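/- Let d ≥ 5. Let f° : [-1,1)^d → ℝ be the indicator function of the closed ball of radius 1/2, i.e. f°(x)=1 if |x| ≤ 1/2 and f°(x)=0 otherwise. For k ∈ ℤ^d let c_k = 2^{-d} ∫_{[-1,1)^d} f°(y) e^{-iπ k·y} dy be the k-th Fourier coefficient of the 2-periodization of f°, and for N ∈ ℕ let S_N(x) = Σ_{k ∈ ℤ^d, |k| < N} c_k e^{iπ k·x} be the spherical partial sum. Then for every x ∈ ℚ^d ∩ [-1,1)^d, the sequence N ↦ S_N(x) − f°(x) does not converge as N → ∞. -/

import Mathlib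

namespace KuratsuboDivergence

open Complex Filter Topology MeasureTheory

/-- Summing a function on `ℤ` over residue classes. -/
theorem tsum_eq_sum_residues {q : ℕ} [NeZero q] {F : ℤ → ℂ} (hF : Summable F) :
    ∑' k, F k = ∑ r : Fin q, ∑' m : ℤ, F (m * q + (r : ℕ)) := by
  have h1 : Summable (fun p : ℤ × Fin q => F (p.1 * q + (p.2 : ℕ))) :=
    ((Int.divModEquiv q).symm.summable_iff (f := F)).2 hF
  have h2 : ∑' k, F k = ∑' p : ℤ × Fin q, F (p.1 * q + (p.2 : ℕ)) :=
    ((Int.divModEquiv q).symm.tsum_eq F).symm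
  rw [h2, h1.tsum_prod]
  simp_rw [tsum_fintype]
  rw [Summable.tsum_finsetSum]
  intro r _
  exact h1.comp_injective (i := fun m : ℤ => (m, r)) (fun a b h => by simpa using h)

theorem sum_fin_natCast_zmod {q : ℕ} [NeZero q] {M : Type*} [AddCommMonoid M] (g : ZMod q → M) :
    ∑ r : Fin q, g ((r : ℕ) : ZMod q) = ∑ s : ZMod q, g s := by
  refine Fintype.sum_equiv (ZMod.finEquiv q).toEquiv _ _ fun r => ?_
  congr 1
  cases q with
  | zero => exact absurd rfl (NeZero.ne 0)
  | succ n =>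
    apply ZMod.val_injective
    rw [ZMod.val_natCast, Nat.mod_eq_of_lt r.2]
    rfl

/-- The norm of a Gaussian term with linear phase is summable. -/
theorem summable_gaussian_phase {a : ℂ} (ha : 0 < a.re) (ξ : ℝ) :
    Summable fun k : ℤ => cexp (2 * Real.pi * I * k * ξ) * cexp (-Real.pi * a * k ^ 2) := by
  have := (summable_jacobiTheta₂_term_iff (ξ : ℂ) (I * a)).2 (by simpa using ha)
  refine this.congr fun k => ?_
  rw [jacobiTheta₂_term, ← Complex.exp_add]
  congr 1
  linear_combination (-(Real.pi : ℂ) * a * k ^ 2) * (-I_sq)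

theorem summable_gaussian_shift {a : ℂ} (ha : 0 < a.re) (y : ℂ) :
    Summable fun k : ℤ => cexp (-Real.pi * a * (k - y) ^ 2) := by
  have := (summable_jacobiTheta₂_term_iff (-I * a * y) (I * a)).2 (by simpa using ha)
  refine (this.mul_left (cexp (-Real.pi * a * y ^ 2))).congr fun k => ?_
  rw [jacobiTheta₂_term, ← Complex.exp_add]
  congr 1
  linear_combination (-(Real.pi : ℂ) * a * k ^ 2 + 2 * Real.pi * a * k * y) * (-I_sq)

theorem summable_weighted_gaussian_phase {a : ℂ} (ha : 0 < a.re) (ξ : ℝ) {q : ℕ} [NeZero q]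
    (f : ZMod q → ℂ) :
    Summable fun k : ℤ => f k * (cexp (2 * Real.pi * I * k * ξ) * cexp (-Real.pi * a * k ^ 2)) := by
  have h := (summable_gaussian_phase ha ξ).norm.mul_left (∑ s, ‖f s‖)
  refine Summable.of_norm_bounded h fun k => ?_
  rw [norm_mul]
  gcongr
  exact Finset.single_le_sum (f := fun s => ‖f s‖) (fun s _ => norm_nonneg _) (Finset.mem_univ _)

/-- Poisson summation for a Gaussian weighted by a periodic function and a linear phase. -/
theorem theta_transform {a : ℂ} (ha : 0 < a.re) (ξ : ℝ) {q : ℕ} [NeZero q] (f : ZMod q → ℂ) :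
    ∑' k : ℤ, f k * (cexp (2 * Real.pi * I * k * ξ) * cexp (-Real.pi * a * k ^ 2)) =
      1 / (q * a ^ (1 / 2 : ℂ)) * ∑' j : ℤ, (∑ s, f s * ZMod.stdAddChar ((j : ZMod q) * s)) *
        cexp (-Real.pi / (a * q ^ 2) * (j - q * ξ) ^ 2) := by
  have hq : (0 : ℝ) < q := by exact_mod_cast Nat.pos_of_ne_zero (NeZero.ne q)
  have hqc : (q : ℂ) ≠ 0 := by exact_mod_cast NeZero.ne q
  have ha0 : a ≠ 0 := by rintro rfl; simp at ha
  have hA : 0 < (a * q ^ 2).re := by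
    have : (a * q ^ 2).re = a.re * q ^ 2 := by
      rw [show (q : ℂ) ^ 2 = ((q ^ 2 : ℝ) : ℂ) by push_cast; rfl, re_mul_ofReal]
    rw [this]; positivity
  have hAs : (a * q ^ 2) ^ (1 / 2 : ℂ) = q * a ^ (1 / 2 : ℂ) := by
    have : a * (q : ℂ) ^ 2 = ((q ^ 2 : ℝ) : ℂ) * a := by push_cast; ring
    have hq2 : (0 : ℝ) < (q : ℝ) ^ 2 := by positivity
    have hne : (((q : ℝ) ^ 2 : ℝ) : ℂ) * a ≠ 0 := mul_ne_zero (by exact_mod_cast hq2.ne') ha0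
    rw [this, Complex.cpow_def_of_ne_zero hne, Complex.cpow_def_of_ne_zero ha0,
      Complex.log_ofReal_mul hq2 ha0, add_mul, Complex.exp_add, Real.log_pow]
    congr 1
    have : (((2 : ℕ) * Real.log q : ℝ) : ℂ) * (1 / 2) = ((Real.log q : ℝ) : ℂ) := by
      push_cast; ring
    rw [this, ← Complex.ofReal_exp, Real.exp_log hq, Complex.ofReal_natCast]
  have key : ∀ r : ℕ, ∑' m : ℤ, cexp (2 * Real.pi * I * (m * q + r) * ξ) *
      cexp (-Real.pi * a * (m * q + r) ^ 2) = 1 / (q * a ^ (1 / 2 : ℂ)) *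
        ∑' j : ℤ, ZMod.stdAddChar ((j : ZMod q) * (r : ZMod q)) *
          cexp (-Real.pi / (a * q ^ 2) * (j - q * ξ) ^ 2) := by
    intro r
    have h := Complex.tsum_exp_neg_quadratic hA (q * (I * ξ - a * r))
    rw [hAs] at h
    have h1 : ∀ m : ℤ, cexp (2 * Real.pi * I * (m * q + r) * ξ) *
      cexp (-Real.pi * a * (m * q + r) ^ 2) =
        cexp (2 * Real.pi * I * r * ξ - Real.pi * a * r ^ 2) *
        cexp (-Real.pi * (a * q ^ 2) * m ^ 2 + 2 * Real.pi * (q * (I * ξ - a * r)) * m) := by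
      intro m
      rw [← Complex.exp_add, ← Complex.exp_add]
      congr 1
      ring
    simp_rw [h1]
    rw [tsum_mul_left, h, mul_left_comm, ← tsum_mul_left]
    congr 1
    refine tsum_congr fun j => ?_
    have h2 : ZMod.stdAddChar ((j : ZMod q) * (r : ZMod q)) = cexp (2 * Real.pi * I * (j * r) / q) := by
      have := ZMod.stdAddChar_coe (N := q) (j * r)
      push_cast at this
      exact this
    rw [h2, ← Complex.exp_add, ← Complex.exp_add]
    congr 1
    field_simp
    ring_nf
    simp only [I_sq, I_pow_four, I_pow_three]
    ring
  rw [tsum_eq_sum_residues (q := q) (summable_weighted_gaussian_phase ha ξ f)]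
  push_cast
  simp only [ZMod.natCast_self, mul_zero, zero_add]
  simp_rw [tsum_mul_left, key]
  rw [Finset.sum_congr rfl fun r _ => mul_left_comm _ _ _, ← Finset.mul_sum]
  congr 1
  have hB : 0 < (1 / (a * q ^ 2)).re := by
    rw [one_div, inv_re]
    exact div_pos hA (Complex.normSq_pos.2 fun h => by rw [h] at hA; simp at hA)
  have hsum : ∀ s : ZMod q, Summable fun j : ℤ => f s * (ZMod.stdAddChar ((j : ZMod q) * s) *
      cexp (-Real.pi / (a * q ^ 2) * (j - q * ξ) ^ 2)) := by
    intro s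
    have h := (summable_gaussian_shift hB (q * ξ)).norm.mul_left ‖f s‖
    refine Summable.of_norm_bounded h fun k => ?_
    rw [norm_mul, norm_mul, ZMod.stdAddChar_apply, Circle.norm_coe, one_mul,
      show -Real.pi / (a * q ^ 2) = -(Real.pi : ℂ) * (1 / (a * q ^ 2)) by ring]
  rw [sum_fin_natCast_zmod fun s => f s * ∑' j : ℤ, ZMod.stdAddChar ((j : ZMod q) * s) *
          cexp (-Real.pi / (a * q ^ 2) * (j - q * ξ) ^ 2)]
  simp_rw [← tsum_mul_left]
  rw [← Summable.tsum_finsetSum fun s _ => hsum s]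
  refine tsum_congr fun j => ?_
  rw [Finset.sum_mul]
  exact Finset.sum_congr rfl fun s _ => by ring

/-- The quadratic Gauss sum with a linear term. -/
noncomputable def quadGauss {q : ℕ} [NeZero q] (h j : ZMod q) : ℂ :=
  ∑ s, ZMod.stdAddChar (h * s ^ 2 + j * s)

theorem conj_stdAddChar {q : ℕ} [NeZero q] (x : ZMod q) :
    (starRingEnd ℂ) (ZMod.stdAddChar x) = ZMod.stdAddChar (-x) := by
  rw [AddChar.map_neg_eq_conj]

theorem norm_stdAddChar {q : ℕ} [NeZero q] (x : ZMod q) :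
    ‖(ZMod.stdAddChar x : ℂ)‖ = 1 := by
  rw [ZMod.stdAddChar_apply, Circle.norm_coe]

theorem quadGauss_norm_sq {q : ℕ} [NeZero q] (h j : ZMod q) :
    ((‖quadGauss h j‖ ^ 2 : ℝ) : ℂ) =
      q * ∑ u with 2 * h * u = 0, ZMod.stdAddChar (h * u ^ 2 + j * u) := by
  have h0 : ((‖quadGauss h j‖ ^ 2 : ℝ) : ℂ) =
      quadGauss h j * (starRingEnd ℂ) (quadGauss h j) := by
    rw [Complex.mul_conj, Complex.normSq_eq_norm_sq]
  rw [h0, quadGauss, map_sum, Finset.sum_mul_sum, Finset.sum_comm]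
  have h1 : ∀ t : ZMod q, ∑ s : ZMod q, (ZMod.stdAddChar (h * s ^ 2 + j * s) : ℂ) *
      (starRingEnd ℂ) (ZMod.stdAddChar (h * t ^ 2 + j * t)) =
      ∑ u : ZMod q, ZMod.stdAddChar (h * u ^ 2 + j * u) *
        ZMod.stdAddChar (t * (2 * h * u)) := by
    intro t
    rw [← Equiv.sum_comp (Equiv.addRight t)]
    refine Finset.sum_congr rfl fun u _ => ?_
    rw [conj_stdAddChar, ← AddChar.map_add_eq_mul, ← AddChar.map_add_eq_mul]
    congr 1
    simp only [Equiv.coe_addRight]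
    ring
  rw [Finset.sum_congr rfl fun t _ => h1 t, Finset.sum_comm, Finset.sum_filter, Finset.mul_sum]
  refine Finset.sum_congr rfl fun u _ => ?_
  rw [← Finset.mul_sum, AddChar.sum_mulShift _ (ZMod.isPrimitive_stdAddChar q)]
  split_ifs <;> simp [ZMod.card, mul_comm]

theorem quadGauss_norm_le {q : ℕ} [NeZero q] {h : ZMod q} (hh : IsUnit h) (j : ZMod q) :
    ‖quadGauss h j‖ ≤ Real.sqrt (2 * q) := by
  apply Real.le_sqrt_of_sq_le
  have h1 := congrArg norm (quadGauss_norm_sq h j)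
  rw [Complex.norm_real, Real.norm_of_nonneg (by positivity), norm_mul, Complex.norm_natCast] at h1
  rw [h1, mul_comm]
  gcongr
  calc ‖∑ u with 2 * h * u = 0, (ZMod.stdAddChar (h * u ^ 2 + j * u) : ℂ)‖
      ≤ ∑ u : ZMod q with 2 * h * u = 0, 1 :=
        norm_sum_le_of_le _ fun u _ => (norm_stdAddChar _).le
    _ = ((Finset.univ.filter fun u : ZMod q => 2 • u = 0).card : ℝ) := by
        rw [Finset.sum_const, nsmul_eq_mul, mul_one]
        congr 2
        ext u
        simp only [Finset.mem_filter, Finset.mem_univ, true_and]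
        rw [mul_comm 2 h, mul_assoc, hh.mul_right_eq_zero, nsmul_eq_mul, Nat.cast_ofNat]
    _ ≤ 2 := by exact_mod_cast IsAddCyclic.card_nsmul_eq_zero_le (α := ZMod q) two_pos

theorem summable_exp_neg_mul_sq {x : ℝ} (hx : 0 < x) :
    Summable fun k : ℤ => Real.exp (-x * k ^ 2) := by
  have h := (summable_gaussian_shift (a := ((x / Real.pi : ℝ) : ℂ))
    (by rw [ofReal_re]; positivity) 0).norm
  refine h.congr fun k => ?_
  rw [Complex.norm_exp]
  congr 1
  have : (-(Real.pi : ℂ) * ((x / Real.pi : ℝ) : ℂ) * ((k : ℂ) - 0) ^ 2) =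
      ((-x * k ^ 2 : ℝ) : ℂ) := by
    push_cast
    field_simp
    ring
  rw [this, ofReal_re]

/-- Shifted Gaussian sums are uniformly bounded. -/
theorem exists_gaussian_sum_bound : ∃ C : ℝ, 0 < C ∧ ∀ x y : ℝ, Real.pi / 4 ≤ x →
    Summable (fun j : ℤ => Real.exp (-x * (j - y) ^ 2)) ∧
    ∑' j : ℤ, Real.exp (-x * (j - y) ^ 2) ≤ C := by
  have hs := summable_exp_neg_mul_sq (x := Real.pi / 8) (by positivity)
  refine ⟨Real.exp (Real.pi / 4) * ∑' j : ℤ, Real.exp (-(Real.pi / 8) * j ^ 2), ?_, ?_⟩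
  · exact mul_pos (Real.exp_pos _) (hs.tsum_pos (fun _ => (Real.exp_pos _).le) 0 (Real.exp_pos _))
  intro x y hx
  have hb : ∀ j : ℤ, Real.exp (-x * (((j + ⌊y⌋ : ℤ) : ℝ) - y) ^ 2) ≤
      Real.exp (Real.pi / 4) * Real.exp (-(Real.pi / 8) * j ^ 2) := by
    intro j
    rw [← Real.exp_add]
    apply Real.exp_le_exp.2
    have h0 := Int.fract_nonneg y
    have h1 := (Int.fract_lt_one y).le
    have h2 : ((j + ⌊y⌋ : ℤ) : ℝ) - y = j - Int.fract y := by
      push_cast; rw [← Int.self_sub_floor]; ring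
    rw [h2]
    have h3 : (j : ℝ) ^ 2 ≤ 2 * (j - Int.fract y) ^ 2 + 2 := by
      nlinarith [sq_nonneg ((j : ℝ) - 2 * Int.fract y), mul_nonneg h0 (sub_nonneg.2 h1)]
    nlinarith [Real.pi_pos, sq_nonneg ((j : ℝ) - Int.fract y)]
  have hsum' : Summable fun j : ℤ => Real.exp (-x * (((j + ⌊y⌋ : ℤ) : ℝ) - y) ^ 2) :=
    Summable.of_nonneg_of_le (fun _ => (Real.exp_pos _).le) hb (hs.mul_left _)
  have hsum : Summable fun j : ℤ => Real.exp (-x * (j - y) ^ 2) :=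
    ((Equiv.addRight ⌊y⌋).summable_iff (f := fun j : ℤ => Real.exp (-x * (j - y) ^ 2))).1 hsum'
  refine ⟨hsum, ?_⟩
  rw [← (Equiv.addRight ⌊y⌋).tsum_eq, ← tsum_mul_left]
  exact hsum'.tsum_le_tsum hb (hs.mul_left _)

theorem norm_gaussian_term {a : ℂ} (q : ℕ) (j : ℤ) (ξ : ℝ) :
    ‖cexp (-Real.pi / (a * q ^ 2) * (j - q * ξ) ^ 2)‖ =
      Real.exp (-(Real.pi * (1 / a).re / q ^ 2) * (j - q * ξ) ^ 2) := by
  rw [Complex.norm_exp]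
  congr 1
  have : (-(Real.pi : ℂ) / (a * q ^ 2) * (j - q * ξ) ^ 2) =
      ((-(Real.pi / q ^ 2) * (j - q * ξ) ^ 2 : ℝ) : ℂ) * (1 / a) := by
    push_cast
    rw [neg_div, div_mul_eq_div_div]
    ring
  rw [this, re_ofReal_mul]
  ring

theorem norm_cpow_half (a : ℂ) : ‖a ^ (1 / 2 : ℂ)‖ = Real.sqrt ‖a‖ := by
  have := Complex.norm_cpow_real a (1 / 2)
  push_cast at this
  rw [this, Real.sqrt_eq_rpow]

/-- Upper bound for a theta function near a rational with denominator `q`. -/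
theorem exists_theta_upper : ∃ C : ℝ, 0 < C ∧ ∀ (q : ℕ) [NeZero q] (h : ZMod q) (ξ : ℝ) (a : ℂ),
    IsUnit h → 0 < a.re → (q : ℝ) ^ 2 / 4 ≤ (1 / a).re →
    ‖∑' k : ℤ, ZMod.stdAddChar (h * (k : ZMod q) ^ 2) *
      (cexp (2 * Real.pi * I * k * ξ) * cexp (-Real.pi * a * k ^ 2))‖ ≤
      C / Real.sqrt (q * ‖a‖) := by
  obtain ⟨C, hC, hb⟩ := exists_gaussian_sum_bound
  refine ⟨Real.sqrt 2 * C, by positivity, ?_⟩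
  intro q _ h ξ a hh ha hR
  have hq : (0 : ℝ) < q := by exact_mod_cast Nat.pos_of_ne_zero (NeZero.ne q)
  have hna : 0 < ‖a‖ := norm_pos_iff.2 (by rintro rfl; simp at ha)
  rw [theta_transform ha ξ (fun s => ZMod.stdAddChar (h * s ^ 2)), norm_mul, norm_div, norm_one,
    norm_mul, norm_cpow_half, Complex.norm_natCast]
  have hx : Real.pi / 4 ≤ Real.pi * (1 / a).re / q ^ 2 := by
    rw [le_div_iff₀ (by positivity)]
    nlinarith [Real.pi_pos]
  obtain ⟨hs, hle⟩ := hb _ (q * ξ) hx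
  have hterm : ∀ j : ℤ, ‖(∑ s : ZMod q, (ZMod.stdAddChar (h * s ^ 2) : ℂ) *
      ZMod.stdAddChar ((j : ZMod q) * s)) * cexp (-Real.pi / (a * q ^ 2) * (j - q * ξ) ^ 2)‖ ≤
      Real.sqrt (2 * q) * Real.exp (-(Real.pi * (1 / a).re / q ^ 2) * (j - q * ξ) ^ 2) := by
    intro j
    rw [norm_mul, norm_gaussian_term]
    gcongr
    have := quadGauss_norm_le hh (j : ZMod q)
    simpa only [quadGauss, AddChar.map_add_eq_mul] using this
  have h2 : ‖∑' j : ℤ, (∑ s : ZMod q, (ZMod.stdAddChar (h * s ^ 2) : ℂ) *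
      ZMod.stdAddChar ((j : ZMod q) * s)) * cexp (-Real.pi / (a * q ^ 2) * (j - q * ξ) ^ 2)‖ ≤
      Real.sqrt (2 * q) * C := by
    refine (tsum_of_norm_bounded (hs.mul_left _).hasSum hterm).trans ?_
    rw [tsum_mul_left]
    gcongr
  calc _ ≤ 1 / (q * Real.sqrt ‖a‖) * (Real.sqrt (2 * q) * C) := by gcongr
    _ = _ := by
      rw [Real.sqrt_mul (by norm_num), Real.sqrt_mul hq.le]
      have := Real.sqrt_pos.2 hq
      have := Real.sqrt_pos.2 hna
      have h3 := Real.mul_self_sqrt hq.le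
      field_simp
      linear_combination h3

/-- The main term of a theta function near a rational with denominator `Q`. -/
theorem exists_theta_main (Q : ℕ) [NeZero Q] : ∃ C : ℝ, 0 < C ∧ ∀ (f : ZMod Q → ℂ) (c : ℤ) (ξ : ℝ)
    (a : ℂ), (∀ s, ‖f s‖ ≤ 1) → Q * ξ = c → 0 < a.re → 1 / 4 ≤ (1 / a).re →
    ‖a ^ (1 / 2 : ℂ) * ∑' k : ℤ, f k *
      (cexp (2 * Real.pi * I * k * ξ) * cexp (-Real.pi * a * k ^ 2)) -
      1 / Q * ∑ s, f s * ZMod.stdAddChar ((c : ZMod Q) * s)‖ ≤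
      C * Real.exp (-(Real.pi / (2 * Q ^ 2)) * (1 / a).re) := by
  have hq : (0 : ℝ) < Q := by exact_mod_cast Nat.pos_of_ne_zero (NeZero.ne Q)
  have hqc : (Q : ℂ) ≠ 0 := by exact_mod_cast NeZero.ne Q
  have hs := summable_exp_neg_mul_sq (x := Real.pi / (8 * Q ^ 2)) (by positivity)
  refine ⟨∑' j : ℤ, Real.exp (-(Real.pi / (8 * Q ^ 2)) * j ^ 2),
    hs.tsum_pos (fun _ => (Real.exp_pos _).le) 0 (Real.exp_pos _), ?_⟩
  intro f c ξ a hf hc ha hR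
  have ha0 : a ≠ 0 := by rintro rfl; simp at ha
  have hsq : a ^ (1 / 2 : ℂ) ≠ 0 := by simp [Complex.cpow_eq_zero_iff, ha0]
  set R := (1 / a).re with hRdef
  set A : ℤ → ℂ := fun j => ∑ s, f s * ZMod.stdAddChar ((j : ZMod Q) * s) with hA
  have hAb : ∀ j, ‖A j‖ ≤ Q := by
    intro j
    calc ‖A j‖ ≤ ∑ s : ZMod Q, 1 := norm_sum_le_of_le _ fun s _ => by
          rw [norm_mul, norm_stdAddChar, mul_one]; exact hf s
      _ = Q := by simp [ZMod.card]
  set T : ℤ → ℂ := fun j => A j * cexp (-Real.pi / (a * Q ^ 2) * (j - Q * ξ) ^ 2) with hT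
  have hTn : ∀ j : ℤ, j ≠ 0 → ‖T (j + c)‖ ≤
      Q * Real.exp (-(Real.pi / (2 * Q ^ 2)) * R) * Real.exp (-(Real.pi / (8 * Q ^ 2)) * j ^ 2) := by
    intro j hj
    rw [hT, norm_mul, norm_gaussian_term, mul_assoc, ← Real.exp_add]
    gcongr
    · exact hAb _
    · have h1 : (1 : ℝ) ≤ (j : ℝ) ^ 2 := by
        have : 1 ≤ j ^ 2 := Int.one_le_abs hj |>.trans (by rw [← sq_abs]; nlinarith [Int.one_le_abs hj])
        exact_mod_cast this
      have h2 : (((j + c : ℤ) : ℝ) - Q * ξ) = j := by push_cast; rw [hc]; ring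
      rw [h2]
      have h3 : Real.pi * (1 / a).re / (Q : ℝ) ^ 2 = Real.pi / Q ^ 2 * R := by rw [hRdef]; ring
      have h4 : Real.pi / (2 * (Q : ℝ) ^ 2) = Real.pi / Q ^ 2 / 2 := by field_simp
      have h5 : Real.pi / (8 * (Q : ℝ) ^ 2) = Real.pi / Q ^ 2 / 8 := by field_simp
      rw [h3, h4, h5]
      have hp : 0 < Real.pi / (Q : ℝ) ^ 2 := by positivity
      set P := Real.pi / (Q : ℝ) ^ 2
      have : 0 ≤ P * ((j : ℝ) ^ 2 * R - R / 2 - (j : ℝ) ^ 2 / 8) := by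
        apply mul_nonneg hp.le
        nlinarith
      nlinarith
  have hT0 : T c = A c := by
    rw [hT]
    simp only
    have : (c : ℂ) - Q * ξ = 0 := by
      rw [sub_eq_zero]; exact_mod_cast hc.symm
    rw [this]; simp
  have hTs : Summable fun j => T (j + c) := by
    refine Summable.of_norm_bounded_eventually (hs.mul_left (Q * Real.exp (-(Real.pi / (2 * Q ^ 2)) * R))) ?_
    rw [Filter.eventually_cofinite]
    refine (Set.finite_singleton (0 : ℤ)).subset fun j hj => ?_
    by_contra hne
    exact hj (hTn j hne)
  have key : ∑' j, T j = A c + ∑' j : ℤ, if j = 0 then 0 else T (j + c) := by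
    rw [← (Equiv.addRight c).tsum_eq]
    simp only [Equiv.coe_addRight]
    rw [hTs.tsum_eq_add_tsum_ite 0, zero_add, hT0]
  rw [theta_transform ha ξ f]
  change ‖a ^ (1 / 2 : ℂ) * (1 / (Q * a ^ (1 / 2 : ℂ)) * ∑' j, T j) - 1 / Q * A c‖ ≤ _
  have : a ^ (1 / 2 : ℂ) * (1 / (Q * a ^ (1 / 2 : ℂ)) * ∑' j, T j) - 1 / Q * A c =
      1 / Q * ∑' j : ℤ, if j = 0 then 0 else T (j + c) := by
    rw [key]; field_simp; ring
  rw [this, norm_mul, norm_div, norm_one, Complex.norm_natCast]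
  have hfin : ‖∑' j : ℤ, if j = 0 then 0 else T (j + c)‖ ≤
      Q * Real.exp (-(Real.pi / (2 * Q ^ 2)) * R) * ∑' j : ℤ, Real.exp (-(Real.pi / (8 * Q ^ 2)) * j ^ 2) := by
    rw [← tsum_mul_left]
    refine tsum_of_norm_bounded (hs.mul_left _).hasSum fun j => ?_
    split_ifs with h
    · rw [norm_zero]; positivity
    · exact hTn j h
  calc _ ≤ 1 / (Q : ℝ) * (Q * Real.exp (-(Real.pi / (2 * Q ^ 2)) * R) *
        ∑' j : ℤ, Real.exp (-(Real.pi / (8 * Q ^ 2)) * j ^ 2)) := by gcongr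
    _ = _ := by field_simp

/-- A one-dimensional theta function. -/
noncomputable def thetaOne (ξ : ℝ) (τ : ℂ) : ℂ :=
  ∑' k : ℤ, cexp (2 * Real.pi * I * k * ξ) * cexp (2 * Real.pi * I * k ^ 2 * τ)

/-- The product of one-dimensional theta functions. -/
noncomputable def thetaD {d : ℕ} (ξ : Fin d → ℝ) (τ : ℂ) : ℂ := ∏ i, thetaOne (ξ i) τ

/-- The local Gaussian parameter on an arc. -/
noncomputable def arcParam (η β : ℝ) : ℂ := 2 * (η - β * I)

theorem arcParam_re (η β : ℝ) : (arcParam η β).re = 2 * η := by simp [arcParam]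

theorem arcParam_norm (η β : ℝ) : ‖arcParam η β‖ = 2 * Real.sqrt (β ^ 2 + η ^ 2) := by
  rw [arcParam, norm_mul, Complex.norm_ofNat]
  congr 1
  rw [Complex.norm_def, Complex.normSq_apply]
  congr 1
  simp
  ring

theorem arcParam_inv_re {η β : ℝ} : (1 / arcParam η β).re = η / (2 * (β ^ 2 + η ^ 2)) := by
  rw [one_div, inv_re, arcParam_re, Complex.normSq_eq_norm_sq, arcParam_norm, mul_pow,
    Real.sq_sqrt (by positivity)]
  rw [show (2 : ℝ) ^ 2 * (β ^ 2 + η ^ 2) = 2 * (2 * (β ^ 2 + η ^ 2)) by ring,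
    mul_div_mul_left _ _ two_ne_zero]

theorem thetaOne_arc (ξ : ℝ) {q : ℕ} [NeZero q] (h : ℤ) (η β : ℝ) :
    thetaOne ξ (((h / q + β : ℝ) : ℂ) + η * I) =
      ∑' k : ℤ, ZMod.stdAddChar ((h : ZMod q) * (k : ZMod q) ^ 2) *
      (cexp (2 * Real.pi * I * k * ξ) * cexp (-Real.pi * arcParam η β * k ^ 2)) := by
  refine tsum_congr fun k => ?_
  have h2 : ZMod.stdAddChar ((h : ZMod q) * (k : ZMod q) ^ 2) =
      cexp (2 * Real.pi * I * (h * k ^ 2) / q) := by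
    have := ZMod.stdAddChar_coe (N := q) (h * k ^ 2)
    push_cast at this
    exact this
  have hqc : (q : ℂ) ≠ 0 := by exact_mod_cast NeZero.ne q
  rw [h2, ← Complex.exp_add, ← Complex.exp_add, ← Complex.exp_add]
  congr 1
  rw [arcParam]
  push_cast
  field_simp
  ring_nf
  simp only [I_sq]
  ring

theorem exists_thetaD_upper {d : ℕ} (hd : 4 ≤ d) (ξ : Fin d → ℝ) : ∃ C : ℝ, 0 < C ∧
    ∀ (N q : ℕ) (h : ℤ) (β : ℝ), 0 < q → q ≤ N → IsCoprime h q → |β| ≤ 1 / (q * N) →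
    ‖thetaD ξ (((h / q + β : ℝ) : ℂ) + ((1 / (N : ℝ) ^ 2 : ℝ) : ℂ) * I)‖ ≤
      C * N ^ (d - 4) / (Real.sqrt q ^ d * (β ^ 2 + (1 / (N : ℝ) ^ 2) ^ 2)) := by
  obtain ⟨C, hC, hb⟩ := exists_theta_upper
  refine ⟨C ^ d, by positivity, ?_⟩
  intro N q h β hq hqN hco hβ
  have : NeZero q := ⟨hq.ne'⟩
  have hN : 0 < N := hq.trans_le hqN
  have hNr : (0 : ℝ) < N := by exact_mod_cast hN
  have hqr : (0 : ℝ) < q := by exact_mod_cast hq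
  have hqNr : (q : ℝ) ≤ N := by exact_mod_cast hqN
  set η : ℝ := 1 / (N : ℝ) ^ 2 with hη
  have hη0 : 0 < η := by positivity
  have hβ2 : β ^ 2 ≤ 1 / (q * N) ^ 2 := by
    rw [← sq_abs, show (1 : ℝ) / (q * N) ^ 2 = (1 / (q * N)) ^ 2 by rw [div_pow, one_pow]]
    exact pow_le_pow_left₀ (abs_nonneg _) hβ 2
  have hη2 : η ^ 2 ≤ 1 / ((q : ℝ) * N) ^ 2 := by
    rw [hη, div_pow, one_pow]
    apply one_div_le_one_div_of_le (by positivity)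
    rw [← pow_mul, show 2 * 2 = 2 + 2 by rfl, pow_add, mul_pow]
    gcongr
  have hR : (q : ℝ) ^ 2 / 4 ≤ (1 / arcParam η β).re := by
    rw [arcParam_inv_re, le_div_iff₀ (by positivity)]
    have h1 : (β ^ 2 + η ^ 2) ≤ 2 * (1 / ((q : ℝ) * N) ^ 2) := by linarith
    calc (q : ℝ) ^ 2 / 4 * (2 * (β ^ 2 + η ^ 2)) ≤
        (q : ℝ) ^ 2 / 4 * (2 * (2 * (1 / ((q : ℝ) * N) ^ 2))) := by gcongr
      _ = η := by rw [hη]; field_simp; norm_num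
  have hunit : IsUnit (h : ZMod q) := by
    obtain ⟨u, v, huv⟩ := hco
    refine isUnit_iff_exists_inv'.2 ⟨(u : ZMod q), ?_⟩
    have := congrArg (Int.cast : ℤ → ZMod q) huv
    push_cast at this
    simpa using this
  have hone : ∀ i, ‖thetaOne (ξ i) (((h / q + β : ℝ) : ℂ) + (η : ℂ) * I)‖ ≤
      C / Real.sqrt (q * ‖arcParam η β‖) := by
    intro i
    rw [thetaOne_arc]
    exact hb q (h : ZMod q) (ξ i) _ hunit (by rw [arcParam_re]; positivity) hR
  rw [thetaD, norm_prod]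
  set W : ℝ := β ^ 2 + η ^ 2 with hW
  have hW0 : 0 < W := by positivity
  have hWη : η ≤ Real.sqrt W := Real.le_sqrt_of_sq_le (by rw [hW]; nlinarith [sq_nonneg β])
  calc ∏ i, ‖thetaOne (ξ i) (((h / q + β : ℝ) : ℂ) + (η : ℂ) * I)‖
      ≤ ∏ _i : Fin d, C / Real.sqrt (q * ‖arcParam η β‖) :=
        Finset.prod_le_prod (fun _ _ => norm_nonneg _) fun i _ => hone i
    _ = C ^ d / (Real.sqrt q ^ d * Real.sqrt ‖arcParam η β‖ ^ d) := by
        rw [Finset.prod_const, Finset.card_univ, Fintype.card_fin, div_pow,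
          Real.sqrt_mul hqr.le, mul_pow]
    _ ≤ C ^ d / (Real.sqrt q ^ d * (W / N ^ (d - 4))) := by
        gcongr
        obtain ⟨e, rfl⟩ := Nat.exists_eq_add_of_le hd
        rw [Nat.add_sub_cancel_left, pow_add, div_eq_mul_one_div]
        have h1 : Real.sqrt ‖arcParam η β‖ ^ 4 = 4 * W := by
          rw [show 4 = 2 * 2 by rfl, pow_mul, Real.sq_sqrt (norm_nonneg _), arcParam_norm, mul_pow,
            Real.sq_sqrt hW0.le]
          norm_num
        have h2 : 1 / (N : ℝ) ≤ Real.sqrt ‖arcParam η β‖ := by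
          apply Real.le_sqrt_of_sq_le
          rw [arcParam_norm, div_pow, one_pow]
          linarith [Real.sqrt_nonneg W]
        rw [h1]
        have h3 : 1 / (N : ℝ) ^ e ≤ Real.sqrt ‖arcParam η β‖ ^ e := by
          rw [← one_div_pow]
          exact pow_le_pow_left₀ (by positivity) h2 e
        gcongr
        linarith
    _ = _ := by field_simp

theorem norm_prod_sub_prod_le {ι : Type*} (s : Finset ι) (X Y : ι → ℂ) {M ε : ℝ} (hM : 1 ≤ M)
    (hX : ∀ i, ‖X i‖ ≤ M) (hY : ∀ i, ‖Y i‖ ≤ M) (hXY : ∀ i, ‖X i - Y i‖ ≤ ε) :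
    ‖∏ i ∈ s, X i - ∏ i ∈ s, Y i‖ ≤ s.card * M ^ s.card * ε := by
  classical
  induction s using Finset.induction_on with
  | empty => simp
  | insert a s ha ih =>
    have hε : 0 ≤ ε := (norm_nonneg _).trans (hXY a)
    rw [Finset.prod_insert ha, Finset.prod_insert ha, Finset.card_insert_of_notMem ha]
    have h1 : X a * ∏ i ∈ s, X i - Y a * ∏ i ∈ s, Y i =
        X a * (∏ i ∈ s, X i - ∏ i ∈ s, Y i) + (X a - Y a) * ∏ i ∈ s, Y i := by ring
    have h2 : ‖∏ i ∈ s, Y i‖ ≤ M ^ s.card := by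
      rw [norm_prod]
      exact (Finset.prod_le_prod (fun _ _ => norm_nonneg _) fun i _ => hY i).trans (by simp)
    have hpow : M ^ s.card ≤ M ^ (s.card + 1) := pow_le_pow_right₀ hM (Nat.le_succ _)
    have hMp : 0 ≤ M := by linarith
    calc _ ≤ ‖X a‖ * ‖∏ i ∈ s, X i - ∏ i ∈ s, Y i‖ + ‖X a - Y a‖ * ‖∏ i ∈ s, Y i‖ := by
          rw [h1, ← norm_mul, ← norm_mul]; exact norm_add_le _ _
      _ ≤ M * (s.card * M ^ s.card * ε) + ε * M ^ (s.card + 1) := by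
          gcongr
          · exact hX a
          · exact hXY a
          · exact h2.trans hpow
      _ = _ := by push_cast; ring

/-- The normalised product of quadratic Gauss sums attached to the phases `A i / B`. -/
noncomputable def gaussProd {d : ℕ} (A : Fin d → ℤ) (B Q : ℕ) [NeZero Q] (h : ZMod Q) : ℂ :=
  ∏ i, 1 / (Q : ℂ) * quadGauss h ((A i * (Q / B : ℕ) : ℤ) : ZMod Q)

theorem norm_gaussFactor_le {Q : ℕ} [NeZero Q] (h j : ZMod Q) :
    ‖1 / (Q : ℂ) * quadGauss h j‖ ≤ 1 := by
  have hq : (0 : ℝ) < Q := by exact_mod_cast Nat.pos_of_ne_zero (NeZero.ne Q)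
  have : ‖quadGauss h j‖ ≤ Q := by
    calc ‖quadGauss h j‖ ≤ ∑ s : ZMod Q, 1 :=
          norm_sum_le_of_le _ fun s _ => (norm_stdAddChar _).le
      _ = Q := by simp [ZMod.card]
  rw [norm_mul, norm_div, norm_one, Complex.norm_natCast, one_div, ← div_eq_inv_mul]
  exact (div_le_one hq).2 this

theorem norm_gaussProd_le {d : ℕ} (A : Fin d → ℤ) (B Q : ℕ) [NeZero Q] (h : ZMod Q) :
    ‖gaussProd A B Q h‖ ≤ 1 := by
  rw [gaussProd, norm_prod]
  exact Finset.prod_le_one (fun _ _ => norm_nonneg _) fun i _ => norm_gaussFactor_le _ _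

theorem exp_neg_mul_pow_le (d : ℕ) {c t : ℝ} (hc : 0 < c) (ht : 0 ≤ t) :
    Real.exp (-(c * t ^ 4)) * t ^ d ≤ 1 + d.factorial / c ^ d := by
  have h1 : t ^ d ≤ 1 + (t ^ 4) ^ d := by
    rcases le_total t 1 with h | h
    · have := pow_le_one₀ ht h (n := d)
      have : 0 ≤ (t ^ 4) ^ d := by positivity
      linarith
    · rw [← pow_mul]
      have := pow_le_pow_right₀ h (show d ≤ 4 * d by omega)
      linarith
  have h2 : (c * t ^ 4) ^ d ≤ d.factorial * Real.exp (c * t ^ 4) := by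
    have := Real.pow_div_factorial_le_exp (c * t ^ 4) (by positivity) d
    rw [div_le_iff₀ (by positivity)] at this
    linarith
  have h3 : (t ^ 4) ^ d ≤ d.factorial / c ^ d * Real.exp (c * t ^ 4) := by
    rw [mul_pow] at h2
    rw [div_mul_eq_mul_div, le_div_iff₀ (by positivity)]
    linarith
  have h4 : Real.exp (-(c * t ^ 4)) ≤ 1 := Real.exp_le_one_iff.2 (by have := pow_nonneg ht 4; nlinarith)
  calc _ ≤ Real.exp (-(c * t ^ 4)) * (1 + d.factorial / c ^ d * Real.exp (c * t ^ 4)) := by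
        gcongr; linarith
    _ = Real.exp (-(c * t ^ 4)) + d.factorial / c ^ d * (Real.exp (-(c * t ^ 4)) * Real.exp (c * t ^ 4)) := by ring
    _ ≤ _ := by rw [← Real.exp_add]; simp only [neg_add_cancel, Real.exp_zero, mul_one]; linarith

theorem exists_thetaD_main {d : ℕ} (A : Fin d → ℤ) (B Q : ℕ) [NeZero Q] (hB : B ∣ Q) :
    ∃ C : ℝ, 0 < C ∧ ∀ (N : ℕ) (h : ℤ) (β : ℝ), 0 < N → |β| ≤ 1 / N →
    ‖thetaD (fun i => (A i : ℝ) / B) (((h / Q + β : ℝ) : ℂ) + ((1 / (N : ℝ) ^ 2 : ℝ) : ℂ) * I) -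
      gaussProd A B Q h / (arcParam (1 / (N : ℝ) ^ 2) β ^ (1 / 2 : ℂ)) ^ d‖ ≤
      C * Real.sqrt N ^ d := by
  obtain ⟨C, hC, hb⟩ := exists_theta_main Q
  have hQ : (0 : ℝ) < Q := by exact_mod_cast Nat.pos_of_ne_zero (NeZero.ne Q)
  set c : ℝ := Real.pi / (2 * Q ^ 2) with hc
  have hc0 : 0 < c := by positivity
  refine ⟨d * (C + 1) ^ d * C * (1 + d.factorial / (c / 8) ^ d) + 1, by positivity, ?_⟩
  intro N h β hN hβ
  have hNr : (0 : ℝ) < N := by exact_mod_cast hN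
  have hN1 : (1 : ℝ) ≤ N := by exact_mod_cast hN
  set η : ℝ := 1 / (N : ℝ) ^ 2 with hη
  have hη0 : 0 < η := by positivity
  have hη1 : η ≤ 1 := by rw [hη, div_le_one (by positivity)]; exact one_le_pow₀ hN1
  set a := arcParam η β with ha
  have hre : 0 < a.re := by rw [ha, arcParam_re]; positivity
  have ha0 : a ≠ 0 := by intro h0; rw [h0] at hre; simp at hre
  set W : ℝ := β ^ 2 + η ^ 2 with hW
  have hW0 : 0 < W := by positivity
  have hβ2 : β ^ 2 ≤ η := by
    rw [← sq_abs, hη, show (1 : ℝ) / N ^ 2 = (1 / N) ^ 2 by rw [div_pow, one_pow]]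
    exact pow_le_pow_left₀ (abs_nonneg _) hβ 2
  have hR : 1 / 4 ≤ (1 / a).re := by
    rw [ha, arcParam_inv_re, le_div_iff₀ (by positivity)]
    nlinarith
  have hone : ∀ i, ‖a ^ (1 / 2 : ℂ) * thetaOne ((A i : ℝ) / B) (((h / Q + β : ℝ) : ℂ) + (η : ℂ) * I) -
      1 / (Q : ℂ) * quadGauss (h : ZMod Q) ((A i * (Q / B : ℕ) : ℤ) : ZMod Q)‖ ≤
      C * Real.exp (-c * (1 / a).re) := by
    intro i
    rw [thetaOne_arc]
    have := hb (fun s => ZMod.stdAddChar ((h : ZMod Q) * s ^ 2)) (A i * (Q / B : ℕ)) ((A i : ℝ) / B) a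
      (fun s => (norm_stdAddChar _).le) (by
        obtain ⟨m, rfl⟩ := hB
        have hB0 : 0 < B := Nat.pos_of_ne_zero fun h0 => NeZero.ne (B * m) (by simp [h0])
        have hB1 : (B : ℝ) ≠ 0 := by exact_mod_cast hB0.ne'
        rw [Nat.mul_div_cancel_left _ hB0]
        push_cast
        field_simp) hre hR
    simpa only [quadGauss, AddChar.map_add_eq_mul] using this
  set ε := C * Real.exp (-c * (1 / a).re) with hε
  have hεC : ε ≤ C := by
    have : Real.exp (-c * (1 / a).re) ≤ 1 := Real.exp_le_one_iff.2 (by nlinarith)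
    rw [hε]; nlinarith
  have hprod := norm_prod_sub_prod_le Finset.univ
    (fun i => a ^ (1 / 2 : ℂ) * thetaOne ((A i : ℝ) / B) (((h / Q + β : ℝ) : ℂ) + (η : ℂ) * I))
    (fun i => 1 / (Q : ℂ) * quadGauss (h : ZMod Q) ((A i * (Q / B : ℕ) : ℤ) : ZMod Q))
    (M := C + 1) (ε := ε) (by linarith) (fun i => by
      have h1 := hone i
      have h2 := norm_gaussFactor_le (h : ZMod Q) ((A i * (Q / B : ℕ) : ℤ) : ZMod Q)
      have h3 := norm_le_norm_add_norm_sub' (a ^ (1 / 2 : ℂ) * thetaOne ((A i : ℝ) / B)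
        (((h / Q + β : ℝ) : ℂ) + (η : ℂ) * I)) (1 / (Q : ℂ) * quadGauss (h : ZMod Q) ((A i * (Q / B : ℕ) : ℤ) : ZMod Q))
      linarith) (fun i => (norm_gaussFactor_le _ _).trans (by linarith)) hone
  rw [Finset.prod_mul_distrib, Finset.prod_const, Finset.card_univ, Fintype.card_fin] at hprod
  set r := a ^ (1 / 2 : ℂ) with hr
  have hr0 : r ≠ 0 := by simp [hr, Complex.cpow_eq_zero_iff, ha0]
  change ‖r ^ d * thetaD _ _ - gaussProd A B Q h‖ ≤ _ at hprod
  set Θ := thetaD (fun i => (A i : ℝ) / B) (((h / Q + β : ℝ) : ℂ) + (η : ℂ) * I) with hΘ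
  have h1 : Θ - gaussProd A B Q h / r ^ d = (r ^ d * Θ - gaussProd A B Q h) / r ^ d := by
    field_simp
  have hu : ‖r‖ = Real.sqrt ‖a‖ := norm_cpow_half a
  have hu0 : 0 < ‖r‖ := norm_pos_iff.2 hr0
  rw [h1, norm_div, norm_pow]
  set u := ‖r‖ with hudef
  set t := 1 / (u * Real.sqrt N) with ht
  have hsN : 0 < Real.sqrt N := Real.sqrt_pos.2 hNr
  have ht0 : 0 < t := by positivity
  have hu4 : u ^ 4 = 4 * W := by
    rw [hu, show 4 = 2 * 2 by rfl, pow_mul, Real.sq_sqrt (norm_nonneg _), ha, arcParam_norm, mul_pow,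
      Real.sq_sqrt hW0.le]
    norm_num
  have hRt : (1 / a).re = 2 * t ^ 4 := by
    have hs4 : Real.sqrt N ^ 4 = (N : ℝ) ^ 2 := by
      rw [show 4 = 2 * 2 by rfl, pow_mul, Real.sq_sqrt hNr.le]
    have ht4 : t ^ 4 = 1 / (4 * W * N ^ 2) := by rw [ht, div_pow, mul_pow, hu4, hs4, one_pow]
    rw [ha, arcParam_inv_re, ht4, ← hW, hη]
    field_simp
    norm_num
  have hexp := exp_neg_mul_pow_le d (c := c / 8) (by positivity) ht0.le
  have hexp' : Real.exp (-c * (1 / a).re) ≤ Real.exp (-(c / 8 * t ^ 4)) := by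
    apply Real.exp_le_exp.2
    rw [hRt]
    have : 0 < c * t ^ 4 := by positivity
    nlinarith
  have hud : 1 / u ^ d = t ^ d * Real.sqrt N ^ d := by
    rw [← mul_pow, ht, ← one_div_pow]
    congr 1
    field_simp
  calc ‖r ^ d * Θ - gaussProd A B Q h‖ / u ^ d ≤ (d * (C + 1) ^ d * ε) * (1 / u ^ d) := by
        rw [div_eq_mul_one_div]; gcongr
    _ = d * (C + 1) ^ d * C * (Real.exp (-c * (1 / a).re) * t ^ d) * Real.sqrt N ^ d := by
        rw [hud, hε]; ring
    _ ≤ d * (C + 1) ^ d * C * (1 + d.factorial / (c / 8) ^ d) * Real.sqrt N ^ d := by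
        gcongr
        exact (mul_le_mul_of_nonneg_right hexp' (by positivity)).trans hexp
    _ ≤ _ := by
        gcongr
        linarith

/-- The difference between the theta function and its main term on an arc. -/
noncomputable def arcError {d : ℕ} (A : Fin d → ℤ) (B Q : ℕ) [NeZero Q] (N : ℕ) (h : ℤ) (β : ℝ) : ℂ :=
  thetaD (fun i => (A i : ℝ) / B) (((h / Q + β : ℝ) : ℂ) + ((1 / (N : ℝ) ^ 2 : ℝ) : ℂ) * I) -
      gaussProd A B Q h / (arcParam (1 / (N : ℝ) ^ 2) β ^ (1 / 2 : ℂ)) ^ d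

theorem exists_arcError_bound {d : ℕ} (hd : 4 ≤ d) (A : Fin d → ℤ) (B : ℕ) : ∃ C : ℝ, 0 < C ∧
    ∀ (Q : ℕ) [NeZero Q], B ∣ Q → ∃ C' : ℝ, 0 < C' ∧ ∀ (N : ℕ) (h : ℤ) (β : ℝ), 2 * Q < N →
    |β| ≤ 1 / (2 * Q) → ‖arcError A B Q N h β‖ ≤ C' * Real.sqrt N ^ d ∨
    ∃ (q : ℕ) (h' : ℤ), 0 < q ∧ q ≤ N ∧ ¬ q ∣ Q ∧ IsCoprime h' q ∧
      |(h / Q + β) - h' / q| ≤ 1 / (q * N) ∧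
      ‖arcError A B Q N h β‖ ≤ C' * Real.sqrt N ^ d + C * N ^ (d - 4) /
        (Real.sqrt q ^ d * (((h / Q + β) - h' / q) ^ 2 + (1 / (N : ℝ) ^ 2) ^ 2)) := by
  obtain ⟨C, hC, hup⟩ := exists_thetaD_upper hd (fun i => (A i : ℝ) / B)
  refine ⟨C, hC, ?_⟩
  intro Q _ hB
  obtain ⟨C', hC', hmain⟩ := exists_thetaD_main A B Q hB
  refine ⟨C' + 1, by positivity, ?_⟩
  intro N h β hN hβ
  have hQ0 : 0 < Q := Nat.pos_of_ne_zero (NeZero.ne Q)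
  have hQ : (0 : ℝ) < Q := by exact_mod_cast hQ0
  have hN0 : 0 < N := by omega
  have hNr : (0 : ℝ) < N := by exact_mod_cast hN0
  have hNQ : 2 * (Q : ℝ) < N := by exact_mod_cast hN
  have hsN : 0 < Real.sqrt N := Real.sqrt_pos.2 hNr
  by_cases hβN : |β| ≤ 1 / N
  · left
    refine (hmain N h β hN0 hβN).trans ?_
    have : 0 ≤ Real.sqrt N ^ d := by positivity
    linarith
  right
  push Not at hβN
  obtain ⟨r, hr1, hr2⟩ := Real.exists_rat_abs_sub_le_and_den_le ((h : ℝ) / Q + β) hN0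
  have hrden : 0 < r.den := r.den_pos
  have hrdr : (0 : ℝ) < r.den := by exact_mod_cast hrden
  have hrdr1 : (1 : ℝ) ≤ r.den := by exact_mod_cast hrden
  have hrcast : (r : ℝ) = (r.num : ℝ) / r.den := Rat.cast_def r
  have hclose : |((h : ℝ) / Q + β) - (r.num : ℝ) / r.den| ≤ 1 / (r.den * N) := by
    rw [← hrcast]
    refine hr1.trans (one_div_le_one_div_of_le (by positivity) ?_)
    nlinarith
  have hcop : IsCoprime r.num (r.den : ℤ) := by
    rw [Int.isCoprime_iff_gcd_eq_one]; exact r.reduced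
  refine ⟨r.den, r.num, hrden, hr2, ?_, hcop, hclose, ?_⟩
  · rintro ⟨m, hm⟩
    have hm0 : 0 < m := Nat.pos_of_ne_zero fun h0 => by simp [h0] at hm; omega
    have hQm : (Q : ℝ) = r.den * m := by exact_mod_cast hm
    have hmr : (0 : ℝ) < m := by exact_mod_cast hm0
    have hclose' : |((h : ℝ) / Q + β) - (r.num : ℝ) / r.den| ≤ 1 / N := by
      refine hclose.trans (one_div_le_one_div_of_le hNr ?_)
      nlinarith
    have heq : ((h : ℝ) / Q + β) - (r.num : ℝ) / r.den = β + ((h - r.num * m : ℤ) : ℝ) / Q := by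
      rw [hQm]; push_cast; field_simp; ring
    rw [heq] at hclose'
    by_cases hz : h - r.num * m = 0
    · rw [hz] at hclose'
      simp at hclose'
      rw [← one_div] at hclose'
      exact absurd hclose' (not_le.2 hβN)
    · have h1 : (1 : ℝ) ≤ |((h - r.num * m : ℤ) : ℝ)| := by
        exact_mod_cast Int.one_le_abs hz
      have h2 : 1 / (Q : ℝ) ≤ |((h - r.num * m : ℤ) : ℝ) / Q| := by
        rw [abs_div, abs_of_pos hQ]
        gcongr
      have h3 : |((h - r.num * m : ℤ) : ℝ) / Q| - |β| ≤ |β + ((h - r.num * m : ℤ) : ℝ) / Q| := by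
        have := abs_sub_abs_le_abs_sub (((h - r.num * m : ℤ) : ℝ) / Q) (-β)
        rw [abs_neg, sub_neg_eq_add, add_comm] at this
        linarith
      have h4 : 1 / (N : ℝ) < 1 / (2 * Q) := one_div_lt_one_div_of_lt (by positivity) hNQ
      have h5 : 1 / (Q : ℝ) = 1 / (2 * Q) + 1 / (2 * Q) := by field_simp; norm_num
      linarith
  · have h1 := hup N r.den r.num (((h : ℝ) / Q + β) - (r.num : ℝ) / r.den) hrden hr2 hcop hclose
    rw [add_sub_cancel] at h1
    have h2 : ‖gaussProd A B Q h / (arcParam (1 / (N : ℝ) ^ 2) β ^ (1 / 2 : ℂ)) ^ d‖ ≤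
        Real.sqrt N ^ d := by
      rw [norm_div, norm_pow, norm_cpow_half]
      have h3 : 1 / (N : ℝ) ≤ ‖arcParam (1 / (N : ℝ) ^ 2) β‖ := by
        rw [arcParam_norm]
        have : |β| ≤ Real.sqrt (β ^ 2 + (1 / (N : ℝ) ^ 2) ^ 2) := by
          apply Real.le_sqrt_of_sq_le
          rw [sq_abs]
          have : 0 ≤ (1 / (N : ℝ) ^ 2) ^ 2 := by positivity
          linarith
        linarith [abs_nonneg β]
      have h4 : 1 / Real.sqrt N ≤ Real.sqrt ‖arcParam (1 / (N : ℝ) ^ 2) β‖ := by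
        rw [← Real.sqrt_one, ← Real.sqrt_div zero_le_one]
        rw [Real.sqrt_one]
        exact Real.sqrt_le_sqrt h3
      have h4' := pow_le_pow_left₀ (by positivity) h4 d
      calc _ ≤ 1 / (1 / Real.sqrt N) ^ d := by
            gcongr
            exact norm_gaussProd_le A B Q _
        _ = _ := by rw [div_pow, one_pow, one_div_one_div]
    calc _ ≤ _ := norm_sub_le _ _
      _ ≤ _ := by
        have : 0 < C' * Real.sqrt N ^ d := by positivity
        linarith

theorem prod_tsum_eq_tsum_prod {d : ℕ} (f : Fin d → ℤ → ℂ) (hf : ∀ i, Summable fun k => ‖f i k‖) :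
    (Summable fun k : Fin d → ℤ => ‖∏ i, f i (k i)‖) ∧
      ∏ i, ∑' k, f i k = ∑' k : Fin d → ℤ, ∏ i, f i (k i) := by
  induction d with
  | zero =>
    refine ⟨Summable.of_finite, ?_⟩
    simp
  | succ d ih =>
    obtain ⟨h1, h2⟩ := ih (fun i => f i.succ) fun i => hf i.succ
    have hs : Summable fun p : ℤ × (Fin d → ℤ) => ‖f 0 p.1 * ∏ i, f (Fin.succ i) (p.2 i)‖ :=
      Summable.mul_norm (f := f 0) (g := fun k : Fin d → ℤ => ∏ i, f (Fin.succ i) (k i)) (hf 0) h1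
    have hcons : ∀ p : ℤ × (Fin d → ℤ), ∏ i, f i ((Fin.consEquiv fun _ => ℤ) p i) =
        f 0 p.1 * ∏ i, f (Fin.succ i) (p.2 i) := by
      intro p
      rw [Fin.prod_univ_succ]
      simp [Fin.consEquiv]
    constructor
    · rw [← (Fin.consEquiv fun _ => ℤ).summable_iff]
      refine hs.congr fun p => ?_
      rw [Function.comp_apply, hcons]
    · rw [Fin.prod_univ_succ, h2, tsum_mul_tsum_of_summable_norm (hf 0) h1,
        ← (Fin.consEquiv fun _ => ℤ).tsum_eq]
      exact tsum_congr fun p => (hcons p).symm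

/-- The phase attached to a lattice point. -/
noncomputable def latticePhase {d : ℕ} (ξ : Fin d → ℝ) (k : Fin d → ℤ) : ℂ :=
  cexp (2 * Real.pi * I * ∑ i, (k i : ℂ) * ξ i)

theorem norm_latticePhase {d : ℕ} (ξ : Fin d → ℝ) (k : Fin d → ℤ) : ‖latticePhase ξ k‖ = 1 := by
  rw [latticePhase]
  have : (2 * Real.pi * I * ∑ i, (k i : ℂ) * ξ i) =
      ((2 * Real.pi * ∑ i, (k i : ℝ) * ξ i : ℝ) : ℂ) * I := by
    push_cast; ring
  rw [this, Complex.norm_exp_ofReal_mul_I]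

/-- The sum of phases over lattice points on the sphere of radius `√n`. -/
noncomputable def sphereSum {d : ℕ} (ξ : Fin d → ℝ) (n : ℕ) : ℂ :=
  ∑' k : Fin d → ℤ, if ∑ i, k i ^ 2 = (n : ℤ) then latticePhase ξ k else 0

theorem norm_thetaOne_term (ξ : ℝ) (k : ℤ) (α η : ℝ) :
    ‖cexp (2 * Real.pi * I * k * ξ) * cexp (2 * Real.pi * I * k ^ 2 * (α + η * I))‖ =
      Real.exp (-(2 * Real.pi * η) * k ^ 2) := by
  rw [← Complex.exp_add, Complex.norm_exp]
  congr 1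
  have : 2 * Real.pi * I * k * ξ + 2 * Real.pi * I * k ^ 2 * (α + η * I) =
      ((-(2 * Real.pi * η) * k ^ 2 : ℝ) : ℂ) +
        ((2 * Real.pi * k * ξ + 2 * Real.pi * k ^ 2 * α : ℝ) : ℂ) * I := by
    push_cast
    ring_nf
    simp only [I_sq]
    ring
  rw [this, add_re, re_ofReal_mul, ofReal_re, I_re, mul_zero, add_zero]

theorem thetaD_eq_tsum {d : ℕ} (ξ : Fin d → ℝ) {η : ℝ} (hη : 0 < η) (α : ℝ) :
    thetaD ξ (α + η * I) = ∑' k : Fin d → ℤ, latticePhase ξ k *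
      cexp (2 * Real.pi * I * ((∑ i, k i ^ 2 : ℤ) : ℂ) * (α + η * I)) := by
  have h := (prod_tsum_eq_tsum_prod (fun i (k : ℤ) => cexp (2 * Real.pi * I * k * ξ i) *
    cexp (2 * Real.pi * I * k ^ 2 * (α + η * I))) fun i => by
      simp_rw [norm_thetaOne_term]
      exact summable_exp_neg_mul_sq (by positivity)).2
  rw [thetaD]
  refine h.trans (tsum_congr fun k => ?_)
  rw [Finset.prod_mul_distrib, ← Complex.exp_sum, ← Complex.exp_sum, latticePhase]
  congr 2
  · rw [Finset.mul_sum]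
    exact Finset.sum_congr rfl fun i _ => by ring
  · push_cast
    rw [Finset.mul_sum, Finset.sum_mul]

theorem summable_lattice_gaussian (d : ℕ) {η : ℝ} (hη : 0 < η) :
    Summable fun k : Fin d → ℤ => Real.exp (-(2 * Real.pi * η) * ((∑ i, k i ^ 2 : ℤ) : ℝ)) := by
  have h := (prod_tsum_eq_tsum_prod (fun (_ : Fin d) (k : ℤ) =>
    ((Real.exp (-(2 * Real.pi * η) * k ^ 2) : ℝ) : ℂ)) fun i => by
      simp_rw [Complex.norm_real, Real.norm_of_nonneg (Real.exp_pos _).le]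
      exact summable_exp_neg_mul_sq (by positivity)).1
  refine h.congr fun k => ?_
  rw [norm_prod]
  simp_rw [Complex.norm_real, Real.norm_of_nonneg (Real.exp_pos _).le]
  rw [← Real.exp_sum]
  push_cast
  rw [Finset.mul_sum]

theorem norm_lattice_term {d : ℕ} (ξ : Fin d → ℝ) (k : Fin d → ℤ) (α η : ℝ) :
    ‖latticePhase ξ k * cexp (2 * Real.pi * I * ((∑ i, k i ^ 2 : ℤ) : ℂ) * (α + η * I))‖ =
      Real.exp (-(2 * Real.pi * η) * ((∑ i, k i ^ 2 : ℤ) : ℝ)) := by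
  rw [norm_mul, norm_latticePhase, one_mul, Complex.norm_exp]
  congr 1
  set m : ℤ := ∑ i, k i ^ 2
  have : 2 * Real.pi * I * (m : ℂ) * (α + η * I) =
      ((-(2 * Real.pi * η) * m : ℝ) : ℂ) + ((2 * Real.pi * m * α : ℝ) : ℂ) * I := by
    push_cast
    ring_nf
    simp only [I_sq]
    ring
  rw [this, add_re, re_ofReal_mul, ofReal_re, I_re, mul_zero, add_zero]

theorem continuous_thetaD {d : ℕ} (ξ : Fin d → ℝ) {η : ℝ} (hη : 0 < η) :
    Continuous fun α : ℝ => thetaD ξ (α + η * I) := by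
  simp_rw [thetaD_eq_tsum ξ hη]
  refine continuous_tsum (fun k => by fun_prop) (summable_lattice_gaussian d hη) fun k α => ?_
  rw [norm_lattice_term]

theorem integral_exp_period (x : ℝ) (m : ℤ) :
    ∫ α in x..x + 1, cexp (2 * Real.pi * I * m * α) = if m = 0 then 1 else 0 := by
  split_ifs with h
  · simp [h]
  · have hm : (m : ℂ) ≠ 0 := by exact_mod_cast h
    have hc : 2 * Real.pi * I * m ≠ 0 := by
      simp [Real.pi_ne_zero, hm]
    rw [integral_exp_mul_complex hc]
    have : cexp (2 * Real.pi * I * m * ((x + 1 : ℝ) : ℂ)) = cexp (2 * Real.pi * I * m * (x : ℂ)) := by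
      rw [show 2 * Real.pi * I * m * ((x + 1 : ℝ) : ℂ) =
        2 * Real.pi * I * m * (x : ℂ) + m * (2 * Real.pi * I) by push_cast; ring, Complex.exp_add,
        Complex.exp_int_mul_two_pi_mul_I, mul_one]
    rw [this, sub_self, zero_div]

theorem sphereSum_eq_integral {d : ℕ} (ξ : Fin d → ℝ) {η : ℝ} (hη : 0 < η) (x : ℝ) (n : ℕ) :
    ∫ α in x..x + 1, thetaD ξ (α + η * I) * cexp (-(2 * Real.pi * I * n * (α + η * I))) =
      sphereSum ξ n := by
  have hx : x ≤ x + 1 := by linarith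
  set F : (Fin d → ℤ) → ℝ → ℂ := fun k α => latticePhase ξ k *
      cexp (2 * Real.pi * I * ((∑ i, k i ^ 2 : ℤ) : ℂ) * (α + η * I)) *
      cexp (-(2 * Real.pi * I * n * (α + η * I))) with hF
  have hFc : ∀ k, Continuous (F k) := fun k => by rw [hF]; fun_prop
  have hFn : ∀ k α, ‖F k α‖ = Real.exp (-(2 * Real.pi * η) * ((∑ i, k i ^ 2 : ℤ) : ℝ)) *
      Real.exp (2 * Real.pi * η * n) := by
    intro k α
    rw [hF, norm_mul, norm_lattice_term, Complex.norm_exp (-_)]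
    congr 2
    have : -(2 * Real.pi * I * (n : ℂ) * (α + η * I)) =
        ((2 * Real.pi * η * n : ℝ) : ℂ) + ((-(2 * Real.pi * n * α) : ℝ) : ℂ) * I := by
      push_cast
      ring_nf
      simp only [I_sq]
      ring
    rw [this, add_re, re_ofReal_mul, ofReal_re, I_re, mul_zero, add_zero]
  have hint : ∀ k, Integrable (F k) (volume.restrict (Set.Ioc x (x + 1))) := fun k =>
    ((hFc k).integrableOn_Icc (a := x) (b := x + 1)).mono_set Set.Ioc_subset_Icc_self
  have hsum : Summable fun k => ∫ α in Set.Ioc x (x + 1), ‖F k α‖ := by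
    simp_rw [hFn]
    simp only [integral_const, smul_eq_mul, MeasurableSet.univ, measureReal_restrict_apply,
      Set.univ_inter, Real.volume_real_Ioc, add_sub_cancel_left]
    exact ((summable_lattice_gaussian d hη).mul_right _).mul_left _
  have h := (hasSum_integral_of_summable_integral_norm hint hsum).tsum_eq
  rw [intervalIntegral.integral_of_le hx, sphereSum]
  have h1 : ∀ α : ℝ, thetaD ξ (α + η * I) * cexp (-(2 * Real.pi * I * n * (α + η * I))) =
      ∑' k, F k α := by
    intro α
    rw [thetaD_eq_tsum ξ hη, ← tsum_mul_right]
  simp_rw [h1]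
  rw [← h]
  refine tsum_congr fun k => ?_
  rw [← intervalIntegral.integral_of_le hx]
  set m : ℤ := ∑ i, k i ^ 2 with hm
  have h2 : ∀ α : ℝ, F k α = latticePhase ξ k * cexp (-(2 * Real.pi * η * ((m - n : ℤ) : ℂ))) *
      cexp (2 * Real.pi * I * ((m - n : ℤ) : ℂ) * α) := by
    intro α
    rw [hF]
    simp only
    rw [← hm, mul_assoc (latticePhase ξ k), mul_assoc (latticePhase ξ k), ← Complex.exp_add,
      ← Complex.exp_add]
    congr 2
    push_cast
    ring_nf
    simp only [I_sq]
    ring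
  simp_rw [h2]
  rw [intervalIntegral.integral_const_mul, integral_exp_period]
  by_cases hmn : m = n
  · simp [hmn]
  · rw [if_neg hmn, if_neg (sub_ne_zero.2 hmn), mul_zero]

/-- The exponential sum detecting the integers in `[a, b)`, damped at height `1 / N ^ 2`. -/
noncomputable def arcKernel (N a b : ℕ) (α : ℝ) : ℂ :=
  ∑ n ∈ Finset.Ico a b, cexp (-(2 * Real.pi * I * n * (α + ((1 / (N : ℝ) ^ 2 : ℝ) : ℂ) * I)))

theorem continuous_arcKernel (N a b : ℕ) : Continuous (arcKernel N a b) := by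
  unfold arcKernel
  fun_prop

theorem norm_arcKernel_term (η : ℝ) (n : ℕ) (α : ℝ) :
    ‖cexp (-(2 * Real.pi * I * n * (α + (η : ℂ) * I)))‖ = Real.exp (2 * Real.pi * η * n) := by
  rw [Complex.norm_exp]
  congr 1
  have : (-(2 * Real.pi * I * n * (α + (η : ℂ) * I)) : ℂ) =
      ((2 * Real.pi * η * n : ℝ) : ℂ) + ((-(2 * Real.pi * n * α) : ℝ) : ℂ) * I := by
    push_cast
    ring_nf
    rw [I_sq]
    ring
  rw [this]
  simp

theorem norm_arcKernel_term_le {N n : ℕ} (hN : 0 < N) (hn : n ≤ (N + 4) ^ 2) (α : ℝ) :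
    ‖cexp (-(2 * Real.pi * I * n * (α + ((1 / (N : ℝ) ^ 2 : ℝ) : ℂ) * I)))‖ ≤
      Real.exp (50 * Real.pi) := by
  rw [norm_arcKernel_term]
  apply Real.exp_le_exp.2
  have hNr : (1 : ℝ) ≤ N := by exact_mod_cast hN
  have hn' : (n : ℝ) ≤ (N + 4) ^ 2 := by exact_mod_cast hn
  have h25 : (n : ℝ) ≤ 25 * N ^ 2 := by nlinarith
  have : 2 * Real.pi * (1 / (N : ℝ) ^ 2) * n = 2 * Real.pi * (n / (N : ℝ) ^ 2) := by ring
  rw [this]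
  have h2 : (n : ℝ) / N ^ 2 ≤ 25 := by
    rw [div_le_iff₀ (by positivity)]; exact h25
  nlinarith [Real.pi_pos]

theorem norm_arcKernel_le {N a b : ℕ} (hN : 0 < N) (ha : N ^ 2 ≤ a) (hb : b ≤ (N + 4) ^ 2)
    (α : ℝ) : ‖arcKernel N a b α‖ ≤ 24 * Real.exp (50 * Real.pi) * N := by
  unfold arcKernel
  refine (norm_sum_le_of_le _ fun n hn =>
    norm_arcKernel_term_le hN ((Finset.mem_Ico.1 hn).2.le.trans hb) α).trans ?_
  rw [Finset.sum_const, Nat.card_Ico, nsmul_eq_mul]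
  have h1 : b - a ≤ 24 * N := by
    have : (N + 4) ^ 2 = N ^ 2 + 8 * N + 16 := by ring
    omega
  have h2 : ((b - a : ℕ) : ℝ) ≤ 24 * N := by exact_mod_cast h1
  nlinarith [Real.exp_pos (50 * Real.pi)]

theorem norm_one_sub_le_of_one_le {ρ : ℝ} (hρ : 1 ≤ ρ) {u : ℂ} (hu : ‖u‖ = 1) :
    ‖1 - u‖ ≤ ‖1 - ρ * u‖ := by
  have hu2 : u.re ^ 2 + u.im ^ 2 = 1 := by
    have := Complex.normSq_eq_norm_sq u
    rw [hu, Complex.normSq_apply] at this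
    nlinarith
  refine (sq_le_sq₀ (norm_nonneg _) (norm_nonneg _)).1 ?_
  rw [← Complex.normSq_eq_norm_sq, ← Complex.normSq_eq_norm_sq, Complex.normSq_apply,
    Complex.normSq_apply]
  simp
  have hre : u.re ≤ 1 := by nlinarith [sq_nonneg u.im]
  have h1 : ρ ^ 2 * (u.re ^ 2 + u.im ^ 2) = ρ ^ 2 := by rw [hu2, mul_one]
  nlinarith [mul_nonneg (sub_nonneg.2 hρ) (sub_nonneg.2 hre), sq_nonneg (ρ - 1)]

theorem le_abs_sin_pi_mul {α : ℝ} (hα : |α| ≤ 1) :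
    2 * min |α| (1 - |α|) ≤ |Real.sin (Real.pi * α)| := by
  have hs : |Real.sin (Real.pi * α)| = |Real.sin (Real.pi * |α|)| := by
    rcases abs_choice α with h | h <;> rw [h]
    rw [mul_neg, Real.sin_neg, abs_neg]
  rw [hs]
  have key : ∀ t : ℝ, 0 ≤ t → t ≤ 1 / 2 → 2 * t ≤ |Real.sin (Real.pi * t)| := by
    intro t h0 h1
    have := Real.mul_abs_le_abs_sin (x := Real.pi * t) (by
      rw [abs_of_nonneg (by positivity)]; nlinarith [Real.pi_pos])
    rw [abs_of_nonneg (by positivity : 0 ≤ Real.pi * t)] at this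
    have h2 : 2 / Real.pi * (Real.pi * t) = 2 * t := by field_simp
    rwa [h2] at this
  rcases le_total |α| (1 / 2) with h | h
  · exact (by gcongr; exact min_le_left _ _ : _ ≤ 2 * |α|).trans (key _ (abs_nonneg _) h)
  · have h2 := key (1 - |α|) (by linarith) (by linarith)
    have h3 : Real.sin (Real.pi * (1 - |α|)) = Real.sin (Real.pi * |α|) := by
      rw [mul_sub, mul_one, Real.sin_pi_sub]
    rw [h3] at h2
    exact (by gcongr; exact min_le_right _ _ : _ ≤ 2 * (1 - |α|)).trans h2

theorem norm_arcKernel_mul_min_le {N a b : ℕ} (hN : 0 < N) (hab : a ≤ b)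
    (hb : b ≤ (N + 4) ^ 2) {α : ℝ} (hα : |α| ≤ 1) :
    ‖arcKernel N a b α‖ * min |α| (1 - |α|) ≤ Real.exp (50 * Real.pi) := by
  set η : ℝ := 1 / (N : ℝ) ^ 2 with hη
  set z : ℂ := cexp (-(2 * Real.pi * I * (α + (η : ℂ) * I))) with hz
  have hterm : ∀ n : ℕ, cexp (-(2 * Real.pi * I * n * (α + (η : ℂ) * I))) = z ^ n := by
    intro n
    rw [hz, ← Complex.exp_nat_mul]
    congr 1
    ring
  have hK : arcKernel N a b α * (1 - z) = z ^ a - z ^ b := by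
    unfold arcKernel
    rw [Finset.sum_congr rfl fun n _ => hterm n]
    exact geom_sum_Ico_mul_neg _ hab
  have hzp : z = (Real.exp (2 * Real.pi * η) : ℝ) * cexp (-(2 * Real.pi * α : ℝ) * I) := by
    rw [hz, Complex.ofReal_exp, ← Complex.exp_add]
    congr 1
    push_cast
    ring_nf
    rw [I_sq]
    ring
  have h1 : 4 * min |α| (1 - |α|) ≤ ‖1 - z‖ := by
    have hu : ‖cexp (-(2 * Real.pi * α : ℝ) * I)‖ = 1 := by
      rw [← Complex.ofReal_neg, Complex.norm_exp_ofReal_mul_I]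
    rw [hzp]
    refine le_trans ?_ (norm_one_sub_le_of_one_le ?_ hu)
    · rw [norm_sub_rev, ← Complex.ofReal_neg, mul_comm _ I, Complex.norm_exp_I_mul_ofReal_sub_one]
      have : -(2 * Real.pi * α) / 2 = -(Real.pi * α) := by ring
      rw [this, Real.sin_neg, mul_neg, norm_neg, Real.norm_eq_abs, abs_mul, abs_two]
      linarith [le_abs_sin_pi_mul hα]
    · apply Real.one_le_exp; positivity
  have h2 : ‖z ^ a - z ^ b‖ ≤ 2 * Real.exp (50 * Real.pi) := by
    refine (norm_sub_le _ _).trans ?_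
    rw [← hterm, ← hterm]
    linarith [norm_arcKernel_term_le hN (hab.trans hb) α, norm_arcKernel_term_le hN hb α]
  rw [← hK, norm_mul] at h2
  have h3 : ‖arcKernel N a b α‖ * (4 * min |α| (1 - |α|)) ≤ 2 * Real.exp (50 * Real.pi) :=
    (mul_le_mul_of_nonneg_left h1 (norm_nonneg _)).trans h2
  linarith [Real.exp_pos (50 * Real.pi)]

theorem sum_integral_arcs {E : Type*} [NormedAddCommGroup E] [NormedSpace ℝ E] {Q : ℕ}
    (hQ : 0 < Q) (f : ℝ → E) (hf : IntervalIntegrable f volume (-1) 1) :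
    ∑ h ∈ Finset.range Q, ∫ β in (-(1 / (2 * Q) : ℝ))..(1 / (2 * Q) : ℝ), f (h / Q + β) =
      ∫ α in (-(1 / (2 * Q) : ℝ))..(-(1 / (2 * Q) : ℝ) + 1), f α := by
  have hQr : (1 : ℝ) ≤ Q := by exact_mod_cast hQ
  have hQ0 : (Q : ℝ) ≠ 0 := by positivity
  have hinv : (1 / (2 * Q) : ℝ) ≤ 1 / 2 := by
    apply one_div_le_one_div_of_le <;> linarith
  have hinv0 : (0 : ℝ) < 1 / (2 * Q) := by positivity
  set a : ℕ → ℝ := fun k => k / Q - 1 / (2 * Q) with ha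
  have hstep : ∀ k : ℕ, (k : ℝ) / Q + 1 / (2 * Q) = a (k + 1) := by
    intro k
    simp only [ha]
    push_cast
    field_simp
    ring
  have h1 : ∀ k ∈ Finset.range Q, ∫ β in (-(1 / (2 * Q) : ℝ))..(1 / (2 * Q) : ℝ), f (k / Q + β) =
      ∫ α in (a k)..(a (k + 1)), f α := by
    intro k _
    rw [intervalIntegral.integral_comp_add_left, hstep]
    simp [ha, sub_eq_add_neg]
  rw [Finset.sum_congr rfl h1, intervalIntegral.sum_integral_adjacent_intervals]
  · have e0 : a 0 = -(1 / (2 * Q)) := by simp [ha]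
    have e1 : a Q = -(1 / (2 * Q)) + 1 := by
      simp only [ha]; rw [div_self hQ0]; ring
    rw [e0, e1]
  · intro k hk
    have hkr : (k : ℝ) + 1 ≤ Q := by exact_mod_cast hk
    have h2 : (0 : ℝ) ≤ k / Q := by positivity
    have h3 : ((k : ℝ) + 1) / Q ≤ 1 := by
      rw [div_le_one (by positivity)]; exact hkr
    have h4 : a k ≤ a (k + 1) := by
      simp only [ha]; push_cast; gcongr; linarith
    have h5 : -1 ≤ a k := by simp only [ha]; linarith
    have h6 : a (k + 1) ≤ 1 := by simp only [ha]; push_cast; linarith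
    refine hf.mono_set ?_
    rw [Set.uIcc_of_le h4, Set.uIcc_of_le (by norm_num)]
    exact Set.Icc_subset_Icc h5 h6

/-- An integrable majorant for the kernel. -/
noncomputable def kernelWeight (α : ℝ) : ℝ := |α| ^ (-(3 / 4) : ℝ) + (1 - |α|) ^ (-(3 / 4) : ℝ)

theorem intervalIntegrable_kernelWeight : IntervalIntegrable kernelWeight volume (-1) 1 := by
  have h1 : IntervalIntegrable kernelWeight volume 0 1 := by
    have h2 : IntervalIntegrable (fun x : ℝ => x ^ (-(3 / 4) : ℝ)) volume 0 1 :=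
      intervalIntegral.intervalIntegrable_rpow' (by norm_num)
    have h3 : IntervalIntegrable (fun x : ℝ => (1 - x) ^ (-(3 / 4) : ℝ)) volume 0 1 := by
      have := h2.comp_sub_left 1
      simp only [sub_zero, sub_self] at this
      exact this.symm
    refine (h2.add h3).congr ?_
    intro x hx
    rw [Set.uIoc_of_le zero_le_one] at hx
    simp [kernelWeight, abs_of_pos hx.1]
  have h4 : IntervalIntegrable kernelWeight volume (-1) 0 := by
    have := (IntervalIntegrable.iff_comp_neg (f := kernelWeight) (a := 0) (b := 1)).1 h1
    simp only [neg_zero] at this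
    have h5 : (fun x => kernelWeight (-x)) = kernelWeight := by
      ext x; simp [kernelWeight]
    rw [h5] at this
    exact this.symm
  exact h4.trans h1

theorem norm_arcKernel_le_weight {N a b : ℕ} (hN : 0 < N) (hab : a ≤ b) (ha : N ^ 2 ≤ a)
    (hb : b ≤ (N + 4) ^ 2) {α : ℝ} (hα : |α| < 1) (hα0 : α ≠ 0) :
    ‖arcKernel N a b α‖ ≤
      24 * Real.exp (50 * Real.pi) * (N : ℝ) ^ (1 / 4 : ℝ) * kernelWeight α := by
  set E := Real.exp (50 * Real.pi) with hE
  have hE0 : 0 < E := Real.exp_pos _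
  have h1 := norm_arcKernel_le hN ha hb α
  have h2 := norm_arcKernel_mul_min_le hN hab hb hα.le
  set m := min |α| (1 - |α|) with hm
  have hm0 : 0 < m := lt_min (abs_pos.2 hα0) (by linarith)
  have hK0 := norm_nonneg (arcKernel N a b α)
  set K := ‖arcKernel N a b α‖ with hK
  have h3 : K ≤ E * m⁻¹ := by
    rw [← div_eq_mul_inv, le_div_iff₀ hm0]; exact h2
  have hNr : (0 : ℝ) < N := by exact_mod_cast hN
  have h4 : K = K ^ (1 / 4 : ℝ) * K ^ (3 / 4 : ℝ) := by
    rw [← Real.rpow_add_of_nonneg hK0 (by norm_num) (by norm_num)]; norm_num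
  have h5 : K ≤ (24 * E * N) ^ (1 / 4 : ℝ) * (24 * E * m⁻¹) ^ (3 / 4 : ℝ) := by
    rw [h4]
    gcongr
    refine h3.trans ?_
    have : 0 < E * m⁻¹ := by positivity
    linarith
  have h6 : (24 * E * N) ^ (1 / 4 : ℝ) * (24 * E * m⁻¹) ^ (3 / 4 : ℝ) =
      24 * E * (N : ℝ) ^ (1 / 4 : ℝ) * m ^ (-(3 / 4) : ℝ) := by
    rw [Real.mul_rpow (x := 24 * E) (y := N) (by positivity) (by positivity),
      Real.mul_rpow (x := 24 * E) (y := m⁻¹) (by positivity) (by positivity),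
      Real.inv_rpow hm0.le, ← Real.rpow_neg hm0.le]
    have : (24 * E) ^ (1 / 4 : ℝ) * (24 * E) ^ (3 / 4 : ℝ) = 24 * E := by
      rw [← Real.rpow_add (by positivity)]; norm_num
    calc _ = ((24 * E) ^ (1 / 4 : ℝ) * (24 * E) ^ (3 / 4 : ℝ)) * (N : ℝ) ^ (1 / 4 : ℝ) *
          m ^ (-(3 / 4) : ℝ) := by ring
      _ = _ := by rw [this]
  rw [h6] at h5
  refine h5.trans ?_
  have h7 : m ^ (-(3 / 4) : ℝ) ≤ kernelWeight α := by
    unfold kernelWeight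
    have p1 : 0 ≤ |α| ^ (-(3 / 4) : ℝ) := Real.rpow_nonneg (abs_nonneg _) _
    have p2 : 0 ≤ (1 - |α|) ^ (-(3 / 4) : ℝ) := Real.rpow_nonneg (by linarith) _
    rcases min_choice |α| (1 - |α|) with h | h <;> rw [hm, h] <;> linarith
  gcongr

theorem integrable_lorentz {η : ℝ} (hη : 0 < η) (c : ℝ) :
    Integrable (fun α : ℝ => 1 / ((α - c) ^ 2 + η ^ 2)) := by
  have h1 : Integrable (fun α : ℝ => (1 + (η⁻¹ * α) ^ 2)⁻¹) :=
    integrable_inv_one_add_sq.comp_mul_left' (inv_ne_zero hη.ne')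
  have h2 := (h1.comp_sub_right c).const_mul (1 / η ^ 2)
  refine h2.congr (ae_of_all _ fun α => ?_)
  field_simp
  ring

theorem integral_lorentz {η : ℝ} (hη : 0 < η) (c : ℝ) :
    ∫ α : ℝ, 1 / ((α - c) ^ 2 + η ^ 2) = Real.pi / η := by
  rw [integral_sub_right_eq_self (fun α : ℝ => 1 / (α ^ 2 + η ^ 2)) c]
  have h1 := Measure.integral_comp_mul_left (fun x : ℝ => (1 + x ^ 2)⁻¹) η⁻¹
  rw [integral_univ_inv_one_add_sq, inv_inv, abs_of_pos hη] at h1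
  have h2 : (fun α : ℝ => 1 / (α ^ 2 + η ^ 2)) = fun α => 1 / η ^ 2 * (1 + (η⁻¹ * α) ^ 2)⁻¹ := by
    ext α
    field_simp
    ring
  rw [h2, integral_const_mul, h1, smul_eq_mul]
  field_simp

/-- The truncation error of the singular series. -/
noncomputable def seriesTail (d Q : ℕ) : ℝ :=
  ∑' q : ℕ, if q ∣ Q then 0 else (q : ℝ) ^ (-((d : ℝ) / 2 - 5 / 4))

theorem summable_seriesTail_base {d : ℕ} (hd : 5 ≤ d) :
    Summable fun q : ℕ => (q : ℝ) ^ (-((d : ℝ) / 2 - 5 / 4)) := by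
  rw [Real.summable_nat_rpow]
  have : (5 : ℝ) ≤ d := by exact_mod_cast hd
  linarith

theorem seriesTail_term_nonneg (d Q q : ℕ) :
    0 ≤ if q ∣ Q then 0 else (q : ℝ) ^ (-((d : ℝ) / 2 - 5 / 4)) := by
  split_ifs
  · rfl
  · positivity

theorem summable_seriesTail {d : ℕ} (hd : 5 ≤ d) (Q : ℕ) :
    Summable fun q : ℕ => if q ∣ Q then 0 else (q : ℝ) ^ (-((d : ℝ) / 2 - 5 / 4)) := by
  refine Summable.of_nonneg_of_le (seriesTail_term_nonneg d Q) (fun q => ?_)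
    (summable_seriesTail_base hd)
  split_ifs
  · positivity
  · rfl

theorem sum_div_add_div_le {q : ℕ} (hq : 0 < q) :
    ∑ m ∈ Finset.Ico 1 q, ((q : ℝ) / m + q / (q - m)) ≤ 10 * q * (q : ℝ) ^ (1 / 4 : ℝ) := by
  have hqr : (1 : ℝ) ≤ q := by exact_mod_cast hq
  have h1 : ∑ m ∈ Finset.Ico 1 q, (1 / (m : ℝ)) ≤ 5 * (q : ℝ) ^ (1 / 4 : ℝ) := by
    have h2 := harmonic_le_one_add_log (q - 1)
    have h3 : ((harmonic (q - 1) : ℚ) : ℝ) = ∑ m ∈ Finset.Ico 1 q, (1 / (m : ℝ)) := by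
      rw [harmonic, Finset.sum_Ico_eq_sum_range]
      push_cast
      refine Finset.sum_congr rfl fun i _ => ?_
      rw [one_div, add_comm]
    rw [← h3]
    have h4 : Real.log ((q - 1 : ℕ) : ℝ) ≤ Real.log q := by
      rcases Nat.eq_zero_or_pos (q - 1) with h | h
      · rw [h]; simp [Real.log_nonneg hqr]
      · exact Real.log_le_log (by exact_mod_cast h) (by exact_mod_cast Nat.sub_le q 1)
    have h5 := Real.log_le_rpow_div (x := q) (ε := 1 / 4) (by linarith) (by norm_num)
    have h6 : (1 : ℝ) ≤ (q : ℝ) ^ (1 / 4 : ℝ) := Real.one_le_rpow hqr (by norm_num)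
    have h7 : (q : ℝ) ^ (1 / 4 : ℝ) / (1 / 4) = 4 * (q : ℝ) ^ (1 / 4 : ℝ) := by ring
    linarith
  have h2 : ∑ m ∈ Finset.Ico 1 q, (1 / ((q : ℝ) - m)) = ∑ m ∈ Finset.Ico 1 q, (1 / (m : ℝ)) := by
    have h := Finset.sum_Ico_reflect (fun m => 1 / (m : ℝ)) 1 (Nat.le_succ q)
    simp only [Nat.add_sub_cancel_left, Nat.add_sub_cancel] at h
    rw [← h]
    refine Finset.sum_congr rfl fun m hm => ?_
    rw [Nat.cast_sub (Finset.mem_Ico.1 hm).2.le]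
  have h3 : ∑ m ∈ Finset.Ico 1 q, ((q : ℝ) / m + q / (q - m)) =
      q * (∑ m ∈ Finset.Ico 1 q, (1 / (m : ℝ)) + ∑ m ∈ Finset.Ico 1 q, (1 / ((q : ℝ) - m))) := by
    rw [← Finset.sum_add_distrib, Finset.mul_sum]
    refine Finset.sum_congr rfl fun m _ => ?_
    ring
  rw [h3, h2]
  nlinarith

/-- Contribution of the rationals whose denominator does not divide `Q`. -/
noncomputable def farTerm (d N q m : ℕ) (α : ℝ) : ℝ :=
  ((q : ℝ) / m + q / (q - m)) / Real.sqrt q ^ d *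
    (1 / ((α - (m : ℝ) / q) ^ 2 + (1 / (N : ℝ) ^ 2) ^ 2) +
      1 / ((α - -((m : ℝ) / q)) ^ 2 + (1 / (N : ℝ) ^ 2) ^ 2))

/-- Sum of the contributions of all rationals whose denominator does not divide `Q`. -/
noncomputable def farSum (d Q N : ℕ) (α : ℝ) : ℝ :=
  ∑ q ∈ Finset.range (N + 1), if q ∣ Q then 0 else ∑ m ∈ Finset.Ico 1 q, farTerm d N q m α

theorem farTerm_nonneg {d N q m : ℕ} (hm : m ∈ Finset.Ico 1 q) (α : ℝ) :
    0 ≤ farTerm d N q m α := by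
  have h1 := (Finset.mem_Ico.1 hm).2
  have h2 : (0 : ℝ) < (q : ℝ) - m := by
    have : (m : ℝ) < q := by exact_mod_cast h1
    linarith
  unfold farTerm
  positivity

theorem farSum_summand_nonneg (d Q N q : ℕ) (α : ℝ) :
    0 ≤ if q ∣ Q then 0 else ∑ m ∈ Finset.Ico 1 q, farTerm d N q m α := by
  split_ifs
  · rfl
  · exact Finset.sum_nonneg fun m hm => farTerm_nonneg hm α

theorem farSum_nonneg (d Q N : ℕ) (α : ℝ) : 0 ≤ farSum d Q N α :=
  Finset.sum_nonneg fun q _ => farSum_summand_nonneg d Q N q α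

theorem farTerm_le_farSum {d Q N q m : ℕ} (hq : q ≤ N) (hqQ : ¬ q ∣ Q) (hm : m ∈ Finset.Ico 1 q)
    (α : ℝ) : farTerm d N q m α ≤ farSum d Q N α := by
  refine le_trans ?_ (Finset.single_le_sum (fun q _ => farSum_summand_nonneg d Q N q α)
    (Finset.mem_range.2 (Nat.lt_succ_of_le hq)))
  rw [if_neg hqQ]
  exact Finset.single_le_sum (fun m hm => farTerm_nonneg hm α) hm

theorem integrable_farTerm {N : ℕ} (hN : 0 < N) (d q m : ℕ) :
    Integrable (farTerm d N q m) := by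
  have hη : (0 : ℝ) < 1 / (N : ℝ) ^ 2 := by
    have : (0 : ℝ) < N := by exact_mod_cast hN
    positivity
  exact ((integrable_lorentz hη _).add (integrable_lorentz hη _)).const_mul _

theorem integral_farTerm {N : ℕ} (hN : 0 < N) (d q m : ℕ) :
    ∫ α, farTerm d N q m α =
      ((q : ℝ) / m + q / (q - m)) / Real.sqrt q ^ d * (2 * Real.pi * N ^ 2) := by
  have hNr : (0 : ℝ) < N := by exact_mod_cast hN
  have hη : (0 : ℝ) < 1 / (N : ℝ) ^ 2 := by positivity
  unfold farTerm
  rw [integral_const_mul, integral_add (integrable_lorentz hη _) (integrable_lorentz hη _),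
    integral_lorentz hη, integral_lorentz hη]
  congr 1
  field_simp
  ring

theorem integrable_farSum {N : ℕ} (hN : 0 < N) (d Q : ℕ) : Integrable (farSum d Q N) := by
  unfold farSum
  refine integrable_finsetSum _ fun q _ => ?_
  split_ifs
  · exact integrable_zero _ _ _
  · exact integrable_finsetSum _ fun m _ => integrable_farTerm hN d q m

theorem integral_farSum_le {d : ℕ} (hd : 5 ≤ d) {N : ℕ} (hN : 0 < N) (Q : ℕ) :
    ∫ α, farSum d Q N α ≤ 20 * Real.pi * N ^ 2 * seriesTail d Q := by
  have hNr : (0 : ℝ) < N := by exact_mod_cast hN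
  have h1 : ∀ q ∈ Finset.range (N + 1),
      ∫ α, (if q ∣ Q then 0 else ∑ m ∈ Finset.Ico 1 q, farTerm d N q m α) ≤
      20 * Real.pi * N ^ 2 * if q ∣ Q then 0 else (q : ℝ) ^ (-((d : ℝ) / 2 - 5 / 4)) := by
    intro q _
    split_ifs with hq
    · simp
    rcases Nat.eq_zero_or_pos q with hq0 | hq0
    · subst hq0; simp; positivity
    have hqr : (0 : ℝ) < q := by exact_mod_cast hq0
    rw [integral_finsetSum _ fun m _ => integrable_farTerm hN d q m]
    simp_rw [integral_farTerm hN, div_mul_eq_mul_div, ← Finset.sum_div, ← Finset.sum_mul]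
    have h2 : (q : ℝ) ^ (-((d : ℝ) / 2 - 5 / 4)) =
        (q : ℝ) * (q : ℝ) ^ (1 / 4 : ℝ) / Real.sqrt q ^ d := by
      rw [Real.sqrt_eq_rpow, ← Real.rpow_natCast, ← Real.rpow_mul hqr.le, eq_div_iff (by positivity),
        ← Real.rpow_add hqr, ← Real.rpow_one_add' hqr.le (by norm_num)]
      congr 1
      ring
    rw [h2, ← mul_div_assoc]
    refine div_le_div_of_nonneg_right ?_ (by positivity)
    nlinarith [mul_le_mul_of_nonneg_right (sum_div_add_div_le hq0)
      (by positivity : 0 ≤ 2 * Real.pi * (N : ℝ) ^ 2)]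
  unfold farSum
  rw [integral_finsetSum]
  · refine (Finset.sum_le_sum h1).trans ?_
    rw [← Finset.mul_sum]
    gcongr
    exact (summable_seriesTail hd Q).sum_le_tsum _ fun q _ => seriesTail_term_nonneg d Q q
  · intro q _
    split_ifs
    · exact integrable_zero _ _ _
    · exact integrable_finsetSum _ fun m _ => integrable_farTerm hN d q m

theorem continuous_arcError {d : ℕ} (A : Fin d → ℤ) (B Q : ℕ) [NeZero Q] {N : ℕ} (hN : 0 < N)
    (h : ℤ) : Continuous (arcError A B Q N h) := by
  have hη : (0 : ℝ) < 1 / (N : ℝ) ^ 2 := by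
    have : (0 : ℝ) < N := by exact_mod_cast hN
    positivity
  unfold arcError
  have hc : Continuous fun β : ℝ => arcParam (1 / (N : ℝ) ^ 2) β := by
    unfold arcParam; fun_prop
  refine Continuous.sub ?_ (Continuous.div continuous_const ?_ ?_)
  · exact (continuous_thetaD _ hη).comp (continuous_const.add continuous_id)
  · refine Continuous.pow ?_ _
    refine Continuous.cpow hc continuous_const fun β => Or.inl ?_
    rw [arcParam_re]; positivity
  · intro β
    apply pow_ne_zero
    rw [Ne, Complex.cpow_eq_zero_iff]
    rintro ⟨h0, -⟩
    have := arcParam_re (1 / (N : ℝ) ^ 2) β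
    rw [h0] at this
    simp at this
    exact hN.ne' this

theorem norm_arcKernel_mul_lorentz_le {d Q N a b q : ℕ} {h' : ℤ} {α : ℝ} (hN2 : (2 : ℝ) ≤ N)
    (hab : a ≤ b) (hb : b ≤ (N + 4) ^ 2) (hα2 : |α| < 1) (hq0 : 0 < q) (hqN : q ≤ N)
    (hqQ : ¬ q ∣ Q) (hcop : IsCoprime h' q) (hclose : |α - h' / q| ≤ 1 / (q * N)) :
    ‖arcKernel N a b α‖ / Real.sqrt q ^ d * (1 / ((α - h' / q) ^ 2 + (1 / (N : ℝ) ^ 2) ^ 2)) ≤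
      2 * Real.exp (50 * Real.pi) * farSum d Q N α := by
  have hNr : (0 : ℝ) < N := by linarith
  have hN0 : 0 < N := by exact_mod_cast hNr
  set E := Real.exp (50 * Real.pi) with hE
  have hE0 : 0 < E := Real.exp_pos _
  have hqr : (0 : ℝ) < q := by exact_mod_cast hq0
  have hq1 : q ≠ 1 := fun h1 => hqQ (h1 ▸ one_dvd Q)
  set m := h'.natAbs with hm
  have hm0 : m ≠ 0 := by
    intro h0
    have : h' = 0 := Int.natAbs_eq_zero.1 h0
    rw [this, isCoprime_zero_left, Int.isUnit_iff_natAbs_eq] at hcop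
    simp at hcop; exact hq1 hcop
  have hmr : |(h' : ℝ)| = m := by rw [hm, Nat.cast_natAbs, Int.cast_abs]
  have hcl2 : |(|α| - (m : ℝ) / q)| ≤ 1 / (q * N) := by
    have : (m : ℝ) / q = |(h' : ℝ) / q| := by rw [abs_div, hmr, abs_of_pos hqr]
    rw [this]
    exact (abs_abs_sub_abs_le_abs_sub _ _).trans hclose
  obtain ⟨hc1, hc2⟩ := abs_le.1 hcl2
  have hmq : m < q := by
    have h1 : (m : ℝ) / q < 1 + 1 / (q * N) := by linarith
    have h2 : (m : ℝ) < q + 1 / N := by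
      rw [div_lt_iff₀ hqr] at h1
      refine h1.trans_eq ?_
      field_simp
    have h3 : (m : ℝ) < q + 1 := by
      have : 1 / (N : ℝ) ≤ 1 := by rw [div_le_one hNr]; linarith
      linarith
    have h4 : m < q + 1 := by exact_mod_cast h3
    refine lt_of_le_of_ne (by omega) fun h5 => ?_
    have h6 : m.gcd q = 1 := by
      rw [Int.isCoprime_iff_gcd_eq_one] at hcop
      simpa [Int.gcd] using hcop
    rw [h5, Nat.gcd_self] at h6
    exact hq1 h6
  have hmI : m ∈ Finset.Ico 1 q := Finset.mem_Ico.2 ⟨by omega, hmq⟩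
  have hmr1 : (1 : ℝ) ≤ m := by exact_mod_cast Nat.one_le_iff_ne_zero.2 hm0
  have hmqr : (1 : ℝ) ≤ (q : ℝ) - m := by
    have : (m : ℝ) + 1 ≤ q := by exact_mod_cast hmq
    linarith
  have hinvN : 1 / ((q : ℝ) * N) ≤ 1 / (2 * q) := by
    apply one_div_le_one_div_of_le (by positivity); nlinarith
  have hhalf : ∀ x : ℝ, 1 ≤ x → x / (2 * q) ≤ x / q - 1 / (2 * q) := by
    intro x hx
    have e1 : x / q - 1 / (2 * q) = (2 * x - 1) / (2 * q) := by field_simp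
    rw [e1]
    gcongr
    linarith
  have hαlow : (m : ℝ) / (2 * q) ≤ |α| := (hhalf _ hmr1).trans (by linarith)
  have hαlow2 : ((q : ℝ) - m) / (2 * q) ≤ 1 - |α| := by
    refine (hhalf _ hmqr).trans ?_
    rw [sub_div, div_self hqr.ne']
    linarith
  have hKq : ‖arcKernel N a b α‖ ≤ 2 * E * ((q : ℝ) / m + q / (q - m)) := by
    have h1 := norm_arcKernel_mul_min_le hN0 hab hb hα2.le
    have h2 : (0 : ℝ) < m / (2 * q) := by positivity
    have h3 : (0 : ℝ) < ((q : ℝ) - m) / (2 * q) := by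
      apply div_pos <;> linarith
    have hp1 : (0 : ℝ) < q / m := by positivity
    have hp2 : (0 : ℝ) < (q : ℝ) / (q - m) := by
      apply div_pos <;> linarith
    have hK0 := norm_nonneg (arcKernel N a b α)
    rcases min_choice |α| (1 - |α|) with h4 | h4 <;> rw [h4] at h1
    · have h5 : ‖arcKernel N a b α‖ * (m / (2 * q)) ≤ E :=
        (mul_le_mul_of_nonneg_left hαlow hK0).trans h1
      rw [← le_div_iff₀ h2] at h5
      refine h5.trans ?_
      have : E / ((m : ℝ) / (2 * q)) = 2 * E * (q / m) := by field_simp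
      rw [this]
      gcongr
      linarith
    · have h5 : ‖arcKernel N a b α‖ * (((q : ℝ) - m) / (2 * q)) ≤ E :=
        (mul_le_mul_of_nonneg_left hαlow2 hK0).trans h1
      rw [← le_div_iff₀ h3] at h5
      refine h5.trans ?_
      have h6 : (q : ℝ) - m ≠ 0 := by linarith
      have : E / (((q : ℝ) - m) / (2 * q)) = 2 * E * (q / (q - m)) := by field_simp
      rw [this]
      gcongr
      linarith
  have hfar := farTerm_le_farSum (d := d) hqN hqQ hmI α
  have hsq : (0 : ℝ) < Real.sqrt q ^ d := by positivity
  set η : ℝ := 1 / (N : ℝ) ^ 2 with hη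
  have hη0 : 0 < η := by positivity
  set D : ℝ := 1 / ((α - h' / q) ^ 2 + η ^ 2) with hD
  have hD0 : 0 ≤ D := by positivity
  have hfar2 : ((q : ℝ) / m + q / (q - m)) / Real.sqrt q ^ d * D ≤ farSum d Q N α := by
    refine le_trans ?_ hfar
    unfold farTerm
    have hcoef : 0 ≤ ((q : ℝ) / m + q / (q - m)) / Real.sqrt q ^ d := by
      have hp2 : (0 : ℝ) < (q : ℝ) / (q - m) := by
        apply div_pos <;> linarith
      positivity
    refine mul_le_mul_of_nonneg_left ?_ hcoef
    have e1 : 0 ≤ 1 / ((α - (m : ℝ) / q) ^ 2 + η ^ 2) := by positivity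
    have e2 : 0 ≤ 1 / ((α - -((m : ℝ) / q)) ^ 2 + η ^ 2) := by positivity
    rcases abs_choice (h' : ℝ) with h4 | h4
    · have : (h' : ℝ) = m := by rw [← hmr, h4]
      rw [hD, this]; linarith
    · have : (h' : ℝ) = -m := by rw [← hmr, h4, neg_neg]
      rw [hD, this, neg_div]; linarith
  calc _ ≤ (2 * E * ((q : ℝ) / m + q / (q - m))) / Real.sqrt q ^ d * D := by gcongr
    _ = 2 * E * (((q : ℝ) / m + q / (q - m)) / Real.sqrt q ^ d * D) := by ring
    _ ≤ _ := by gcongr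

set_option maxHeartbeats 1000000 in
theorem exists_arcError_integral_bound {d : ℕ} (hd : 5 ≤ d) (A : Fin d → ℤ) (B : ℕ) :
    ∃ C : ℝ, 0 < C ∧ ∀ (Q : ℕ) [NeZero Q], B ∣ Q → ∃ C' : ℝ, 0 < C' ∧ ∀ N a b : ℕ, 2 * Q < N →
      N ^ 2 ≤ a → a ≤ b → b ≤ (N + 4) ^ 2 →
      ∑ h ∈ Finset.range Q, ∫ β in (-(1 / (2 * Q) : ℝ))..(1 / (2 * Q) : ℝ),
        ‖arcError A B Q N h β * arcKernel N a b (h / Q + β)‖ ≤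
        C' * (N : ℝ) ^ ((d : ℝ) / 2 + 1 / 4) + C * seriesTail d Q * N ^ (d - 2) := by
  obtain ⟨C, hC, hup⟩ := exists_arcError_bound (by omega : 4 ≤ d) A B
  set E := Real.exp (50 * Real.pi) with hE
  have hE0 : 0 < E := Real.exp_pos _
  refine ⟨2 * E * C * (20 * Real.pi), by positivity, ?_⟩
  intro Q _ hB
  obtain ⟨C', hC', hup⟩ := hup Q hB
  set W : ℝ := ∫ α in (-1 : ℝ)..1, kernelWeight α with hW
  refine ⟨C' * (24 * E) * (|W| + 1), by positivity, ?_⟩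
  intro N a b hQN ha hab hb
  have hQ0 : 0 < Q := Nat.pos_of_ne_zero (NeZero.ne Q)
  have hQ : (1 : ℝ) ≤ Q := by exact_mod_cast hQ0
  have hN0 : 0 < N := by omega
  have hN2 : (2 : ℝ) ≤ N := by exact_mod_cast (by omega : 2 ≤ N)
  have hNr : (0 : ℝ) < N := by linarith
  have hinv : (1 / (2 * Q) : ℝ) ≤ 1 / 2 := by
    apply one_div_le_one_div_of_le <;> linarith
  have hinv0 : (0 : ℝ) < 1 / (2 * Q) := by positivity
  set P : ℝ := C' * Real.sqrt N ^ d * (24 * E * (N : ℝ) ^ (1 / 4 : ℝ)) with hP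
  have hP0 : 0 ≤ P := by positivity
  set R : ℝ := 2 * E * C * N ^ (d - 4) with hR
  have hR0 : 0 ≤ R := by positivity
  set M : ℝ → ℝ := fun α => P * kernelWeight α + R * farSum d Q N α with hM
  have hMi : IntervalIntegrable M volume (-1) 1 :=
    (intervalIntegrable_kernelWeight.const_mul P).add
      ((integrable_farSum hN0 d Q).const_mul R).intervalIntegrable
  have hW0 : ∀ α : ℝ, |α| < 1 → 0 ≤ kernelWeight α := by
    intro α hα
    unfold kernelWeight
    have p1 : 0 ≤ |α| ^ (-(3 / 4) : ℝ) := Real.rpow_nonneg (abs_nonneg _) _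
    have p2 : 0 ≤ (1 - |α|) ^ (-(3 / 4) : ℝ) := Real.rpow_nonneg (by linarith) _
    linarith
  have hpt : ∀ h ∈ Finset.range Q, ∀ β : ℝ, |β| ≤ 1 / (2 * Q) → (h / Q + β : ℝ) ≠ 0 →
      ‖arcError A B Q N h β * arcKernel N a b (h / Q + β)‖ ≤ M (h / Q + β) := by
    intro h hh β hβ hne
    have hhQ : (h : ℝ) + 1 ≤ Q := by exact_mod_cast Finset.mem_range.1 hh
    have hQpos : (0 : ℝ) < Q := by linarith
    have hh1 : (h : ℝ) / Q ≤ 1 - 1 / Q := by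
      rw [le_sub_iff_add_le, ← add_div, div_le_one hQpos]; exact hhQ
    have hh0 : (0 : ℝ) ≤ h / Q := by positivity
    have h2Q : 1 / (Q : ℝ) = 2 * (1 / (2 * Q)) := by field_simp
    obtain ⟨hβ1, hβ2⟩ := abs_le.1 hβ
    set α : ℝ := h / Q + β with hα
    have hα1 : |α| ≤ 1 - 1 / (2 * Q) := abs_le.2 ⟨by linarith, by linarith⟩
    have hα2 : |α| < 1 := by linarith
    have hKw := norm_arcKernel_le_weight hN0 hab ha hb hα2 hne
    have hfirst : C' * Real.sqrt N ^ d * ‖arcKernel N a b α‖ ≤ P * kernelWeight α := by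
      rw [hP, mul_assoc (C' * Real.sqrt N ^ d)]
      gcongr
    rw [norm_mul, hM]
    simp only
    rcases hup N h β hQN hβ with hb1 | ⟨q, h', hq0, hqN, hqQ, hcop, hclose, hb1⟩
    · have h1 := mul_le_mul_of_nonneg_right hb1 (norm_nonneg (arcKernel N a b α))
      have h2 := mul_nonneg hR0 (farSum_nonneg d Q N α)
      linarith
    have hqr : (0 : ℝ) < q := by exact_mod_cast hq0
    rw [Int.cast_natCast, ← hα] at hclose hb1
    have hlor := norm_arcKernel_mul_lorentz_le (d := d) (Q := Q) hN2 hab hb hα2 hq0 hqN hqQ hcop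
      hclose
    set η : ℝ := 1 / (N : ℝ) ^ 2 with hη
    have h1 := mul_le_mul_of_nonneg_right hb1 (norm_nonneg (arcKernel N a b α))
    rw [add_mul] at h1
    have h2 : C * (N : ℝ) ^ (d - 4) / (Real.sqrt q ^ d * ((α - h' / q) ^ 2 + η ^ 2)) *
        ‖arcKernel N a b α‖ ≤ R * farSum d Q N α := by
      calc _ = C * (N : ℝ) ^ (d - 4) * (‖arcKernel N a b α‖ / Real.sqrt q ^ d *
            (1 / ((α - h' / q) ^ 2 + η ^ 2))) := by field_simp
        _ ≤ C * (N : ℝ) ^ (d - 4) * (2 * E * farSum d Q N α) := by gcongr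
        _ = R * farSum d Q N α := by rw [hR]; ring
    linarith
  have hle : -(1 / (2 * Q) : ℝ) ≤ 1 / (2 * Q) := by linarith
  have hsum : ∑ h ∈ Finset.range Q, ∫ β in (-(1 / (2 * Q) : ℝ))..(1 / (2 * Q) : ℝ),
      ‖arcError A B Q N h β * arcKernel N a b (h / Q + β)‖ ≤
      ∑ h ∈ Finset.range Q, ∫ β in (-(1 / (2 * Q) : ℝ))..(1 / (2 * Q) : ℝ), M (h / Q + β) := by
    refine Finset.sum_le_sum fun h hh => ?_
    have hhQ : (h : ℝ) + 1 ≤ Q := by exact_mod_cast Finset.mem_range.1 hh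
    have hQpos : (0 : ℝ) < Q := by linarith
    have hh1 : (h : ℝ) / Q ≤ 1 - 1 / Q := by
      rw [le_sub_iff_add_le, ← add_div, div_le_one hQpos]; exact hhQ
    have hh0 : (0 : ℝ) ≤ h / Q := by positivity
    have h2Q : 1 / (Q : ℝ) = 2 * (1 / (2 * Q)) := by field_simp
    refine intervalIntegral.integral_mono_ae_restrict hle ?_ ?_ ?_
    · refine Continuous.intervalIntegrable ?_ _ _
      exact ((continuous_arcError A B Q hN0 h).mul
        ((continuous_arcKernel N a b).comp (continuous_const.add continuous_id))).norm
    · have h3 : IntervalIntegrable M volume (h / Q + -(1 / (2 * Q))) (h / Q + 1 / (2 * Q)) := by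
        refine hMi.mono_set ?_
        rw [Set.uIcc_of_le (by linarith), Set.uIcc_of_le (by norm_num)]
        exact Set.Icc_subset_Icc (by linarith) (by linarith)
      have h4 := h3.comp_add_left (h / Q : ℝ)
      simpa using h4
    · have h0 : ∀ᵐ β : ℝ, β ≠ -(h / Q : ℝ) := by
        simp [ae_iff]
      rw [Filter.EventuallyLE, ae_restrict_iff' measurableSet_Icc]
      filter_upwards [h0] with β hβ hβI
      exact hpt h hh β (abs_le.2 hβI) fun h5 => hβ (by linarith)
  refine hsum.trans ?_
  rw [sum_integral_arcs hQ0 M hMi]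
  have hKi : IntervalIntegrable kernelWeight volume (-(1 / (2 * Q) : ℝ)) (-(1 / (2 * Q) : ℝ) + 1) := by
    refine intervalIntegrable_kernelWeight.mono_set ?_
    rw [Set.uIcc_of_le (by linarith), Set.uIcc_of_le (by norm_num)]
    exact Set.Icc_subset_Icc (by linarith) (by linarith)
  have hfi := integrable_farSum hN0 d Q
  rw [hM, intervalIntegral.integral_add (hKi.const_mul P) (hfi.const_mul R).intervalIntegrable,
    intervalIntegral.integral_const_mul, intervalIntegral.integral_const_mul]
  have h1 : ∫ α in (-(1 / (2 * Q) : ℝ))..(-(1 / (2 * Q) : ℝ) + 1), kernelWeight α ≤ |W| + 1 := by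
    have : ∫ α in (-(1 / (2 * Q) : ℝ))..(-(1 / (2 * Q) : ℝ) + 1), kernelWeight α ≤ W := by
      refine intervalIntegral.integral_mono_interval (by linarith) (by linarith) (by linarith) ?_
        intervalIntegrable_kernelWeight
      have h0 : ∀ᵐ β : ℝ, β ≠ 1 := by simp [ae_iff]
      rw [Filter.EventuallyLE, ae_restrict_iff' measurableSet_Ioc]
      filter_upwards [h0] with β hβ hβI
      exact hW0 β (abs_lt.2 ⟨hβI.1, lt_of_le_of_ne hβI.2 hβ⟩)
    linarith [le_abs_self W]
  have h2 : ∫ α in (-(1 / (2 * Q) : ℝ))..(-(1 / (2 * Q) : ℝ) + 1), farSum d Q N α ≤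
      20 * Real.pi * N ^ 2 * seriesTail d Q := by
    rw [intervalIntegral.integral_of_le (by linarith)]
    exact (setIntegral_le_integral hfi (ae_of_all _ (farSum_nonneg d Q N))).trans
      (integral_farSum_le hd hN0 Q)
  have hNpow : Real.sqrt N ^ d * (N : ℝ) ^ (1 / 4 : ℝ) = (N : ℝ) ^ ((d : ℝ) / 2 + 1 / 4) := by
    rw [Real.sqrt_eq_rpow, ← Real.rpow_natCast, ← Real.rpow_mul hNr.le, ← Real.rpow_add hNr]
    congr 1
    ring
  have hNpow2 : (N : ℝ) ^ (d - 4) * N ^ 2 = N ^ (d - 2) := by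
    rw [← pow_add]; congr 1; omega
  refine (add_le_add (mul_le_mul_of_nonneg_left h1 hP0) (mul_le_mul_of_nonneg_left h2 hR0)).trans
    (le_of_eq ?_)
  rw [hP, hR, ← hNpow, ← hNpow2]
  ring

theorem integral_rpow_mul_cexp_neg_mul {s : ℝ} (hs : 0 < s) {z : ℂ} (hz : 0 < z.re) :
    ∫ t in Set.Ioi (0 : ℝ), ((t ^ (s - 1) : ℝ) : ℂ) * cexp (-(z * t)) =
      Real.Gamma s * z ^ (-(s : ℂ)) := by
  set w : ℝ → NNReal := fun t => (t ^ (s - 1)).toNNReal with hw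
  have hwm : Measurable w := by fun_prop
  set μ : Measure ℝ := (volume.restrict (Set.Ioi 0)).withDensity fun t => (w t : ENNReal) with hμ
  have hwt : ∀ t ∈ Set.Ioi (0 : ℝ), (w t : ℝ) = t ^ (s - 1) := fun t ht =>
    Real.coe_toNNReal _ (Real.rpow_nonneg (le_of_lt ht) _)
  have hsub : Set.Iio (0 : ℝ) ⊆ ProbabilityTheory.integrableExpSet id μ := by
    intro r hr
    show Integrable (fun t => Real.exp (r * id t)) μ
    rw [hμ, integrable_withDensity_iff_integrable_smul hwm]
    have h1 := Real.GammaIntegral_convergent hs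
    have h2 : 0 < -r := by simpa using hr
    have h3 : IntegrableOn (fun t : ℝ => t ^ (s - 1) * Real.exp (r * t)) (Set.Ioi 0) := by
      have := integrableOn_rpow_mul_exp_neg_mul_rpow (p := 1) (s := s - 1) (b := -r) (by linarith)
        one_pos h2
      simpa using this
    refine (integrableOn_congr_fun (fun t ht => ?_) measurableSet_Ioi).1 h3
    simp only [NNReal.smul_def, hwt t ht, id, smul_eq_mul]
  have hmgf : ∀ u : ℂ, ProbabilityTheory.complexMGF id μ u =
      ∫ t in Set.Ioi (0 : ℝ), ((t ^ (s - 1) : ℝ) : ℂ) * cexp (u * t) := by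
    intro u
    rw [ProbabilityTheory.complexMGF, hμ, integral_withDensity_eq_integral_smul hwm]
    refine setIntegral_congr_fun measurableSet_Ioi fun t ht => ?_
    simp only [NNReal.smul_def, hwt t ht, id, real_smul]
  have han : AnalyticOnNhd ℂ (ProbabilityTheory.complexMGF id μ) {u | u.re < 0} := by
    refine ProbabilityTheory.analyticOnNhd_complexMGF.mono fun u hu => ?_
    exact interior_mono hsub (by rw [isOpen_Iio.interior_eq]; exact hu)
  have hopen : IsOpen {u : ℂ | u.re < 0} := isOpen_lt Complex.continuous_re continuous_const
  have han2 : AnalyticOnNhd ℂ (fun u : ℂ => (Real.Gamma s : ℂ) * (-u) ^ (-(s : ℂ)))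
      {u | u.re < 0} := by
    refine DifferentiableOn.analyticOnNhd (fun u hu => ?_) hopen
    refine (DifferentiableAt.const_mul ?_ _).differentiableWithinAt
    refine DifferentiableAt.cpow_const (by fun_prop) (Or.inl ?_)
    simpa using hu
  have hconn : IsPreconnected {u : ℂ | u.re < 0} :=
    (convex_halfSpace_re_lt 0).isPreconnected
  have heq := han.eqOn_of_preconnected_of_frequently_eq han2 hconn (z₀ := -1) (by simp) (by
    have hreal : ∀ x : ℝ, x < 0 → ProbabilityTheory.complexMGF id μ (x : ℂ) =
        (Real.Gamma s : ℂ) * (-(x : ℂ)) ^ (-(s : ℂ)) := by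
      intro x hx
      have hx' : 0 < -x := by linarith
      have h1 := integral_cpow_mul_exp_neg_mul_Ioi (a := (s : ℂ)) (r := -x) (by simpa using hs) hx'
      rw [hmgf]
      have h2 : ∫ t in Set.Ioi (0 : ℝ), ((t ^ (s - 1) : ℝ) : ℂ) * cexp ((x : ℂ) * t) =
          ∫ t in Set.Ioi (0 : ℝ), (t : ℂ) ^ ((s : ℂ) - 1) * cexp (-((-x : ℝ) : ℂ) * t) := by
        refine setIntegral_congr_fun measurableSet_Ioi fun t ht => ?_
        rw [Complex.ofReal_cpow (le_of_lt ht)]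
        push_cast
        ring_nf
      rw [h2]
      have h3 : ∀ t : ℝ, -((-x : ℝ) : ℂ) * t = -(((-x : ℝ) : ℂ) * t) := fun t => by ring
      simp_rw [h3]
      rw [h1, Complex.Gamma_ofReal, mul_comm]
      congr 1
      rw [one_div, Complex.inv_cpow _ _ (by
        rw [Complex.arg_ofReal_of_nonneg hx'.le]; exact Real.pi_pos.ne), Complex.cpow_neg]
      push_cast
      rfl
    have hseq : Tendsto (fun n : ℕ => ((-1 - 1 / ((n : ℝ) + 1) : ℝ) : ℂ)) atTop (𝓝[≠] (-1)) := by
      refine tendsto_nhdsWithin_iff.2 ⟨?_, Eventually.of_forall fun n => ?_⟩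
      · have h1 : Tendsto (fun n : ℕ => (-1 - 1 / ((n : ℝ) + 1) : ℝ)) atTop (𝓝 (-1 - 0)) :=
          tendsto_const_nhds.sub tendsto_one_div_add_atTop_nhds_zero_nat
        have h2 := (Complex.continuous_ofReal.tendsto _).comp h1
        simpa [Function.comp_def] using h2
      · simp only [Set.mem_compl_iff, Set.mem_singleton_iff]
        intro h
        have h2 := congrArg Complex.re h
        rw [ofReal_re] at h2
        simp at h2
        have h3 : (0 : ℝ) < (n : ℝ) + 1 := by positivity
        linarith
    refine hseq.frequently (Frequently.of_forall fun n => ?_)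
    exact hreal _ (by
      have : (0 : ℝ) < 1 / ((n : ℝ) + 1) := by positivity
      linarith))
  have h1 := heq (x := -z) (by simpa using hz)
  rw [hmgf] at h1
  simpa [neg_mul] using h1

theorem ofReal_mul_cpow {a : ℝ} (ha : 0 < a) {w : ℂ} (hw : w ≠ 0) (r : ℂ) :
    ((a : ℂ) * w) ^ r = (a : ℂ) ^ r * w ^ r := by
  have ha' : (a : ℂ) ≠ 0 := by exact_mod_cast ha.ne'
  rw [Complex.cpow_def_of_ne_zero (mul_ne_zero ha' hw), Complex.cpow_def_of_ne_zero ha',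
    Complex.cpow_def_of_ne_zero hw, Complex.log_ofReal_mul ha hw, ← Complex.exp_add,
    Complex.ofReal_log ha.le]
  congr 1
  ring

theorem arcParam_ne_zero {η : ℝ} (hη : 0 < η) (β : ℝ) : arcParam η β ≠ 0 := by
  intro h0
  have := arcParam_re η β
  rw [h0] at this
  simp at this
  exact hη.ne' this

theorem arcParam_cpow_pow (d : ℕ) (η β : ℝ) :
    (arcParam η β ^ (1 / 2 : ℂ)) ^ d = arcParam η β ^ (((d : ℝ) / 2 : ℝ) : ℂ) := by
  rw [← Complex.cpow_nat_mul]
  congr 1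
  push_cast
  ring

theorem norm_inv_arcParam_pow_le {d : ℕ} (hd : 4 ≤ d) {η β δ : ℝ} (hδ : 0 < δ)
    (hβ : δ ^ 2 ≤ β ^ 2 + η ^ 2) :
    ‖1 / (arcParam η β ^ (1 / 2 : ℂ)) ^ d‖ ≤
      1 / (4 * Real.sqrt (2 * δ) ^ (d - 4)) * (1 / (β ^ 2 + η ^ 2)) := by
  have hpos : 0 < β ^ 2 + η ^ 2 := lt_of_lt_of_le (by positivity) hβ
  have hw : 2 * δ ≤ ‖arcParam η β‖ := by
    rw [arcParam_norm]
    have := Real.sqrt_le_sqrt hβ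
    rw [Real.sqrt_sq hδ.le] at this
    linarith
  have hsq : ‖arcParam η β‖ ^ 2 = 4 * (β ^ 2 + η ^ 2) := by
    rw [arcParam_norm, mul_pow, Real.sq_sqrt hpos.le]; norm_num
  rw [norm_div, norm_one, norm_pow, norm_cpow_half]
  have h1 : Real.sqrt ‖arcParam η β‖ ^ d = Real.sqrt ‖arcParam η β‖ ^ (d - 4) *
      (4 * (β ^ 2 + η ^ 2)) := by
    rw [← hsq]
    nth_rewrite 3 [← Real.sq_sqrt (norm_nonneg (arcParam η β))]
    rw [← pow_mul, ← pow_add]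
    congr 1
    omega
  rw [h1, one_div_mul_one_div]
  apply one_div_le_one_div_of_le (by positivity)
  have h2 : Real.sqrt (2 * δ) ^ (d - 4) ≤ Real.sqrt ‖arcParam η β‖ ^ (d - 4) := by gcongr
  calc _ = Real.sqrt (2 * δ) ^ (d - 4) * (4 * (β ^ 2 + η ^ 2)) := by ring
    _ ≤ _ := by gcongr

theorem continuous_inv_arcParam_pow (d : ℕ) {η : ℝ} (hη : 0 < η) :
    Continuous fun β => 1 / (arcParam η β ^ (1 / 2 : ℂ)) ^ d := by
  have hc : Continuous fun β : ℝ => arcParam η β := by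
    unfold arcParam; fun_prop
  refine Continuous.div continuous_const ?_ ?_
  · refine Continuous.pow ?_ _
    refine Continuous.cpow hc continuous_const fun β => Or.inl ?_
    rw [arcParam_re]; positivity
  · intro β
    apply pow_ne_zero
    rw [Ne, Complex.cpow_eq_zero_iff]
    rintro ⟨h0, -⟩
    have := arcParam_re η β
    rw [h0] at this
    simp at this
    exact hη.ne' this

theorem integrable_inv_arcParam_pow {d : ℕ} (hd : 4 ≤ d) {η : ℝ} (hη : 0 < η) :
    Integrable fun β => 1 / (arcParam η β ^ (1 / 2 : ℂ)) ^ d := by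
  refine Integrable.mono' (((integrable_lorentz hη 0)).const_mul
    (1 / (4 * Real.sqrt (2 * η) ^ (d - 4)))) (continuous_inv_arcParam_pow d hη).aestronglyMeasurable
    (ae_of_all _ fun β => ?_)
  have := norm_inv_arcParam_pow_le hd (η := η) (β := β) hη (by nlinarith [sq_nonneg β])
  simpa using this

/-- The constant in the main term: the volume density of the sphere. -/
noncomputable def sphereConst (d : ℕ) : ℝ := Real.pi ^ ((d : ℝ) / 2) / Real.Gamma ((d : ℝ) / 2)

theorem sphereConst_pos {d : ℕ} (hd : 0 < d) : 0 < sphereConst d := by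
  have : (0 : ℝ) < d := by exact_mod_cast hd
  exact div_pos (by positivity) (Real.Gamma_pos_of_pos (by positivity))

open scoped FourierTransform in
theorem integral_inv_arcParam_mul_exp {d : ℕ} (hd : 4 ≤ d) {η : ℝ} (hη : 0 < η) {n : ℕ}
    (hn : 0 < n) :
    ∫ β : ℝ, 1 / (arcParam η β ^ (1 / 2 : ℂ)) ^ d *
      cexp (-(2 * Real.pi * I * n * (β + (η : ℂ) * I))) =
      ((sphereConst d * (n : ℝ) ^ ((d : ℝ) / 2 - 1) : ℝ) : ℂ) := by
  set s : ℝ := (d : ℝ) / 2 with hs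
  have hs2 : 2 ≤ s := by
    have : (4 : ℝ) ≤ d := by exact_mod_cast hd
    linarith
  have hΓ : 0 < Real.Gamma s := Real.Gamma_pos_of_pos (by linarith)
  set f : ℝ → ℂ := Set.indicator (Set.Ioi 0) fun t =>
    ((t ^ (s - 1) : ℝ) : ℂ) * cexp (-(2 * Real.pi * η * t)) with hf
  have hfi : Integrable f := by
    rw [hf, integrable_indicator_iff measurableSet_Ioi]
    have h3 : IntegrableOn (fun t : ℝ => t ^ (s - 1) * Real.exp (-(2 * Real.pi * η) * t))
        (Set.Ioi 0) := by
      have := integrableOn_rpow_mul_exp_neg_mul_rpow (p := 1) (s := s - 1) (b := 2 * Real.pi * η)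
        (by linarith) one_pos (by positivity)
      simpa using this
    refine (integrableOn_congr_fun (fun t _ => ?_) measurableSet_Ioi).1 h3.ofReal
    simp
  have hFf : ∀ v : ℝ, 𝓕 f v = ((Real.Gamma s * Real.pi ^ (-s) : ℝ) : ℂ) *
      (1 / (arcParam η (-v) ^ (1 / 2 : ℂ)) ^ d) := by
    intro v
    rw [Real.fourier_real_eq_integral_exp_smul]
    have h1 : (fun t : ℝ => cexp (((-2 * Real.pi * t * v : ℝ) : ℂ) * I) • f t) =
        Set.indicator (Set.Ioi 0) fun t : ℝ => ((t ^ (s - 1) : ℝ) : ℂ) *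
          cexp (-((Real.pi : ℝ) * arcParam η (-v) * t)) := by
      ext t
      rw [hf]
      by_cases ht : t ∈ Set.Ioi (0 : ℝ)
      · rw [Set.indicator_of_mem ht, Set.indicator_of_mem ht, smul_eq_mul, mul_left_comm,
          ← Complex.exp_add]
        congr 2
        rw [arcParam]
        push_cast
        ring
      · rw [Set.indicator_of_notMem ht, Set.indicator_of_notMem ht, smul_zero]
    rw [h1, integral_indicator measurableSet_Ioi, integral_rpow_mul_cexp_neg_mul (by linarith)]
    · rw [arcParam_cpow_pow, ← hs, ofReal_mul_cpow Real.pi_pos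
        (arcParam_ne_zero hη _), Complex.cpow_neg, ofReal_mul,
        Complex.ofReal_cpow Real.pi_pos.le, ofReal_neg, one_div, Complex.cpow_neg]
      rw [Complex.cpow_neg]
      ring
    · rw [re_ofReal_mul, arcParam_re]; positivity
  have hFi : Integrable (𝓕 f) := by
    have h1 := ((integrable_inv_arcParam_pow hd hη).comp_neg).const_mul
      ((Real.Gamma s * Real.pi ^ (-s) : ℝ) : ℂ)
    exact h1.congr (ae_of_all _ fun v => (hFf v).symm)
  have hnr : (0 : ℝ) < n := by exact_mod_cast hn
  have hcont : ContinuousAt f (n : ℝ) := by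
    have h1 : ContinuousAt (fun t : ℝ => ((t ^ (s - 1) : ℝ) : ℂ) *
        cexp (-(2 * Real.pi * η * t))) (n : ℝ) := by
      refine ContinuousAt.mul ?_ (by fun_prop)
      exact Complex.continuous_ofReal.continuousAt.comp
        (Real.continuousAt_rpow_const _ _ (Or.inl hnr.ne'))
    refine h1.congr ?_
    filter_upwards [Ioi_mem_nhds hnr] with t ht
    rw [hf, Set.indicator_of_mem ht]
  have hinv := hfi.fourierInv_fourier_eq hFi hcont
  have hfn : f n = (((n : ℝ) ^ (s - 1) : ℝ) : ℂ) * cexp (-(2 * Real.pi * η * n)) := by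
    rw [hf, Set.indicator_of_mem (Set.mem_Ioi.2 hnr)]
    push_cast
    rfl
  rw [Real.fourierInv_eq' , hfn] at hinv
  have h2 : ∫ v : ℝ, cexp (((2 * Real.pi * inner ℝ v (n : ℝ) : ℝ) : ℂ) * I) • 𝓕 f v =
      ((Real.Gamma s * Real.pi ^ (-s) : ℝ) : ℂ) * cexp (-(2 * Real.pi * η * n)) *
      ∫ β : ℝ, 1 / (arcParam η β ^ (1 / 2 : ℂ)) ^ d *
      cexp (-(2 * Real.pi * I * n * (β + (η : ℂ) * I))) := by
    rw [← integral_const_mul, ← integral_neg_eq_self]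
    refine integral_congr_ae (ae_of_all _ fun β => ?_)
    simp only
    rw [hFf, neg_neg, smul_eq_mul]
    have : cexp (((2 * Real.pi * inner ℝ (-β) (n : ℝ) : ℝ) : ℂ) * I) =
        cexp (-(2 * Real.pi * η * n)) * cexp (-(2 * Real.pi * I * n * (β + (η : ℂ) * I))) := by
      rw [← Complex.exp_add]
      congr 1
      simp
      ring_nf
      rw [I_sq]
      ring
    rw [this]
    ring
  rw [h2] at hinv
  have hne : cexp (-(2 * Real.pi * η * n)) ≠ 0 := Complex.exp_ne_zero _
  have hconst : ((Real.Gamma s * Real.pi ^ (-s) : ℝ) : ℂ) * ((sphereConst d : ℝ) : ℂ) = 1 := by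
    rw [← ofReal_mul, sphereConst, ← hs, Real.rpow_neg Real.pi_pos.le]
    have : Real.pi ^ s ≠ 0 := (Real.rpow_pos_of_pos Real.pi_pos s).ne'
    rw [show Real.Gamma s * (Real.pi ^ s)⁻¹ * (Real.pi ^ s / Real.Gamma s) = 1 by
      field_simp]
    simp
  have hc0 : ((Real.Gamma s * Real.pi ^ (-s) : ℝ) : ℂ) ≠ 0 := left_ne_zero_of_mul_eq_one hconst
  apply mul_left_cancel₀ (mul_ne_zero hc0 hne)
  rw [hinv, ofReal_mul (sphereConst d)]
  calc _ = 1 * (((n : ℝ) ^ (s - 1) : ℝ) : ℂ) * cexp (-(2 * Real.pi * η * n)) := by ring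
    _ = _ := by rw [← hconst]; ring

theorem exists_mainArc_bound {d : ℕ} (hd : 4 ≤ d) {δ : ℝ} (hδ : 0 < δ) : ∃ C : ℝ, 0 < C ∧
    ∀ (η : ℝ) (n : ℕ), 0 < η → 0 < n →
    ‖(∫ β in (-δ)..δ, 1 / (arcParam η β ^ (1 / 2 : ℂ)) ^ d *
      cexp (-(2 * Real.pi * I * n * (β + (η : ℂ) * I)))) -
      ((sphereConst d * (n : ℝ) ^ ((d : ℝ) / 2 - 1) : ℝ) : ℂ)‖ ≤
      C * Real.exp (2 * Real.pi * η * n) := by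
  set c₁ : ℝ := 1 / (4 * Real.sqrt (2 * δ) ^ (d - 4)) with hc₁
  have hc₁0 : 0 < c₁ := by positivity
  refine ⟨c₁ * 2 * (Real.pi / δ), by positivity, ?_⟩
  intro η n hη hn
  set F : ℝ → ℂ := fun β => 1 / (arcParam η β ^ (1 / 2 : ℂ)) ^ d *
      cexp (-(2 * Real.pi * I * n * (β + (η : ℂ) * I))) with hF
  have hFn : ∀ β, ‖F β‖ = ‖1 / (arcParam η β ^ (1 / 2 : ℂ)) ^ d‖ * Real.exp (2 * Real.pi * η * n) := by
    intro β
    rw [hF, norm_mul, norm_arcKernel_term]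
  have hFc : Continuous F := (continuous_inv_arcParam_pow d hη).mul (by fun_prop)
  have hFi : Integrable F := by
    refine ((integrable_inv_arcParam_pow hd hη).norm.mul_const
      (Real.exp (2 * Real.pi * η * n))).mono' hFc.aestronglyMeasurable (ae_of_all _ fun β => ?_)
    rw [hFn]
  rw [← integral_inv_arcParam_mul_exp hd hη hn, intervalIntegral.integral_of_le (by linarith),
    norm_sub_rev]
  have hcompl := integral_add_compl (measurableSet_Ioc (a := -δ) (b := δ)) hFi
  rw [← hcompl, add_sub_cancel_left]
  refine (norm_integral_le_integral_norm _).trans ?_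
  have hLi := ((integrable_lorentz hδ 0).const_mul (c₁ * 2)).mul_const
    (Real.exp (2 * Real.pi * η * n))
  have h1 : ∫ β in (Set.Ioc (-δ) δ)ᶜ, ‖F β‖ ≤ ∫ β in (Set.Ioc (-δ) δ)ᶜ,
      c₁ * 2 * (1 / ((β - 0) ^ 2 + δ ^ 2)) * Real.exp (2 * Real.pi * η * n) := by
    refine setIntegral_mono_on hFi.norm.integrableOn hLi.integrableOn
      measurableSet_Ioc.compl fun β hβ => ?_
    have hβ2 : δ ^ 2 ≤ β ^ 2 := by
      rw [Set.mem_compl_iff, Set.mem_Ioc, not_and_or, not_lt, not_le] at hβ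
      rcases hβ with h | h <;> nlinarith
    rw [hFn, mul_assoc c₁ 2]
    gcongr
    refine (norm_inv_arcParam_pow_le hd hδ (by nlinarith [sq_nonneg η])).trans ?_
    rw [← hc₁]
    gcongr
    rw [sub_zero, mul_one_div, div_le_div_iff₀ (by positivity) (by positivity)]
    nlinarith [sq_nonneg η]
  refine h1.trans ((setIntegral_le_integral hLi (ae_of_all _ fun β => by
    simp only [Pi.zero_apply]; positivity)).trans (le_of_eq ?_))
  rw [integral_mul_const, integral_const_mul, integral_lorentz hδ]

/-- The truncated singular series of the level sums `sphereSum`. -/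
noncomputable def singSeries {d : ℕ} (A : Fin d → ℤ) (B Q : ℕ) [NeZero Q] (n : ℕ) : ℂ :=
  ∑ h ∈ Finset.range Q, gaussProd A B Q (h : ZMod Q) * cexp (-(2 * Real.pi * I * n * (h / Q : ℝ)))

theorem norm_singSeries_le {d : ℕ} (A : Fin d → ℤ) (B Q : ℕ) [NeZero Q] (n : ℕ) :
    ‖singSeries A B Q n‖ ≤ Q := by
  refine (norm_sum_le _ _).trans ?_
  calc _ ≤ ∑ h ∈ Finset.range Q, (1 : ℝ) := by
        refine Finset.sum_le_sum fun h _ => ?_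
        rw [norm_mul]
        have : ‖cexp (-(2 * Real.pi * I * n * (h / Q : ℝ)))‖ = 1 := by
          rw [show (-(2 * Real.pi * I * n * (h / Q : ℝ)) : ℂ) =
            ((-(2 * Real.pi * n * (h / Q)) : ℝ) : ℂ) * I by push_cast; ring]
          exact norm_exp_ofReal_mul_I _
        rw [this, mul_one]
        exact norm_gaussProd_le A B Q h
    _ = Q := by simp

theorem sum_sphereSum_eq_integral {d : ℕ} (A : Fin d → ℤ) (B Q N a b : ℕ) [NeZero Q] (hN : 0 < N) :
    ∑ n ∈ Finset.Ico a b, sphereSum (fun i => (A i : ℝ) / B) n =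
    ∑ h ∈ Finset.range Q, ∫ β in (-(1 / (2 * Q) : ℝ))..(1 / (2 * Q) : ℝ),
      thetaD (fun i => (A i : ℝ) / B)
        (((h / Q + β : ℝ) : ℂ) + ((1 / (N : ℝ) ^ 2 : ℝ) : ℂ) * I) * arcKernel N a b (h / Q + β) := by
  have hη : (0 : ℝ) < 1 / (N : ℝ) ^ 2 := by positivity
  set f : ℝ → ℂ := fun α => thetaD (fun i => (A i : ℝ) / B)
        ((α : ℂ) + ((1 / (N : ℝ) ^ 2 : ℝ) : ℂ) * I) * arcKernel N a b α with hf
  have hth : Continuous fun α : ℝ => thetaD (fun i => (A i : ℝ) / B)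
        ((α : ℂ) + ((1 / (N : ℝ) ^ 2 : ℝ) : ℂ) * I) := continuous_thetaD _ hη
  have hfc : Continuous f := hth.mul (continuous_arcKernel N a b)
  have := sum_integral_arcs (Nat.pos_of_ne_zero (NeZero.ne Q)) f (hfc.intervalIntegrable _ _)
  rw [this, hf]
  simp only [arcKernel, Finset.mul_sum]
  rw [intervalIntegral.integral_finsetSum]
  · refine Finset.sum_congr rfl fun n _ => ?_
    rw [← sphereSum_eq_integral _ hη (-(1 / (2 * Q) : ℝ)) n]
  · intro n _
    refine Continuous.intervalIntegrable (hth.mul ?_) _ _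
    fun_prop

theorem integral_main_arcs_eq {d : ℕ} (A : Fin d → ℤ) (B Q N a b : ℕ) [NeZero Q] (hN : 0 < N) :
    ∑ h ∈ Finset.range Q, ∫ β in (-(1 / (2 * Q) : ℝ))..(1 / (2 * Q) : ℝ),
      gaussProd A B Q (h : ZMod Q) / (arcParam (1 / (N : ℝ) ^ 2) β ^ (1 / 2 : ℂ)) ^ d *
        arcKernel N a b (h / Q + β) =
    ∑ n ∈ Finset.Ico a b, singSeries A B Q n * ∫ β in (-(1 / (2 * Q) : ℝ))..(1 / (2 * Q) : ℝ),
      1 / (arcParam (1 / (N : ℝ) ^ 2) β ^ (1 / 2 : ℂ)) ^ d *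
      cexp (-(2 * Real.pi * I * n * (β + ((1 / (N : ℝ) ^ 2 : ℝ) : ℂ) * I))) := by
  have hη : (0 : ℝ) < 1 / (N : ℝ) ^ 2 := by positivity
  simp only [singSeries, Finset.sum_mul]
  rw [Finset.sum_comm]
  refine Finset.sum_congr rfl fun h _ => ?_
  simp only [arcKernel, Finset.mul_sum]
  rw [intervalIntegral.integral_finsetSum]
  · refine Finset.sum_congr rfl fun n _ => ?_
    rw [← intervalIntegral.integral_const_mul]
    refine intervalIntegral.integral_congr fun β _ => ?_
    rw [show (-(2 * Real.pi * I * n * (((h / Q + β : ℝ) : ℂ) + ((1 / (N : ℝ) ^ 2 : ℝ) : ℂ) * I)) : ℂ) =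
      (-(2 * Real.pi * I * n * (h / Q : ℝ))) +
      (-(2 * Real.pi * I * n * (β + ((1 / (N : ℝ) ^ 2 : ℝ) : ℂ) * I))) by push_cast; ring, Complex.exp_add]
    ring
  · intro n _
    refine Continuous.intervalIntegrable (Continuous.mul ?_ ?_) _ _
    · simpa [div_eq_mul_inv] using (continuous_inv_arcParam_pow d hη).const_mul _
    · fun_prop

/-- Level sums of the lattice phases agree on average with the truncated singular series. -/
theorem exists_sum_sphereSum_bound {d : ℕ} (hd : 5 ≤ d) (A : Fin d → ℤ) (B : ℕ) :
    ∃ C : ℝ, 0 < C ∧ ∀ (Q : ℕ) [NeZero Q], B ∣ Q → ∀ ρ : ℝ, 0 < ρ → ∃ N₀ : ℕ, ∀ N a b : ℕ,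
      N₀ ≤ N → N ^ 2 ≤ a → a ≤ b → b ≤ (N + 4) ^ 2 →
      ‖∑ n ∈ Finset.Ico a b, (sphereSum (fun i => (A i : ℝ) / B) n -
        ((sphereConst d * (n : ℝ) ^ ((d : ℝ) / 2 - 1) : ℝ) : ℂ) * singSeries A B Q n)‖ ≤
        (C * seriesTail d Q + ρ) * (N : ℝ) ^ (d - 2) := by
  obtain ⟨C, hC, hA⟩ := exists_arcError_integral_bound hd A B
  refine ⟨C, hC, ?_⟩
  intro Q _ hB ρ hρ
  have hQ : 0 < Q := Nat.pos_of_ne_zero (NeZero.ne Q)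
  obtain ⟨C', hC', hA⟩ := hA Q hB
  obtain ⟨D, hD, hmain⟩ := exists_mainArc_bound (by omega : 4 ≤ d)
    (by positivity : (0 : ℝ) < 1 / (2 * Q))
  set E := Real.exp (50 * Real.pi) with hE
  have hlim : Tendsto (fun N : ℕ => C' * ((N : ℝ) ^ (-(1 / 4) : ℝ)) +
      (24 * Q * D * E) * ((N : ℝ) ^ (-(1 / 4) : ℝ))) atTop (𝓝 0) := by
    have h := (tendsto_rpow_neg_atTop (by norm_num : (0 : ℝ) < 1 / 4)).comp
      tendsto_natCast_atTop_atTop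
    simpa using (h.const_mul C').add (h.const_mul (24 * Q * D * E))
  obtain ⟨N₁, hN₁⟩ := eventually_atTop.1 ((hlim.eventually (gt_mem_nhds hρ)))
  refine ⟨max N₁ (2 * Q + 1), ?_⟩
  intro N a b hN ha hab hb
  have hNQ : 2 * Q < N := by have := le_of_max_le_right hN; omega
  have hN0 : 0 < N := by omega
  have hN1 : (1 : ℝ) ≤ N := by exact_mod_cast hN0
  have hη : (0 : ℝ) < 1 / (N : ℝ) ^ 2 := by positivity
  specialize hA N a b hNQ ha hab hb
  have key : ∑ n ∈ Finset.Ico a b, (sphereSum (fun i => (A i : ℝ) / B) n -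
        ((sphereConst d * (n : ℝ) ^ ((d : ℝ) / 2 - 1) : ℝ) : ℂ) * singSeries A B Q n) =
      (∑ h ∈ Finset.range Q, ∫ β in (-(1 / (2 * Q) : ℝ))..(1 / (2 * Q) : ℝ),
        arcError A B Q N h β * arcKernel N a b (h / Q + β)) +
      ∑ n ∈ Finset.Ico a b, singSeries A B Q n *
        ((∫ β in (-(1 / (2 * Q) : ℝ))..(1 / (2 * Q) : ℝ),
          1 / (arcParam (1 / (N : ℝ) ^ 2) β ^ (1 / 2 : ℂ)) ^ d *
            cexp (-(2 * Real.pi * I * n * (β + ((1 / (N : ℝ) ^ 2 : ℝ) : ℂ) * I)))) -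
          ((sphereConst d * (n : ℝ) ^ ((d : ℝ) / 2 - 1) : ℝ) : ℂ)) := by
    simp only [mul_sub, Finset.sum_sub_distrib]
    rw [sum_sphereSum_eq_integral A B Q N a b hN0, ← integral_main_arcs_eq A B Q N a b hN0,
      ← add_sub_assoc, ← Finset.sum_add_distrib]
    congr 1
    · refine Finset.sum_congr rfl fun h _ => ?_
      have hc1 := (continuous_arcError A B Q hN0 h)
      have hk : Continuous fun β : ℝ => arcKernel N a b (h / Q + β) :=
        (continuous_arcKernel N a b).comp (by fun_prop)
      rw [← intervalIntegral.integral_add]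
      · refine intervalIntegral.integral_congr fun β _ => ?_
        simp only [arcError]
        push_cast
        ring
      · exact (hc1.mul hk).intervalIntegrable _ _
      · refine Continuous.intervalIntegrable (Continuous.mul ?_ hk) _ _
        simpa [div_eq_mul_inv] using (continuous_inv_arcParam_pow d hη).const_mul _
    · exact Finset.sum_congr rfl fun n _ => mul_comm _ _
  rw [key]
  have h1 : ‖∑ h ∈ Finset.range Q, ∫ β in (-(1 / (2 * Q) : ℝ))..(1 / (2 * Q) : ℝ),
        arcError A B Q N h β * arcKernel N a b (h / Q + β)‖ ≤
        C' * (N : ℝ) ^ ((d : ℝ) / 2 + 1 / 4) + C * seriesTail d Q * N ^ (d - 2) := by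
    refine (norm_sum_le _ _).trans (le_trans (Finset.sum_le_sum fun h _ => ?_) hA)
    exact intervalIntegral.norm_integral_le_integral_norm (by
      have : (0 : ℝ) < 1 / (2 * Q) := by positivity
      linarith)
  have h2 : ‖∑ n ∈ Finset.Ico a b, singSeries A B Q n *
        ((∫ β in (-(1 / (2 * Q) : ℝ))..(1 / (2 * Q) : ℝ),
          1 / (arcParam (1 / (N : ℝ) ^ 2) β ^ (1 / 2 : ℂ)) ^ d *
            cexp (-(2 * Real.pi * I * n * (β + ((1 / (N : ℝ) ^ 2 : ℝ) : ℂ) * I)))) -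
          ((sphereConst d * (n : ℝ) ^ ((d : ℝ) / 2 - 1) : ℝ) : ℂ))‖ ≤ (24 * Q * D * E) * N := by
    refine (norm_sum_le _ _).trans ?_
    calc _ ≤ ∑ n ∈ Finset.Ico a b, (Q * (D * E) : ℝ) := by
          refine Finset.sum_le_sum fun n hn => ?_
          rw [Finset.mem_Ico] at hn
          rw [norm_mul]
          have hn0 : 0 < n := lt_of_lt_of_le (by positivity) (ha.trans hn.1)
          have e1 := hmain (1 / (N : ℝ) ^ 2) n hη hn0
          have e2 := norm_arcKernel_term_le (α := 0) hN0 (hn.2.le.trans hb)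
          rw [norm_arcKernel_term] at e2
          gcongr
          · exact norm_singSeries_le A B Q n
          · exact e1.trans (by gcongr)
      _ = ((b - a : ℕ) : ℝ) * (Q * (D * E)) := by simp
      _ ≤ (24 * N) * (Q * (D * E)) := by
          gcongr
          have : b - a ≤ 24 * N := by
            have : b ≤ a + 24 * N := by nlinarith
            omega
          exact_mod_cast this
      _ = _ := by ring
  refine (norm_add_le _ _).trans ((add_le_add h1 h2).trans ?_)
  have hs := (hN₁ N (le_of_max_le_left hN)).le
  have hp : (N : ℝ) ^ (d - 2) = (N : ℝ) ^ ((d : ℝ) - 2) := by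
    rw [← Real.rpow_natCast, Nat.cast_sub (by omega)]; norm_num
  have hd' : (5 : ℝ) ≤ d := by exact_mod_cast hd
  have e1 : (N : ℝ) ^ ((d : ℝ) / 2 + 1 / 4) ≤ (N : ℝ) ^ (-(1 / 4) : ℝ) * (N : ℝ) ^ (d - 2) := by
    rw [hp, ← Real.rpow_add (by linarith)]
    exact Real.rpow_le_rpow_of_exponent_le hN1 (by linarith)
  have e2 : (N : ℝ) ≤ (N : ℝ) ^ (-(1 / 4) : ℝ) * (N : ℝ) ^ (d - 2) := by
    rw [hp, ← Real.rpow_add (by linarith)]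
    conv_lhs => rw [← Real.rpow_one (N : ℝ)]
    exact Real.rpow_le_rpow_of_exponent_le hN1 (by linarith)
  have hpp : (0 : ℝ) ≤ (N : ℝ) ^ (d - 2) := by positivity
  have h3 := mul_le_mul_of_nonneg_right hs hpp
  have h4 := mul_le_mul_of_nonneg_left e1 hC'.le
  have h5 := mul_le_mul_of_nonneg_left e2 (by positivity : 0 ≤ 24 * Q * D * E)
  nlinarith

/-- Solutions of a Bessel-type equation `u'' = -u + μ u / r ^ 2` are bounded and asymptotically
trigonometric, with nontrivial amplitude. -/
theorem exists_bessel_asymptotics {u v : ℝ → ℝ} {μ : ℝ} (hμ : 0 ≤ μ)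
    (hu : ∀ r, 0 < r → HasDerivAt u (v r) r)
    (hv : ∀ r, 0 < r → HasDerivAt v (-u r + μ * u r / r ^ 2) r) (h1 : 0 < u 1 ^ 2 + v 1 ^ 2) :
    (∃ M : ℝ, 0 < M ∧ ∀ r, 1 ≤ r → |u r| ≤ M ∧ |v r| ≤ M) ∧
    ∃ P R : ℝ, 0 < P ^ 2 + R ^ 2 ∧
      Tendsto (fun r => u r * Real.cos r - v r * Real.sin r) atTop (𝓝 P) ∧
      Tendsto (fun r => u r * Real.sin r + v r * Real.cos r) atTop (𝓝 R) := by
  set E : ℝ → ℝ := fun r => u r ^ 2 + v r ^ 2 with hE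
  have hE0 : ∀ r, 0 ≤ E r := fun r => by positivity
  have hEd : ∀ r, 0 < r → HasDerivAt E (2 * μ * (u r * v r) / r ^ 2) r := by
    intro r hr
    refine (((hu r hr).pow 2).add ((hv r hr).pow 2)).congr_deriv ?_
    field_simp
    ring
  have hinv : ∀ r : ℝ, 0 < r → HasDerivAt (fun r : ℝ => μ / r) (-(μ / r ^ 2)) r := by
    intro r hr
    have := (hasDerivAt_inv hr.ne').const_mul μ
    refine (this.congr_deriv ?_).congr_of_eventuallyEq ?_
    · field_simp
    · exact Eventually.of_forall fun x => by simp [div_eq_mul_inv]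
  have hg1 : ∀ r, 0 < r → HasDerivAt (fun r => E r * Real.exp (μ / r))
      (-(Real.exp (μ / r) * (μ / r ^ 2) * (u r - v r) ^ 2)) r := by
    intro r hr
    refine ((hEd r hr).mul (hinv r hr).exp).congr_deriv ?_
    simp only [hE]
    field_simp
    ring
  have hg2 : ∀ r, 0 < r → HasDerivAt (fun r => E r * Real.exp (-(μ / r)))
      (Real.exp (-(μ / r)) * (μ / r ^ 2) * (u r + v r) ^ 2) r := by
    intro r hr
    refine ((hEd r hr).mul (hinv r hr).neg.exp).congr_deriv ?_
    simp only [hE, Pi.neg_apply]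
    field_simp
    ring
  have hup : ∀ r, 1 ≤ r → E r ≤ E 1 * Real.exp μ := by
    intro r hr
    have hanti : AntitoneOn (fun r => E r * Real.exp (μ / r)) (Set.Ici 1) := by
      refine antitoneOn_of_deriv_nonpos (convex_Ici 1) ?_ ?_ ?_
      · exact fun x hx => (hg1 x (lt_of_lt_of_le one_pos hx)).continuousAt.continuousWithinAt
      · intro x hx
        rw [interior_Ici] at hx
        exact (hg1 x (one_pos.trans hx)).differentiableAt.differentiableWithinAt
      · intro x hx
        rw [interior_Ici] at hx
        rw [(hg1 x (one_pos.trans hx)).deriv, neg_nonpos]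
        positivity
    have := hanti Set.self_mem_Ici (Set.mem_Ici.2 hr) hr
    simp only [div_one] at this
    refine le_trans ?_ this
    exact le_mul_of_one_le_right (hE0 r) (Real.one_le_exp (by positivity))
  have hlow : ∀ r, 1 ≤ r → E 1 * Real.exp (-μ) ≤ E r := by
    intro r hr
    have hmono : MonotoneOn (fun r => E r * Real.exp (-(μ / r))) (Set.Ici 1) := by
      refine monotoneOn_of_deriv_nonneg (convex_Ici 1) ?_ ?_ ?_
      · exact fun x hx => (hg2 x (lt_of_lt_of_le one_pos hx)).continuousAt.continuousWithinAt
      · intro x hx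
        rw [interior_Ici] at hx
        exact (hg2 x (one_pos.trans hx)).differentiableAt.differentiableWithinAt
      · intro x hx
        rw [interior_Ici] at hx
        rw [(hg2 x (one_pos.trans hx)).deriv]
        positivity
    have := hmono Set.self_mem_Ici (Set.mem_Ici.2 hr) hr
    simp only [div_one] at this
    refine le_trans this ?_
    refine mul_le_of_le_one_right (hE0 r) (Real.exp_le_one_iff.2 ?_)
    rw [neg_nonpos]; positivity
  have hE1 : 0 < E 1 := h1
  set M : ℝ := Real.sqrt (E 1 * Real.exp μ) with hM
  have hM0 : 0 < M := by positivity
  have hub : ∀ r, 1 ≤ r → |u r| ≤ M := fun r hr => by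
    rw [← Real.sqrt_sq_eq_abs]
    exact Real.sqrt_le_sqrt ((le_add_of_nonneg_right (sq_nonneg _)).trans (hup r hr))
  have hvb : ∀ r, 1 ≤ r → |v r| ≤ M := fun r hr => by
    rw [← Real.sqrt_sq_eq_abs]
    exact Real.sqrt_le_sqrt ((le_add_of_nonneg_left (sq_nonneg _)).trans (hup r hr))
  refine ⟨⟨M, hM0, fun r hr => ⟨hub r hr, hvb r hr⟩⟩, ?_⟩
  have hint : ∀ f : ℝ → ℝ, ContinuousOn f (Set.Ioi 1) → (∀ r, 1 ≤ r → |f r| ≤ 1) →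
      IntegrableOn (fun r => μ * u r * f r / r ^ 2) (Set.Ioi 1) := by
    intro f hf hfb
    have hb : IntegrableOn (fun r : ℝ => μ * M * r ^ (-2 : ℝ)) (Set.Ioi 1) :=
      (integrableOn_Ioi_rpow_of_lt (by norm_num) one_pos).const_mul _
    refine hb.mono' (ContinuousOn.aestronglyMeasurable ?_ measurableSet_Ioi)
      ((ae_restrict_mem measurableSet_Ioi).mono fun r hr => ?_)
    · have hc : ContinuousOn u (Set.Ioi 1) := fun x hx =>
        (hu x (one_pos.trans hx)).continuousAt.continuousWithinAt
      refine ((continuousOn_const.mul hc).mul hf).div (by fun_prop) fun x hx => ?_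
      have : (0 : ℝ) < x := one_pos.trans hx
      positivity
    · have hr' : 1 ≤ r := le_of_lt hr
      have hr0 : 0 < r := by linarith
      rw [Real.norm_eq_abs, abs_div, abs_mul, abs_mul, abs_of_nonneg hμ, abs_of_pos (pow_pos hr0 2),
        Real.rpow_neg hr0.le, div_eq_mul_inv]
      norm_cast
      have := hub r hr'
      have := hfb r hr'
      calc μ * |u r| * |f r| * (r ^ 2)⁻¹ ≤ μ * M * 1 * (r ^ 2)⁻¹ := by gcongr
        _ = _ := by ring
  have hp : ∀ r ∈ Set.Ioi (1 : ℝ), HasDerivAt (fun r => u r * Real.cos r - v r * Real.sin r)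
      (μ * u r * (-Real.sin r) / r ^ 2) r := by
    intro r hr
    have hr0 : (0 : ℝ) < r := one_pos.trans hr
    refine (((hu r hr0).mul (Real.hasDerivAt_cos r)).sub
      ((hv r hr0).mul (Real.hasDerivAt_sin r))).congr_deriv ?_
    field_simp
    ring
  have hq : ∀ r ∈ Set.Ioi (1 : ℝ), HasDerivAt (fun r => u r * Real.sin r + v r * Real.cos r)
      (μ * u r * (Real.cos r) / r ^ 2) r := by
    intro r hr
    have hr0 : (0 : ℝ) < r := one_pos.trans hr
    refine (((hu r hr0).mul (Real.hasDerivAt_sin r)).add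
      ((hv r hr0).mul (Real.hasDerivAt_cos r))).congr_deriv ?_
    field_simp
    ring
  have hP := tendsto_limUnder_of_hasDerivAt_of_integrableOn_Ioi hp
    (hint (fun r => -Real.sin r) (by fun_prop) fun r _ => by
      rw [abs_neg]; exact Real.abs_sin_le_one r)
  have hR := tendsto_limUnder_of_hasDerivAt_of_integrableOn_Ioi hq
    (hint Real.cos (by fun_prop) fun r _ => Real.abs_cos_le_one r)
  refine ⟨_, _, ?_, hP, hR⟩
  have hlim := (hP.pow 2).add (hR.pow 2)
  refine lt_of_lt_of_le (mul_pos hE1 (Real.exp_pos (-μ))) (ge_of_tendsto hlim ?_)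
  filter_upwards [eventually_ge_atTop 1] with r hr
  refine (hlow r hr).trans (le_of_eq ?_)
  simp only [hE]
  linear_combination (-(u r ^ 2 + v r ^ 2)) * Real.sin_sq_add_cos_sq r

theorem hasDerivAt_integral_mul_cos {w : ℝ → ℝ} (hw : Continuous w) (r : ℝ) :
    HasDerivAt (fun r => ∫ s in (-1 : ℝ)..1, w s * Real.cos (r * s))
      (-∫ s in (-1 : ℝ)..1, s * w s * Real.sin (r * s)) r := by
  have h := (intervalIntegral.hasDerivAt_integral_of_dominated_loc_of_deriv_le (μ := volume)
    (a := -1) (b := 1) (F := fun r s => w s * Real.cos (r * s))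
    (F' := fun r s => -(s * w s * Real.sin (r * s))) (x₀ := r) (s := Set.univ)
    (bound := fun s => |s * w s|) univ_mem
    (Eventually.of_forall fun r => by
      have : Continuous fun s => w s * Real.cos (r * s) := by fun_prop
      exact this.aestronglyMeasurable)
    (Continuous.intervalIntegrable (by fun_prop) _ _)
    (by
      have : Continuous fun s => -(s * w s * Real.sin (r * s)) := by fun_prop
      exact this.aestronglyMeasurable)
    (ae_of_all _ fun s _ r _ => by
      rw [norm_neg, norm_mul, Real.norm_eq_abs, Real.norm_eq_abs]
      exact mul_le_of_le_one_right (abs_nonneg _) (Real.abs_sin_le_one _))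
    (Continuous.intervalIntegrable (by fun_prop) _ _)
    (ae_of_all _ fun s _ r _ => by
      refine (((hasDerivAt_mul_const s).cos (x := r)).const_mul (w s)).congr_deriv ?_
      ring)).2
  rwa [intervalIntegral.integral_neg] at h

theorem hasDerivAt_integral_mul_sin {w : ℝ → ℝ} (hw : Continuous w) (r : ℝ) :
    HasDerivAt (fun r => ∫ s in (-1 : ℝ)..1, w s * Real.sin (r * s))
      (∫ s in (-1 : ℝ)..1, s * w s * Real.cos (r * s)) r := by
  exact (intervalIntegral.hasDerivAt_integral_of_dominated_loc_of_deriv_le (μ := volume)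
    (a := -1) (b := 1) (F := fun r s => w s * Real.sin (r * s))
    (F' := fun r s => s * w s * Real.cos (r * s)) (x₀ := r) (s := Set.univ)
    (bound := fun s => |s * w s|) univ_mem
    (Eventually.of_forall fun r => by
      have : Continuous fun s => w s * Real.sin (r * s) := by fun_prop
      exact this.aestronglyMeasurable)
    (Continuous.intervalIntegrable (by fun_prop) _ _)
    (by
      have : Continuous fun s => (s * w s * Real.cos (r * s)) := by fun_prop
      exact this.aestronglyMeasurable)
    (ae_of_all _ fun s _ r _ => by
      rw [norm_mul, Real.norm_eq_abs, Real.norm_eq_abs]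
      exact mul_le_of_le_one_right (abs_nonneg _) (Real.abs_cos_le_one _))
    (Continuous.intervalIntegrable (by fun_prop) _ _)
    (ae_of_all _ fun s _ r _ => by
      refine (((hasDerivAt_mul_const s).sin (x := r)).const_mul (w s)).congr_deriv ?_
      ring)).2

/-- Poisson's integral, proportional to `r ↦ r ^ (-(ν + 1 / 2)) J_{ν + 1 / 2}(r)`. -/
noncomputable def poissonInt (ν r : ℝ) : ℝ :=
  ∫ s in (-1 : ℝ)..1, (1 - s ^ 2) ^ ν * Real.cos (r * s)

/-- The derivative of `poissonInt`. -/
noncomputable def poissonIntDeriv (ν r : ℝ) : ℝ :=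
  -∫ s in (-1 : ℝ)..1, s * (1 - s ^ 2) ^ ν * Real.sin (r * s)

theorem continuous_poissonWeight {ν : ℝ} (hν : 1 ≤ ν) :
    Continuous fun s : ℝ => (1 - s ^ 2) ^ ν :=
  Continuous.rpow_const (by fun_prop) fun _ => Or.inr (by linarith)

theorem hasDerivAt_poissonInt {ν : ℝ} (hν : 1 ≤ ν) (r : ℝ) :
    HasDerivAt (poissonInt ν) (poissonIntDeriv ν r) r :=
  hasDerivAt_integral_mul_cos (continuous_poissonWeight hν) r

theorem poissonInt_by_parts {ν : ℝ} (hν : 1 ≤ ν) (r : ℝ) :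
    r * (∫ s in (-1 : ℝ)..1, (1 - s ^ 2) * (1 - s ^ 2) ^ ν * Real.cos (r * s)) +
      2 * (ν + 1) * poissonIntDeriv ν r = 0 := by
  have hc := continuous_poissonWeight hν
  have hd : ∀ s : ℝ, HasDerivAt (fun s : ℝ => (1 - s ^ 2) * (1 - s ^ 2) ^ ν * Real.sin (r * s))
      (r * ((1 - s ^ 2) * (1 - s ^ 2) ^ ν * Real.cos (r * s)) +
        2 * (ν + 1) * (-(s * (1 - s ^ 2) ^ ν * Real.sin (r * s)))) s := by
    intro s
    have h0 : HasDerivAt (fun s : ℝ => 1 - s ^ 2) (-(2 * s)) s := by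
      simpa using (hasDerivAt_pow 2 s).const_sub 1
    have h1 := (h0.rpow_const (p := ν) (Or.inr hν))
    have h2 : HasDerivAt (fun s => Real.sin (r * s)) (Real.cos (r * s) * r) s := by
      simpa using ((hasDerivAt_id s).const_mul r).sin
    refine ((h0.mul h1).mul h2).congr_deriv ?_
    have h3 : (1 - s ^ 2) * (1 - s ^ 2) ^ (ν - 1) = (1 - s ^ 2) ^ ν := by
      rcases eq_or_ne (1 - s ^ 2) 0 with h | h
      · rw [h, zero_mul, Real.zero_rpow (by linarith)]
      · rw [Real.rpow_sub_one h]; field_simp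
    simp only [Pi.mul_apply]
    rw [← h3]
    ring
  have hint := intervalIntegral.integral_eq_sub_of_hasDerivAt (a := -1) (b := 1) (fun s _ => hd s)
    (Continuous.intervalIntegrable (by fun_prop) _ _)
  rw [intervalIntegral.integral_add (Continuous.intervalIntegrable (by fun_prop) _ _)
    (Continuous.intervalIntegrable (by fun_prop) _ _), intervalIntegral.integral_const_mul,
    intervalIntegral.integral_const_mul, intervalIntegral.integral_neg] at hint
  rw [poissonIntDeriv, hint]
  norm_num

theorem hasDerivAt_poissonIntDeriv {ν : ℝ} (hν : 1 ≤ ν) {r : ℝ} (hr : 0 < r) :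
    HasDerivAt (poissonIntDeriv ν) (-(2 * (ν + 1) / r) * poissonIntDeriv ν r - poissonInt ν r) r := by
  have hc := continuous_poissonWeight hν
  have h := (hasDerivAt_integral_mul_sin (w := fun s => s * (1 - s ^ 2) ^ ν) (by fun_prop) r).neg
  refine h.congr_deriv ?_
  have hp := poissonInt_by_parts hν r
  have e : (∫ s in (-1 : ℝ)..1, (1 - s ^ 2) * (1 - s ^ 2) ^ ν * Real.cos (r * s)) =
      poissonInt ν r - ∫ s in (-1 : ℝ)..1, s * (s * (1 - s ^ 2) ^ ν) * Real.cos (r * s) := by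
    rw [poissonInt, ← intervalIntegral.integral_sub
      (Continuous.intervalIntegrable (by fun_prop) _ _)
      (Continuous.intervalIntegrable (by fun_prop) _ _)]
    refine intervalIntegral.integral_congr fun s _ => ?_
    ring
  rw [e] at hp
  generalize (∫ s in (-1 : ℝ)..1, s * (s * (1 - s ^ 2) ^ ν) * Real.cos (r * s)) = J at hp ⊢
  field_simp
  linarith

theorem poissonInt_one_pos {ν : ℝ} (hν : 1 ≤ ν) : 0 < poissonInt ν 1 := by
  have hc := continuous_poissonWeight hν
  refine intervalIntegral.intervalIntegral_pos_of_pos_on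
    (Continuous.intervalIntegrable (by fun_prop) _ _) (fun s hs => ?_) (by norm_num)
  have h1 : 0 < 1 - s ^ 2 := by nlinarith [hs.1, hs.2]
  refine mul_pos (Real.rpow_pos_of_pos h1 _) (Real.cos_pos_of_mem_Ioo ⟨?_, ?_⟩) <;>
    linarith [hs.1, hs.2, Real.pi_gt_three]

/-- `r ^ (ν + 1) * poissonInt ν r`, a solution of `u'' = -u + ν (ν + 1) u / r ^ 2`. -/
noncomputable def besselWave (ν r : ℝ) : ℝ := r ^ (ν + 1) * poissonInt ν r

/-- The derivative of `besselWave`. -/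
noncomputable def besselWaveDeriv (ν r : ℝ) : ℝ :=
  (ν + 1) * r ^ ν * poissonInt ν r + r ^ (ν + 1) * poissonIntDeriv ν r

theorem hasDerivAt_besselWave {ν : ℝ} (hν : 1 ≤ ν) {r : ℝ} (hr : 0 < r) :
    HasDerivAt (besselWave ν) (besselWaveDeriv ν r) r := by
  refine ((Real.hasDerivAt_rpow_const (p := ν + 1) (Or.inl hr.ne')).mul
    (hasDerivAt_poissonInt hν r)).congr_deriv ?_
  rw [besselWaveDeriv, add_sub_cancel_right]

theorem hasDerivAt_besselWaveDeriv {ν : ℝ} (hν : 1 ≤ ν) {r : ℝ} (hr : 0 < r) :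
    HasDerivAt (besselWaveDeriv ν)
      (-besselWave ν r + ν * (ν + 1) * besselWave ν r / r ^ 2) r := by
  have h1 := ((Real.hasDerivAt_rpow_const (p := ν) (Or.inl hr.ne')).const_mul (ν + 1)).mul
    (hasDerivAt_poissonInt hν r)
  have h2 := (Real.hasDerivAt_rpow_const (p := ν + 1) (Or.inl hr.ne')).mul
    (hasDerivAt_poissonIntDeriv hν hr)
  refine (h1.add h2).congr_deriv ?_
  rw [besselWave, add_sub_cancel_right, Real.rpow_add_one hr.ne', Real.rpow_sub_one hr.ne']
  field_simp
  ring

/-- `besselWave` rescaled to have period four asymptotically. -/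
noncomputable def ballWave (ν r : ℝ) : ℝ := besselWave ν (Real.pi / 2 * r)

/-- The first derivative of `ballWave`. -/
noncomputable def ballWaveDeriv (ν r : ℝ) : ℝ := Real.pi / 2 * besselWaveDeriv ν (Real.pi / 2 * r)

/-- The second derivative of `ballWave`. -/
noncomputable def ballWaveDeriv₂ (ν r : ℝ) : ℝ :=
  (-(Real.pi / 2) ^ 2 + ν * (ν + 1) / r ^ 2) * ballWave ν r

theorem hasDerivAt_ballWave {ν : ℝ} (hν : 1 ≤ ν) {r : ℝ} (hr : 0 < r) :
    HasDerivAt (ballWave ν) (ballWaveDeriv ν r) r := by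
  have h := (hasDerivAt_besselWave hν (by positivity : 0 < Real.pi / 2 * r)).comp r
    ((hasDerivAt_id r).const_mul (Real.pi / 2))
  refine h.congr_deriv ?_
  rw [ballWaveDeriv]; ring

theorem hasDerivAt_ballWaveDeriv {ν : ℝ} (hν : 1 ≤ ν) {r : ℝ} (hr : 0 < r) :
    HasDerivAt (ballWaveDeriv ν) (ballWaveDeriv₂ ν r) r := by
  have h := ((hasDerivAt_besselWaveDeriv hν (by positivity : 0 < Real.pi / 2 * r)).comp r
    ((hasDerivAt_id r).const_mul (Real.pi / 2))).const_mul (Real.pi / 2)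
  refine h.congr_deriv ?_
  rw [ballWaveDeriv₂, ballWave]
  field_simp

theorem exists_ballWave_bounds {ν : ℝ} (hν : 1 ≤ ν) :
    (∃ M : ℝ, 0 < M ∧ ∀ r, 1 ≤ r → |ballWave ν r| ≤ M ∧ |ballWaveDeriv ν r| ≤ M ∧
      |ballWaveDeriv₂ ν r| ≤ M) ∧
    (∃ b : ℕ, 0 < b ∧ ∃ l : ℝ, l ≠ 0 ∧ Tendsto (fun m : ℕ => ballWave ν ((b + 4 * m : ℕ) : ℝ)) atTop (𝓝 l)) ∧
    (∃ b : ℕ, 0 < b ∧ ∃ l : ℝ, l ≠ 0 ∧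
      Tendsto (fun m : ℕ => ballWaveDeriv ν ((b + 4 * m : ℕ) : ℝ)) atTop (𝓝 l) ∧
      Tendsto (fun m : ℕ => ballWaveDeriv ν ((b + 4 * m + 2 : ℕ) : ℝ)) atTop (𝓝 (-l))) := by
  have hμ : 0 ≤ ν * (ν + 1) := by nlinarith
  have hu1 : 0 < besselWave ν 1 := by
    rw [besselWave, Real.one_rpow, one_mul]; exact poissonInt_one_pos hν
  obtain ⟨⟨M, hM, hb⟩, P, R, hPR, hP, hR⟩ := exists_bessel_asymptotics hμ
    (fun r hr => hasDerivAt_besselWave hν hr) (fun r hr => hasDerivAt_besselWaveDeriv hν hr)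
    (by positivity)
  have hpi := Real.pi_gt_three
  refine ⟨?_, ?_⟩
  · set K := (Real.pi / 2) ^ 2 + ν * (ν + 1) with hK
    have hK0 : 0 < K := by positivity
    refine ⟨M + Real.pi / 2 * M + K * M, by positivity, fun r hr => ?_⟩
    obtain ⟨h1, h2⟩ := hb (Real.pi / 2 * r) (by nlinarith)
    have h3 : |ballWaveDeriv ν r| ≤ Real.pi / 2 * M := by
      rw [ballWaveDeriv, abs_mul, abs_of_pos (by positivity)]; gcongr
    have h4 : |ballWaveDeriv₂ ν r| ≤ K * M := by
      rw [ballWaveDeriv₂, abs_mul]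
      refine mul_le_mul ?_ h1 (abs_nonneg _) hK0.le
      refine (abs_add_le _ _).trans ?_
      rw [abs_neg, abs_of_nonneg (by positivity), abs_of_nonneg (by positivity)]
      have : ν * (ν + 1) / r ^ 2 ≤ ν * (ν + 1) := div_le_self hμ (one_le_pow₀ hr)
      linarith
    have h5 : |ballWave ν r| ≤ M := h1
    have : 0 < Real.pi / 2 * M := by positivity
    have : 0 < K * M := by positivity
    exact ⟨by linarith, by linarith, by linarith⟩
  have hseq : ∀ b : ℕ, Tendsto (fun m : ℕ => Real.pi / 2 * ((b + 4 * m : ℕ) : ℝ)) atTop atTop := by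
    intro b
    refine Tendsto.const_mul_atTop (by positivity) (tendsto_natCast_atTop_atTop.comp ?_)
    exact tendsto_atTop_mono (fun m => by simp only [id]; omega) tendsto_id
  have hcs : ∀ b m : ℕ, Real.cos (Real.pi / 2 * ((b + 4 * m : ℕ) : ℝ)) = Real.cos (Real.pi / 2 * b) ∧
      Real.sin (Real.pi / 2 * ((b + 4 * m : ℕ) : ℝ)) = Real.sin (Real.pi / 2 * b) := by
    intro b m
    have : Real.pi / 2 * ((b + 4 * m : ℕ) : ℝ) = Real.pi / 2 * b + m * (2 * Real.pi) := by
      push_cast; ring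
    rw [this, Real.cos_add_nat_mul_two_pi, Real.sin_add_nat_mul_two_pi]
    exact ⟨rfl, rfl⟩
  have hU : ∀ b : ℕ, Tendsto (fun m : ℕ => ballWave ν ((b + 4 * m : ℕ) : ℝ)) atTop
      (𝓝 (P * Real.cos (Real.pi / 2 * b) + R * Real.sin (Real.pi / 2 * b))) := by
    intro b
    have h := ((hP.comp (hseq b)).mul_const (Real.cos (Real.pi / 2 * b))).add
      ((hR.comp (hseq b)).mul_const (Real.sin (Real.pi / 2 * b)))
    refine h.congr fun m => ?_
    simp only [Function.comp, (hcs b m).1, (hcs b m).2, ballWave]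
    linear_combination besselWave ν (Real.pi / 2 * ((b + 4 * m : ℕ) : ℝ)) *
      Real.sin_sq_add_cos_sq (Real.pi / 2 * b)
  have hV : ∀ b : ℕ, Tendsto (fun m : ℕ => ballWaveDeriv ν ((b + 4 * m : ℕ) : ℝ)) atTop
      (𝓝 (Real.pi / 2 * (R * Real.cos (Real.pi / 2 * b) - P * Real.sin (Real.pi / 2 * b)))) := by
    intro b
    have h := (((hR.comp (hseq b)).mul_const (Real.cos (Real.pi / 2 * b))).sub
      ((hP.comp (hseq b)).mul_const (Real.sin (Real.pi / 2 * b)))).const_mul (Real.pi / 2)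
    refine h.congr fun m => ?_
    simp only [Function.comp, (hcs b m).1, (hcs b m).2, ballWaveDeriv]
    linear_combination Real.pi / 2 * besselWaveDeriv ν (Real.pi / 2 * ((b + 4 * m : ℕ) : ℝ)) *
      Real.sin_sq_add_cos_sq (Real.pi / 2 * b)
  have c1 : Real.cos (Real.pi / 2 * (1 : ℕ)) = 0 := by simp
  have s1 : Real.sin (Real.pi / 2 * (1 : ℕ)) = 1 := by simp
  have c4 : Real.cos (Real.pi / 2 * (4 : ℕ)) = 1 := by
    rw [show Real.pi / 2 * (4 : ℕ) = 2 * Real.pi by push_cast; ring]; simp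
  have s4 : Real.sin (Real.pi / 2 * (4 : ℕ)) = 0 := by
    rw [show Real.pi / 2 * (4 : ℕ) = 2 * Real.pi by push_cast; ring]; simp
  have hVs : ∀ b : ℕ, Tendsto (fun m : ℕ => ballWaveDeriv ν ((b + 4 * m + 2 : ℕ) : ℝ)) atTop
      (𝓝 (-(Real.pi / 2 * (R * Real.cos (Real.pi / 2 * b) - P * Real.sin (Real.pi / 2 * b))))) := by
    intro b
    have h := hV (b + 2)
    rw [show Real.pi / 2 * ((b + 2 : ℕ) : ℝ) = Real.pi / 2 * b + Real.pi by push_cast; ring,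
      Real.cos_add_pi, Real.sin_add_pi] at h
    have h' := h.congr (f₂ := fun m : ℕ => ballWaveDeriv ν ((b + 4 * m + 2 : ℕ) : ℝ)) fun m => by
      rw [show b + 2 + 4 * m = b + 4 * m + 2 by omega]
    convert h' using 2
    ring
  have hne : P ≠ 0 ∨ R ≠ 0 := by
    by_contra hcon
    push Not at hcon
    rw [hcon.1, hcon.2] at hPR
    norm_num at hPR
  refine ⟨?_, ?_⟩
  · rcases hne with h | h
    · refine ⟨4, by norm_num, P, h, ?_⟩
      have := hU 4
      rwa [c4, s4, mul_one, mul_zero, add_zero] at this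
    · refine ⟨1, by norm_num, R, h, ?_⟩
      have := hU 1
      rwa [c1, s1, mul_one, mul_zero, zero_add] at this
  · rcases hne with h | h
    · refine ⟨1, by norm_num, _, ?_, hV 1, hVs 1⟩
      rw [c1, s1, mul_zero, mul_one, zero_sub]
      exact mul_ne_zero (by positivity) (neg_ne_zero.2 h)
    · refine ⟨4, by norm_num, _, ?_, hV 4, hVs 4⟩
      rw [c4, s4, mul_zero, mul_one, sub_zero]
      exact mul_ne_zero (by positivity) h

theorem volume_real_sum_sq_le {m : ℕ} (t : ℝ) :
    volume.real {z : Fin m → ℝ | ∑ i, z i ^ 2 ≤ t} =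
      (if 0 ≤ t then t ^ ((m : ℝ) / 2) else 0) *
        volume.real (Metric.ball (0 : EuclideanSpace ℝ (Fin m)) 1) := by
  split_ifs with ht
  · have hmp := EuclideanSpace.volume_preserving_symm_measurableEquiv_toLp (Fin m)
    have h1 := hmp.measure_preimage_equiv {z : Fin m → ℝ | ∑ i, z i ^ 2 ≤ t}
    have h2 : (MeasurableEquiv.toLp 2 (Fin m → ℝ)).symm ⁻¹' {z : Fin m → ℝ | ∑ i, z i ^ 2 ≤ t} =
        Metric.closedBall (0 : EuclideanSpace ℝ (Fin m)) (Real.sqrt t) := by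
      ext z
      rw [mem_closedBall_zero_iff, EuclideanSpace.norm_eq, Real.sqrt_le_sqrt_iff ht]
      simp
    rw [h2, Measure.addHaar_closedBall _ _ (Real.sqrt_nonneg t)] at h1
    rw [Measure.real, ← h1, ENNReal.toReal_mul, ENNReal.toReal_ofReal (by positivity), Measure.real]
    congr 1
    rw [finrank_euclideanSpace_fin, Real.sqrt_eq_rpow, ← Real.rpow_natCast, ← Real.rpow_mul ht]
    ring_nf
  · have : {z : Fin m → ℝ | ∑ i, z i ^ 2 ≤ t} = ∅ := by
      ext z
      simp only [Set.mem_ofPred_eq, Set.mem_empty_iff_false, iff_false, not_le]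
      exact lt_of_lt_of_le (not_le.1 ht) (Finset.sum_nonneg fun i _ => sq_nonneg _)
    rw [this]
    simp

theorem integral_closedBall_coord {m : ℕ} {g : ℝ → ℂ} (hg : Continuous g) :
    ∫ y in Metric.closedBall (0 : EuclideanSpace ℝ (Fin (m + 1))) (1 / 2), g (y 0) =
      volume.real (Metric.ball (0 : EuclideanSpace ℝ (Fin m)) 1) *
        ∫ t in (-(1 / 2) : ℝ)..(1 / 2), ((1 / 4 - t ^ 2) ^ ((m : ℝ) / 2) : ℝ) * g t := by
  set Φ := (MeasurableEquiv.toLp 2 (Fin (m + 1) → ℝ)).symm.trans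
    (MeasurableEquiv.piFinSuccAbove (fun _ => ℝ) 0) with hΦ
  have hmp : MeasurePreserving Φ volume volume :=
    (volume_preserving_piFinSuccAbove (fun _ : Fin (m + 1) => ℝ) 0).comp
      (EuclideanSpace.volume_preserving_symm_measurableEquiv_toLp (Fin (m + 1)))
  set T : Set (ℝ × (Fin m → ℝ)) := {z | ∑ i, z.2 i ^ 2 ≤ 1 / 4 - z.1 ^ 2} with hT
  have hTm : MeasurableSet T := by
    refine measurableSet_le ?_ ?_ <;> fun_prop
  set F : ℝ × (Fin m → ℝ) → ℂ := T.indicator (fun z => g z.1) with hF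
  have hFΦ : ∀ y, F (Φ y) = (Metric.closedBall (0 : EuclideanSpace ℝ (Fin (m + 1))) (1 / 2)).indicator
      (fun y => g (y 0)) y := by
    intro y
    have h1 : (Φ y).1 = y 0 := rfl
    have h2 : ∀ i, (Φ y).2 i = y i.succ := fun i => rfl
    have hiff : Φ y ∈ T ↔ y ∈ Metric.closedBall (0 : EuclideanSpace ℝ (Fin (m + 1))) (1 / 2) := by
      rw [mem_closedBall_zero_iff, EuclideanSpace.norm_eq,
        Real.sqrt_le_left (by norm_num), hT, Set.mem_ofPred_eq, Fin.sum_univ_succ]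
      simp only [h1, h2, Real.norm_eq_abs, sq_abs]
      constructor <;> intro h <;> linarith
    rw [hF]
    by_cases h : Φ y ∈ T
    · rw [Set.indicator_of_mem h, Set.indicator_of_mem (hiff.1 h), h1]
    · rw [Set.indicator_of_notMem h, Set.indicator_of_notMem (fun h' => h (hiff.2 h'))]
  have hgi : Integrable ((Metric.closedBall (0 : EuclideanSpace ℝ (Fin (m + 1))) (1 / 2)).indicator
      (fun y => g (y 0))) := by
    rw [integrable_indicator_iff measurableSet_closedBall]
    exact ContinuousOn.integrableOn_compact (isCompact_closedBall _ _) (by fun_prop)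
  have hFi : Integrable F := by
    rw [← hmp.integrable_comp_emb Φ.measurableEmbedding]
    exact hgi.congr (Eventually.of_forall fun y => (hFΦ y).symm)
  rw [← integral_indicator measurableSet_closedBall]
  simp_rw [← hFΦ]
  rw [hmp.integral_comp Φ.measurableEmbedding F]
  rw [show (volume : Measure (ℝ × (Fin m → ℝ))) = (volume : Measure ℝ).prod volume from rfl] at hFi ⊢
  rw [integral_prod _ hFi]
  have hin : ∀ t : ℝ, ∫ z : Fin m → ℝ, F (t, z) =
      (Set.Icc (-(1 / 2) : ℝ) (1 / 2)).indicator (fun t =>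
        (volume.real (Metric.ball (0 : EuclideanSpace ℝ (Fin m)) 1) : ℂ) *
        (((1 / 4 - t ^ 2) ^ ((m : ℝ) / 2) : ℝ) * g t)) t := by
    intro t
    have hFt : ∀ z, F (t, z) = {z : Fin m → ℝ | ∑ i, z i ^ 2 ≤ 1 / 4 - t ^ 2}.indicator
        (fun _ => g t) z := fun z => rfl
    simp_rw [hFt]
    rw [integral_indicator_const _ (measurableSet_le (by fun_prop) (by fun_prop)),
      volume_real_sum_sq_le]
    by_cases ht : t ∈ Set.Icc (-(1 / 2) : ℝ) (1 / 2)
    · rw [Set.indicator_of_mem ht, if_pos (by nlinarith [ht.1, ht.2]), Complex.real_smul]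
      push_cast
      ring
    · rw [Set.indicator_of_notMem ht, if_neg, zero_mul, zero_smul]
      intro h
      refine ht ⟨?_, ?_⟩ <;> nlinarith
  simp_rw [hin]
  rw [integral_indicator measurableSet_Icc, integral_Icc_eq_integral_Ioc,
    ← intervalIntegral.integral_of_le (by norm_num), intervalIntegral.integral_const_mul]

theorem integral_closedBall_inner {m : ℕ} (v : EuclideanSpace ℝ (Fin (m + 1))) (g : ℝ → ℂ) :
    ∫ y in Metric.closedBall (0 : EuclideanSpace ℝ (Fin (m + 1))) (1 / 2), g (inner ℝ v y) =
      ∫ y in Metric.closedBall (0 : EuclideanSpace ℝ (Fin (m + 1))) (1 / 2), g (‖v‖ * y 0) := by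
  set w : EuclideanSpace ℝ (Fin (m + 1)) := EuclideanSpace.single 0 ‖v‖ with hw
  have hnw : ‖v‖ = ‖w‖ := by rw [hw, PiLp.norm_single]; simp
  set R := (ℝ ∙ (v - w))ᗮ.reflection with hR
  have hRv : R v = w := Submodule.reflection_sub hnw
  have hmp := R.measurePreserving
  rw [← integral_indicator measurableSet_closedBall, ← integral_indicator measurableSet_closedBall,
    ← hmp.integral_comp R.toHomeomorph.measurableEmbedding]
  refine integral_congr_ae (Eventually.of_forall fun y => ?_)
  have hRw : R w = v := by rw [← hRv]; exact Submodule.reflection_reflection _ v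
  have h1 : inner ℝ v (R y) = ‖v‖ * y 0 := by
    nth_rewrite 1 [← hRw]
    rw [R.inner_map_map w y, hw, EuclideanSpace.inner_single_left]
    simp
  by_cases hy : y ∈ Metric.closedBall (0 : EuclideanSpace ℝ (Fin (m + 1))) (1 / 2)
  · have hy' : R y ∈ Metric.closedBall (0 : EuclideanSpace ℝ (Fin (m + 1))) (1 / 2) := by
      rw [mem_closedBall_zero_iff] at hy ⊢
      rwa [R.norm_map]
    simp only
    rw [Set.indicator_of_mem hy, Set.indicator_of_mem hy', h1]
  · have hy' : R y ∉ Metric.closedBall (0 : EuclideanSpace ℝ (Fin (m + 1))) (1 / 2) := by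
      rw [mem_closedBall_zero_iff] at hy ⊢
      rwa [R.norm_map]
    simp only
    rw [Set.indicator_of_notMem hy, Set.indicator_of_notMem hy']

theorem integral_slice_eq_poissonInt {ν : ℝ} (hν : 1 ≤ ν) (r : ℝ) :
    ∫ t in (-(1 / 2) : ℝ)..(1 / 2), ((1 / 4 - t ^ 2) ^ ν : ℝ) * cexp (-(I * Real.pi * (r * t : ℝ))) =
      ((1 / 2 * (1 / 4) ^ ν * poissonInt ν (Real.pi / 2 * r) : ℝ) : ℂ) := by
  have hc := continuous_poissonWeight hν
  have h1 := intervalIntegral.integral_comp_div (a := -1) (b := 1) (c := 2)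
    (fun t : ℝ => (((1 / 4 - t ^ 2) ^ ν : ℝ) : ℂ) * cexp (-(I * Real.pi * (r * t : ℝ)))) (by norm_num)
  rw [show (-1 / 2 : ℝ) = -(1 / 2) by norm_num] at h1
  have h2 : ∀ s ∈ Set.uIcc (-1 : ℝ) 1, (((1 / 4 - (s / 2) ^ 2) ^ ν : ℝ) : ℂ) *
      cexp (-(I * Real.pi * (r * (s / 2) : ℝ))) =
      (((1 / 4) ^ ν : ℝ) : ℂ) * (((((1 - s ^ 2) ^ ν * Real.cos (Real.pi / 2 * r * s) : ℝ) : ℂ)) -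
        ((((1 - s ^ 2) ^ ν * Real.sin (Real.pi / 2 * r * s) : ℝ) : ℂ)) * I) := by
    intro s hs
    rw [Set.uIcc_of_le (by norm_num)] at hs
    rw [show (1 / 4 - (s / 2) ^ 2 : ℝ) = 1 / 4 * (1 - s ^ 2) by ring,
      Real.mul_rpow (by norm_num) (by nlinarith [hs.1, hs.2]),
      show (-(I * Real.pi * (r * (s / 2) : ℝ)) : ℂ) = ((-(Real.pi / 2 * r * s) : ℝ) : ℂ) * I by
        push_cast; ring, Complex.exp_mul_I, ← ofReal_cos, ← ofReal_sin, Real.cos_neg, Real.sin_neg]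
    push_cast
    ring
  rw [intervalIntegral.integral_congr h2, intervalIntegral.integral_const_mul,
    intervalIntegral.integral_sub (Continuous.intervalIntegrable (by fun_prop) _ _)
    (Continuous.intervalIntegrable (by fun_prop) _ _), intervalIntegral.integral_mul_const,
    intervalIntegral.integral_ofReal, intervalIntegral.integral_ofReal] at h1
  have hodd : ∫ s in (-1 : ℝ)..1, (1 - s ^ 2) ^ ν * Real.sin (Real.pi / 2 * r * s) = 0 := by
    have := intervalIntegral.integral_comp_neg (a := -1) (b := 1)
      (fun s : ℝ => (1 - s ^ 2) ^ ν * Real.sin (Real.pi / 2 * r * s))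
    simp only [neg_neg, mul_neg, Real.sin_neg, neg_sq, intervalIntegral.integral_neg] at this
    linarith
  rw [hodd, ofReal_zero, zero_mul, sub_zero] at h1
  rw [poissonInt]
  have h3 : (2 : ℝ) • (∫ t in (-(1 / 2) : ℝ)..(1 / 2), (((1 / 4 - t ^ 2) ^ ν : ℝ) : ℂ) *
      cexp (-(I * Real.pi * (r * t : ℝ)))) = 2 * (∫ t in (-(1 / 2) : ℝ)..(1 / 2),
      (((1 / 4 - t ^ 2) ^ ν : ℝ) : ℂ) * cexp (-(I * Real.pi * (r * t : ℝ)))) := by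
    rw [Complex.real_smul]; norm_num
  rw [h3] at h1
  have h4 : ∀ X Y : ℂ, Y = 2 * X → X = 1 / 2 * Y := fun X Y h => by rw [h]; ring
  rw [h4 _ _ h1]
  push_cast
  ring

/-- The Fourier coefficients of the ball of radius `1 / 2`. -/
theorem exists_ball_coeff {d : ℕ} (hd : 5 ≤ d) : ∃ c₁ : ℝ, c₁ ≠ 0 ∧ ∀ (k : Fin d → ℤ) (n : ℕ),
    0 < n → ∑ i, k i ^ 2 = (n : ℤ) →
    ∫ y in Metric.closedBall (0 : EuclideanSpace ℝ (Fin d)) (1 / 2),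
      cexp (-(I * Real.pi * ∑ i, (k i : ℂ) * (y i : ℂ))) =
    ((c₁ * ((n : ℝ) ^ (-((d : ℝ) + 1) / 4) * ballWave (((d : ℝ) - 1) / 2) (Real.sqrt n)) : ℝ) : ℂ) := by
  obtain ⟨m, rfl⟩ : ∃ m, d = m + 1 := ⟨d - 1, by omega⟩
  set ν : ℝ := (m : ℝ) / 2 with hν
  have hm4 : (4 : ℝ) ≤ m := by exact_mod_cast (by omega : 4 ≤ m)
  have hν1 : 1 ≤ ν := by rw [hν]; linarith
  have hν' : (((m + 1 : ℕ) : ℝ) - 1) / 2 = ν := by rw [hν]; push_cast; ring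
  set V := volume.real (Metric.ball (0 : EuclideanSpace ℝ (Fin m)) 1) with hV
  have hV0 : 0 < V := ENNReal.toReal_pos (Metric.measure_ball_pos _ _ one_pos).ne'
    measure_ball_lt_top.ne
  refine ⟨V * (1 / 2 * (1 / 4) ^ ν * (Real.pi / 2) ^ (-(ν + 1))), ?_, ?_⟩
  · have hpi := Real.pi_pos
    positivity
  intro k n hn hk
  set v : EuclideanSpace ℝ (Fin (m + 1)) := WithLp.toLp 2 (fun i => (k i : ℝ)) with hv
  have hnv : ‖v‖ = Real.sqrt n := by
    rw [EuclideanSpace.norm_eq]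
    congr 1
    have : ((∑ i, k i ^ 2 : ℤ) : ℝ) = (n : ℝ) := by rw [hk]; simp
    rw [← this]
    push_cast
    simp [hv]
  have h1 : ∀ y : EuclideanSpace ℝ (Fin (m + 1)),
      cexp (-(I * Real.pi * ∑ i, (k i : ℂ) * (y i : ℂ))) =
      (fun t : ℝ => cexp (-(I * Real.pi * (t : ℂ)))) (inner ℝ v y) := by
    intro y
    simp only
    congr 3
    rw [PiLp.inner_apply]
    push_cast
    refine Finset.sum_congr rfl fun i _ => ?_
    simp [hv, mul_comm]
  rw [integral_congr_ae (ae_of_all _ h1), integral_closedBall_inner v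
    (fun t : ℝ => cexp (-(I * Real.pi * (t : ℂ)))), integral_closedBall_coord (g := fun t => cexp (-(I * Real.pi * ((‖v‖ * t : ℝ) : ℂ))))
    (by fun_prop), integral_slice_eq_poissonInt hν1, ← hV, hν', ballWave, besselWave, ← ofReal_mul,
    ← hnv]
  congr 1
  have hpos : 0 < ‖v‖ := by rw [hnv]; positivity
  have hn' : (n : ℝ) = ‖v‖ ^ (2 : ℝ) := by
    rw [hnv, Real.rpow_two, Real.sq_sqrt (by positivity)]
  rw [hn', ← Real.rpow_mul hpos.le, Real.mul_rpow (by positivity) hpos.le,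
    Real.rpow_neg (by positivity), show (2 : ℝ) * (-(((m + 1 : ℕ) : ℝ) + 1) / 4) = -(ν + 1) by
      rw [hν]; push_cast; ring, Real.rpow_neg hpos.le]
  have e1 : (Real.pi / 2) ^ (ν + 1) ≠ 0 := (Real.rpow_pos_of_pos (by positivity) _).ne'
  have e2 : ‖v‖ ^ (ν + 1) ≠ 0 := (Real.rpow_pos_of_pos hpos _).ne'
  field_simp

theorem sum_range_natCast_zmod {Q : ℕ} [NeZero Q] {M : Type*} [AddCommMonoid M] (g : ZMod Q → M) :
    ∑ n ∈ Finset.range Q, g (n : ZMod Q) = ∑ s, g s := by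
  rw [← sum_fin_natCast_zmod, Finset.sum_range]

theorem singSeries_eq_sum_zmod {d : ℕ} (A : Fin d → ℤ) (B Q : ℕ) [NeZero Q] (n : ℕ) :
    singSeries A B Q n =
      ∑ h : ZMod Q, gaussProd A B Q h * ZMod.stdAddChar (-((n : ZMod Q) * h)) := by
  rw [← sum_range_natCast_zmod, singSeries]
  refine Finset.sum_congr rfl fun h _ => ?_
  congr 1
  rw [show (-((n : ZMod Q) * (h : ZMod Q))) = ((-(n * h) : ℤ) : ZMod Q) by push_cast; ring,
    ZMod.stdAddChar_coe]
  congr 1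
  push_cast
  ring

theorem singSeries_congr {d : ℕ} (A : Fin d → ℤ) (B Q : ℕ) [NeZero Q] {n m : ℕ}
    (h : (n : ZMod Q) = m) : singSeries A B Q n = singSeries A B Q m := by
  rw [singSeries_eq_sum_zmod, singSeries_eq_sum_zmod, h]

theorem sum_singSeries_mul_stdAddChar {d : ℕ} (A : Fin d → ℤ) (B Q : ℕ) [NeZero Q] (h₀ : ZMod Q) :
    ∑ n ∈ Finset.range Q, singSeries A B Q n * ZMod.stdAddChar ((n : ZMod Q) * h₀) =
      Q * gaussProd A B Q h₀ := by
  simp_rw [singSeries_eq_sum_zmod]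
  rw [sum_range_natCast_zmod (fun x : ZMod Q => (∑ h : ZMod Q, gaussProd A B Q h *
    ZMod.stdAddChar (-(x * h))) * ZMod.stdAddChar (x * h₀))]
  simp_rw [Finset.sum_mul]
  rw [Finset.sum_comm]
  have h1 : ∀ h : ZMod Q, ∑ x : ZMod Q, gaussProd A B Q h * (ZMod.stdAddChar (-(x * h)) : ℂ) *
      ZMod.stdAddChar (x * h₀) = if h = h₀ then Q * gaussProd A B Q h else 0 := by
    intro h
    have h2 : ∀ x : ZMod Q, gaussProd A B Q h * (ZMod.stdAddChar (-(x * h)) : ℂ) *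
      ZMod.stdAddChar (x * h₀) = gaussProd A B Q h * ZMod.stdAddChar (x * (h₀ - h)) := by
      intro x
      rw [mul_assoc, ← AddChar.map_add_eq_mul]
      congr 2
      ring
    simp_rw [h2]
    rw [← Finset.mul_sum, AddChar.sum_mulShift _ (ZMod.isPrimitive_stdAddChar Q)]
    rcases eq_or_ne h h₀ with rfl | hne
    · simp [ZMod.card, mul_comm]
    · rw [if_neg (sub_ne_zero.2 hne.symm), if_neg hne]; simp
  simp_rw [h1]
  simp

/-- Summatory function of `singSeries`. -/
noncomputable def singSum {d : ℕ} (A : Fin d → ℤ) (B Q : ℕ) [NeZero Q] (x : ℕ) : ℂ :=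
  ∑ n ∈ Finset.range x, singSeries A B Q n

theorem singSum_sub {d : ℕ} (A : Fin d → ℤ) (B Q : ℕ) [NeZero Q] {x y : ℕ} (h : x ≤ y) :
    singSum A B Q y - singSum A B Q x = ∑ n ∈ Finset.Ico x y, singSeries A B Q n := by
  rw [singSum, singSum, Finset.sum_Ico_eq_sub _ h]

theorem gaussProd_zero {d : ℕ} {A : Fin d → ℤ} {B Q : ℕ} [NeZero Q] (hB : B ∣ Q)
    (hA : ∃ i, ¬ (B : ℤ) ∣ A i) : gaussProd A B Q 0 = 0 := by
  obtain ⟨i, hi⟩ := hA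
  rw [gaussProd]
  refine Finset.prod_eq_zero (Finset.mem_univ i) ?_
  have hQ : Q ≠ 0 := NeZero.ne Q
  obtain ⟨e, rfl⟩ := hB
  have hB0 : 0 < B := Nat.pos_of_ne_zero (left_ne_zero_of_mul hQ)
  have he0 : e ≠ 0 := right_ne_zero_of_mul hQ
  rw [Nat.mul_div_cancel_left _ hB0, quadGauss]
  have h1 : ∀ s : ZMod (B * e), (ZMod.stdAddChar (0 * s ^ 2 + ((A i * (e : ℕ) : ℤ) : ZMod (B * e)) * s) : ℂ) =
      ZMod.stdAddChar (s * ((A i * (e : ℕ) : ℤ) : ZMod (B * e))) := fun s => by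
    rw [zero_mul, zero_add, mul_comm s]
  simp_rw [h1]
  rw [AddChar.sum_mulShift _ (ZMod.isPrimitive_stdAddChar _), if_neg]
  · simp
  · rw [ZMod.intCast_zmod_eq_zero_iff_dvd]
    push_cast
    rwa [mul_dvd_mul_iff_right (by exact_mod_cast he0)]

theorem sum_singSeries_period {d : ℕ} {A : Fin d → ℤ} {B Q : ℕ} [NeZero Q] (hB : B ∣ Q)
    (hA : ∃ i, ¬ (B : ℤ) ∣ A i) : ∑ n ∈ Finset.range Q, singSeries A B Q n = 0 := by
  have h := sum_singSeries_mul_stdAddChar A B Q 0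
  simpa [gaussProd_zero hB hA] using h

theorem singSum_add_period {d : ℕ} {A : Fin d → ℤ} {B Q : ℕ} [NeZero Q] (hB : B ∣ Q)
    (hA : ∃ i, ¬ (B : ℤ) ∣ A i) (x : ℕ) : singSum A B Q (x + Q) = singSum A B Q x := by
  rw [add_comm, singSum, Finset.sum_range_add, sum_singSeries_period hB hA, zero_add, singSum]
  refine Finset.sum_congr rfl fun n _ => singSeries_congr A B Q ?_
  simp

theorem singSum_congr {d : ℕ} {A : Fin d → ℤ} {B Q : ℕ} [NeZero Q] (hB : B ∣ Q)
    (hA : ∃ i, ¬ (B : ℤ) ∣ A i) {x y : ℕ} (h : x ≡ y [MOD Q]) :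
    singSum A B Q x = singSum A B Q y := by
  have h1 : ∀ k x, singSum A B Q (x + Q * k) = singSum A B Q x := by
    intro k
    induction k with
    | zero => simp
    | succ k ih => intro x; rw [Nat.mul_succ, ← add_assoc, singSum_add_period hB hA, ih]
  rw [← Nat.mod_add_div x Q, ← Nat.mod_add_div y Q, h1, h1, h]

theorem le_norm_gaussProd {d : ℕ} (A : Fin d → ℤ) {B Q : ℕ} [NeZero Q] (hB : 0 < B)
    (hBQ : 4 * B ∣ Q) :
    (1 / Real.sqrt (2 * B)) ^ d ≤ ‖gaussProd A B Q ((Q / (4 * B) : ℕ) : ZMod Q)‖ := by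
  obtain ⟨e, rfl⟩ := hBQ
  have he : 0 < e := Nat.pos_of_ne_zero (right_ne_zero_of_mul (NeZero.ne (4 * B * e)))
  rw [Nat.mul_div_cancel_left _ (by positivity)]
  set Q := 4 * B * e with hQ
  rw [gaussProd, norm_prod]
  have h1 : (1 / Real.sqrt (2 * B)) ^ d = ∏ _i : Fin d, (1 / Real.sqrt (2 * B)) := by simp
  rw [h1]
  rw [show Q / B = 4 * e by
    rw [hQ, show 4 * B * e = B * (4 * e) by ring, Nat.mul_div_cancel_left _ hB]]
  refine Finset.prod_le_prod (fun _ _ => by positivity) fun i _ => ?_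
  have hsq := quadGauss_norm_sq (q := Q) ((e : ℕ) : ZMod Q) ((A i * ((4 * e : ℕ)) : ℤ) : ZMod Q)
  have hker : ∀ u : ZMod Q, 2 * ((e : ℕ) : ZMod Q) * u = 0 →
      (ZMod.stdAddChar (((e : ℕ) : ZMod Q) * u ^ 2 + ((A i * ((4 * e : ℕ)) : ℤ) : ZMod Q) * u) : ℂ) = 1 := by
    intro u hu
    rw [← AddChar.map_zero_eq_one (ZMod.stdAddChar (N := Q))]
    congr 1
    have hu' : 2 * B ∣ u.val := by
      have : ((2 * e * u.val : ℕ) : ZMod Q) = 0 := by push_cast; rw [ZMod.natCast_zmod_val, hu]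
      rw [ZMod.natCast_eq_zero_iff] at this
      obtain ⟨c, hc⟩ := this
      refine ⟨c, ?_⟩
      apply Nat.eq_of_mul_eq_mul_left (by positivity : 0 < 2 * e)
      rw [hc, hQ]; ring
    obtain ⟨t, ht⟩ := hu'
    have hu2 : u = ((2 * B * t : ℕ) : ZMod Q) := by rw [← ht, ZMod.natCast_zmod_val]
    have hQ0 : (4 * B * e : ZMod Q) = 0 := by
      have := ZMod.natCast_self Q
      rw [hQ] at this
      push_cast at this
      exact this
    rw [hu2]
    push_cast
    linear_combination (B * t ^ 2 + 2 * A i * t : ZMod Q) * hQ0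
  rw [Finset.sum_congr rfl (g := fun _ => (1 : ℂ)) (fun u hu => hker u (Finset.mem_filter.1 hu).2),
    Finset.sum_const, nsmul_one] at hsq
  have hcard : 2 * e ≤ (Finset.univ.filter fun u : ZMod Q => 2 * ((e : ℕ) : ZMod Q) * u = 0).card := by
    rw [← Finset.card_range (2 * e)]
    refine Finset.card_le_card_of_injOn (fun t => ((2 * B * t : ℕ) : ZMod Q)) ?_ ?_
    · intro t _
      simp only [Finset.coe_filter, Finset.mem_univ, true_and, Set.mem_ofPred_eq]
      have : ((2 * e * (2 * B * t) : ℕ) : ZMod Q) = 0 := by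
        rw [ZMod.natCast_eq_zero_iff]
        exact ⟨t, by rw [hQ]; ring⟩
      push_cast at this ⊢
      exact this
    · intro t ht t' ht' h
      simp only [Finset.coe_range, Set.mem_Iio] at ht ht'
      have h2 := (ZMod.natCast_eq_natCast_iff' _ _ _).1 h
      have hlt : ∀ t, t < 2 * e → 2 * B * t < Q := fun t ht => by rw [hQ]; nlinarith
      rw [Nat.mod_eq_of_lt (hlt t ht), Nat.mod_eq_of_lt (hlt t' ht')] at h2
      exact Nat.eq_of_mul_eq_mul_left (by positivity) h2
  have hsq' : ‖quadGauss ((e : ℕ) : ZMod Q) ((A i * ((4 * e : ℕ)) : ℤ) : ZMod Q)‖ ^ 2 =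
      Q * (Finset.univ.filter fun u : ZMod Q => 2 * ((e : ℕ) : ZMod Q) * u = 0).card := by
    exact_mod_cast hsq
  have hQr : (Q : ℝ) = 4 * B * e := by rw [hQ]; push_cast; ring
  have hlow : (Q : ℝ) ^ 2 / (2 * B) ≤
      ‖quadGauss ((e : ℕ) : ZMod Q) ((A i * ((4 * e : ℕ)) : ℤ) : ZMod Q)‖ ^ 2 := by
    rw [hsq']
    calc (Q : ℝ) ^ 2 / (2 * B) = Q * (2 * e : ℕ) := by rw [hQr]; push_cast; field_simp; norm_num
      _ ≤ _ := by gcongr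
  have hsqrt := Real.sqrt_le_sqrt hlow
  rw [Real.sqrt_sq (norm_nonneg _), Real.sqrt_div (sq_nonneg _), Real.sqrt_sq (Nat.cast_nonneg _)] at hsqrt
  have hQ0 : (0 : ℝ) < Q := by rw [hQr]; positivity
  rw [norm_mul, norm_div, norm_one, Complex.norm_natCast]
  calc (1 / Real.sqrt (2 * B)) = 1 / Q * (Q / Real.sqrt (2 * B)) := by field_simp
    _ ≤ _ := by gcongr

theorem exists_le_norm_singSeries {d : ℕ} (A : Fin d → ℤ) {B Q : ℕ} [NeZero Q] (hB : 0 < B)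
    (hBQ : 4 * B ∣ Q) :
    ∃ n < Q, (1 / Real.sqrt (2 * B)) ^ d ≤ ‖singSeries A B Q n‖ := by
  by_contra! hcon
  have h := sum_singSeries_mul_stdAddChar A B Q ((Q / (4 * B) : ℕ) : ZMod Q)
  have hQ : 0 < Q := Nat.pos_of_ne_zero (NeZero.ne Q)
  have h1 : ‖∑ n ∈ Finset.range Q, singSeries A B Q n *
      ZMod.stdAddChar ((n : ZMod Q) * ((Q / (4 * B) : ℕ) : ZMod Q))‖ <
      Q * (1 / Real.sqrt (2 * B)) ^ d := by
    refine (norm_sum_le _ _).trans_lt ?_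
    calc _ < ∑ n ∈ Finset.range Q, (1 / Real.sqrt (2 * B)) ^ d := by
          refine Finset.sum_lt_sum_of_nonempty ⟨0, Finset.mem_range.2 hQ⟩ fun n hn => ?_
          rw [norm_mul, norm_stdAddChar, mul_one]
          exact hcon n (Finset.mem_range.1 hn)
      _ = _ := by simp
  rw [h, norm_mul, Complex.norm_natCast] at h1
  have h2 := le_norm_gaussProd A hB hBQ (Q := Q)
  have : (0 : ℝ) < Q := by exact_mod_cast hQ
  nlinarith

theorem stdAddChar_sum {Q : ℕ} [NeZero Q] {ι : Type*} (s : Finset ι) (f : ι → ZMod Q) :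
    (ZMod.stdAddChar (∑ i ∈ s, f i) : ℂ) = ∏ i ∈ s, ZMod.stdAddChar (f i) := by
  classical
  induction s using Finset.induction_on with
  | empty => simp
  | insert a s ha ih =>
    rw [Finset.sum_insert ha, Finset.prod_insert ha, AddChar.map_add_eq_mul, ih]

theorem singSeries_eq_sum_points {d : ℕ} (A : Fin d → ℤ) (B Q : ℕ) [NeZero Q] (n : ℕ) :
    singSeries A B Q n = Q * (1 / Q : ℂ) ^ d * ∑ s : Fin d → ZMod Q,
      if ∑ i, s i ^ 2 = (n : ZMod Q) then
        ∏ i, ZMod.stdAddChar (((A i * (Q / B : ℕ) : ℤ) : ZMod Q) * s i) else 0 := by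
  rw [singSeries_eq_sum_zmod]
  have h1 : ∀ h : ZMod Q, gaussProd A B Q h * ZMod.stdAddChar (-((n : ZMod Q) * h)) =
      (1 / Q : ℂ) ^ d * ∑ s : Fin d → ZMod Q,
        (∏ i, (ZMod.stdAddChar (((A i * (Q / B : ℕ) : ℤ) : ZMod Q) * s i) : ℂ)) *
        ZMod.stdAddChar (h * (∑ i, s i ^ 2 - (n : ZMod Q))) := by
    intro h
    rw [gaussProd, Finset.prod_mul_distrib]
    simp only [quadGauss]
    rw [Fintype.prod_sum, Finset.prod_const, Finset.card_univ, Fintype.card_fin, mul_assoc,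
      Finset.sum_mul]
    congr 1
    refine Finset.sum_congr rfl fun s _ => ?_
    rw [show h * (∑ i, s i ^ 2 - (n : ZMod Q)) = ∑ i, h * s i ^ 2 + -((n : ZMod Q) * h) by
      rw [← Finset.mul_sum]; ring, AddChar.map_add_eq_mul, stdAddChar_sum, ← mul_assoc,
      ← Finset.prod_mul_distrib]
    congr 1
    refine Finset.prod_congr rfl fun i _ => ?_
    rw [AddChar.map_add_eq_mul, mul_comm]
  simp_rw [h1]
  rw [← Finset.mul_sum, Finset.sum_comm, mul_comm (Q : ℂ), mul_assoc, Finset.mul_sum (a := (Q : ℂ))]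
  congr 1
  refine Finset.sum_congr rfl fun s _ => ?_
  rw [← Finset.mul_sum, AddChar.sum_mulShift _ (ZMod.isPrimitive_stdAddChar Q)]
  simp only [sub_eq_zero]
  split_ifs <;> simp [ZMod.card, mul_comm]

/-- Number of representations of `a` as a sum of `d` squares in a finite ring. -/
noncomputable def sqCount (F : Type*) [Fintype F] [CommRing F] (d : ℕ) (a : F) : ℕ :=
  by classical exact (Finset.univ.filter fun t : Fin d → F => ∑ i, t i ^ 2 = a).card

theorem stdAddChar_mul_chineseRemainder {Q p : ℕ} [NeZero Q] [NeZero p] [NeZero (Q * p)]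
    (hc : Q.Coprime p) (j : ℤ) (x : ZMod (Q * p)) :
    (ZMod.stdAddChar (((j * p : ℤ) : ZMod (Q * p)) * x) : ℂ) =
      ZMod.stdAddChar ((j : ZMod Q) * (ZMod.chineseRemainder hc x).1) := by
  obtain ⟨a, rfl⟩ := ZMod.intCast_surjective x
  rw [map_intCast, Prod.fst_intCast, ← Int.cast_mul, ← Int.cast_mul, ZMod.stdAddChar_coe,
    ZMod.stdAddChar_coe]
  congr 1
  have h1 : (Q : ℂ) ≠ 0 := Nat.cast_ne_zero.2 (NeZero.ne Q)
  have h2 : (p : ℂ) ≠ 0 := Nat.cast_ne_zero.2 (NeZero.ne p)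
  push_cast
  field_simp

theorem singSeries_mul_coprime {d : ℕ} (A : Fin d → ℤ) {B Q p : ℕ} [NeZero Q] [NeZero p]
    [NeZero (Q * p)] (hB : B ∣ Q) (hc : Q.Coprime p) (n : ℕ) :
    singSeries A B (Q * p) n =
      singSeries A B Q n * (p * (1 / p : ℂ) ^ d * sqCount (ZMod p) d n) := by
  classical
  have hB0 : 0 < B := Nat.pos_of_dvd_of_pos hB (Nat.pos_of_ne_zero (NeZero.ne Q))
  set e := ZMod.chineseRemainder hc with he
  set E : (Fin d → ZMod (Q * p)) ≃ (Fin d → ZMod Q) × (Fin d → ZMod p) :=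
    ((Equiv.refl (Fin d)).arrowCongr e.toEquiv).trans (Equiv.arrowProdEquivProdArrow _ _ _) with hE
  have hE1 : ∀ s i, (E s).1 i = (e (s i)).1 := fun s i => rfl
  have hE2 : ∀ s i, (E s).2 i = (e (s i)).2 := fun s i => rfl
  rw [singSeries_eq_sum_points, singSeries_eq_sum_points]
  have hsum : (∑ s : Fin d → ZMod (Q * p), if ∑ i, s i ^ 2 = ((n : ℕ) : ZMod (Q * p)) then
        ∏ i, (ZMod.stdAddChar (((A i * (Q * p / B : ℕ) : ℤ) : ZMod (Q * p)) * s i) : ℂ) else 0) =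
      ∑ z : (Fin d → ZMod Q) × (Fin d → ZMod p),
        (if ∑ i, z.1 i ^ 2 = ((n : ℕ) : ZMod Q) then
          ∏ i, (ZMod.stdAddChar (((A i * (Q / B : ℕ) : ℤ) : ZMod Q) * z.1 i) : ℂ) else 0) *
        (if ∑ i, z.2 i ^ 2 = ((n : ℕ) : ZMod p) then 1 else 0) := by
    refine Fintype.sum_equiv E _ _ fun s => ?_
    have hiff : ∑ i, s i ^ 2 = ((n : ℕ) : ZMod (Q * p)) ↔
        ∑ i, (E s).1 i ^ 2 = ((n : ℕ) : ZMod Q) ∧ ∑ i, (E s).2 i ^ 2 = ((n : ℕ) : ZMod p) := by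
      rw [← e.injective.eq_iff, map_sum, map_natCast, Prod.ext_iff, Prod.fst_sum, Prod.snd_sum,
        Prod.fst_natCast, Prod.snd_natCast]
      simp only [hE1, hE2, map_pow, Prod.pow_fst, Prod.pow_snd]
    have hprod : ∀ i, (ZMod.stdAddChar (((A i * (Q * p / B : ℕ) : ℤ) : ZMod (Q * p)) * s i) : ℂ) =
        ZMod.stdAddChar (((A i * (Q / B : ℕ) : ℤ) : ZMod Q) * (E s).1 i) := by
      intro i
      rw [hE1, ← stdAddChar_mul_chineseRemainder hc]
      congr 3
      rw [mul_comm Q p, Nat.mul_div_assoc p hB]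
      push_cast
      ring
    simp only [hprod, hiff]
    by_cases h1 : ∑ i, (E s).1 i ^ 2 = ((n : ℕ) : ZMod Q) <;>
      by_cases h2 : ∑ i, (E s).2 i ^ 2 = ((n : ℕ) : ZMod p) <;> simp [h1, h2]
  have hprod_sum : ∀ (u : (Fin d → ZMod Q) → ℂ) (v : (Fin d → ZMod p) → ℂ),
      ∑ z : (Fin d → ZMod Q) × (Fin d → ZMod p), u z.1 * v z.2 = (∑ s, u s) * ∑ t, v t := by
    intro u v
    rw [Fintype.sum_mul_sum, Fintype.sum_prod_type]
  have hsum' := hsum.trans (hprod_sum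
    (fun s => if ∑ i, s i ^ 2 = ((n : ℕ) : ZMod Q) then
      ∏ i, (ZMod.stdAddChar (((A i * (Q / B : ℕ) : ℤ) : ZMod Q) * s i) : ℂ) else 0)
    (fun t => if ∑ i, t i ^ 2 = ((n : ℕ) : ZMod p) then 1 else 0))
  rw [hsum']
  have hcount : (∑ t : Fin d → ZMod p, if ∑ i, t i ^ 2 = ((n : ℕ) : ZMod p) then (1 : ℂ) else 0) =
      sqCount (ZMod p) d n := by
    rw [Finset.sum_boole, sqCount]
    congr 2
    ext
    simp
  rw [hcount]
  push_cast
  rw [one_div, mul_inv, mul_pow]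
  ring

theorem sqCount_succ {F : Type*} [Fintype F] [CommRing F] (d : ℕ) (a : F) :
    sqCount F (d + 1) a = ∑ x : F, sqCount F d (a - x ^ 2) := by
  classical
  simp only [sqCount, Finset.card_filter]
  rw [← (Fin.consEquiv fun _ => F).sum_comp, Fintype.sum_prod_type]
  refine Finset.sum_congr rfl fun x _ => Finset.sum_congr rfl fun t _ => ?_
  simp only [Fin.consEquiv_apply, Fin.sum_univ_succ, Fin.cons_zero, Fin.cons_succ]
  congr 1
  rw [eq_iff_iff, eq_sub_iff_add_eq, add_comm]

theorem sum_sqCount {F : Type*} [Fintype F] [CommRing F] (d : ℕ) :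
    ∑ a : F, sqCount F d a = Fintype.card F ^ d := by
  classical
  simp only [sqCount, Finset.card_filter]
  rw [Finset.sum_comm]
  simp

theorem sqCount_mul_sq {F : Type*} [Fintype F] [Field F] (d : ℕ) (a : F) {c : F} (hc : c ≠ 0) :
    sqCount F d (a * c ^ 2) = sqCount F d a := by
  classical
  simp only [sqCount, Finset.card_filter]
  rw [← ((Equiv.refl (Fin d)).arrowCongr (Equiv.mulRight₀ c hc)).sum_comp]
  refine Finset.sum_congr rfl fun t _ => ?_
  congr 1
  rw [eq_iff_iff]
  have : ∑ i, ((Equiv.refl (Fin d)).arrowCongr (Equiv.mulRight₀ c hc)) t i ^ 2 =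
      (∑ i, t i ^ 2) * c ^ 2 := by
    rw [Finset.sum_mul]
    refine Finset.sum_congr rfl fun i _ => ?_
    simp [mul_pow]
  rw [this]
  exact mul_left_inj' (pow_ne_zero 2 hc)

theorem sqCount_add_two {F : Type*} [Fintype F] [Field F] {i : F} (hi : i ^ 2 = -1)
    (h2 : (2 : F) ≠ 0) (d : ℕ) (a : F) :
    sqCount F (d + 2) a =
      Fintype.card F * sqCount F d a + (Fintype.card F - 1) * Fintype.card F ^ d := by
  classical
  rw [sqCount_succ]
  simp_rw [sqCount_succ]
  have hi0 : i ≠ 0 := by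
    rintro rfl
    norm_num at hi
  have h1 : ∑ x : F, ∑ y : F, sqCount F d (a - x ^ 2 - y ^ 2) =
      ∑ u : F, ∑ v : F, sqCount F d (a - u * v) := by
    rw [← Fintype.sum_prod_type', ← Fintype.sum_prod_type']
    let E : F × F ≃ F × F :=
      { toFun := fun z => (z.1 + i * z.2, z.1 - i * z.2)
        invFun := fun z => ((z.1 + z.2) / 2, (z.1 - z.2) / (2 * i))
        left_inv := fun z => by
          ext <;> field_simp <;> ring
        right_inv := fun z => by
          ext <;> field_simp <;> ring }
    refine Fintype.sum_equiv E _ _ fun z => ?_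
    congr 1
    change a - z.1 ^ 2 - z.2 ^ 2 = a - (z.1 + i * z.2) * (z.1 - i * z.2)
    linear_combination (-(z.2 ^ 2)) * hi
  rw [h1, ← Finset.add_sum_erase _ _ (Finset.mem_univ (0 : F))]
  have h3 : ∀ u ∈ Finset.univ.erase (0 : F), ∑ v : F, sqCount F d (a - u * v) =
      Fintype.card F ^ d := by
    intro u hu
    have hu0 : u ≠ 0 := Finset.ne_of_mem_erase hu
    rw [← sum_sqCount d]
    exact ((Equiv.mulLeft₀ u hu0).trans (Equiv.subLeft a)).sum_comp (fun v => sqCount F d v)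
  rw [Finset.sum_congr rfl h3, Finset.sum_const, Finset.card_erase_of_mem (Finset.mem_univ _)]
  simp

theorem sqCount_zero_sub_one {F : Type*} [Fintype F] [Field F] {i : F} (hi : i ^ 2 = -1)
    (h2 : (2 : F) ≠ 0) (d : ℕ) :
    |(sqCount F d 0 : ℤ) - sqCount F d 1| = (Fintype.card F : ℤ) ^ (d / 2) := by
  classical
  have h0 : ∀ a : F, sqCount F 0 a = if a = 0 then 1 else 0 := by
    intro a
    simp only [sqCount, Finset.card_filter]
    simp [eq_comm]
  induction d using Nat.twoStepInduction with
  | zero => rw [h0, h0]; simp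
  | one =>
    have hs0 : sqCount F 1 0 = 1 := by
      rw [sqCount_succ]
      simp [h0]
    have hs1 : sqCount F 1 1 = 2 := by
      rw [sqCount_succ]
      simp only [h0]
      rw [← Finset.card_filter]
      have hne : (1 : F) ≠ -1 := by
        intro h
        apply h2
        linear_combination h
      refine Eq.trans (congrArg Finset.card ?_) (Finset.card_pair hne)
      ext x
      simp only [Finset.mem_filter, Finset.mem_univ, true_and, Finset.mem_insert,
        Finset.mem_singleton]
      rw [sub_eq_zero, eq_comm, sq, mul_self_eq_one_iff]
    rw [hs0, hs1]
    norm_num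
  | more d ih _ =>
    rw [sqCount_add_two hi h2, sqCount_add_two hi h2]
    push_cast
    rw [add_sub_add_right_eq_sub, ← mul_sub, abs_mul, ih, Nat.abs_cast,
      show (d + 2) / 2 = d / 2 + 1 by omega, pow_succ]
    ring

theorem exists_prime_forall_isSquare (K N₀ : ℕ) : ∃ p : ℕ, p.Prime ∧ N₀ < p ∧ p % 4 = 1 ∧
    ∀ j : ℤ, j.natAbs ≤ K → IsSquare (j : ZMod p) := by
  obtain ⟨p, hp, hN, hmod⟩ := Nat.exists_prime_gt_modEq_one (k := 8 * K.factorial) N₀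
    (by positivity)
  have h8 : p % 8 = 1 := hmod.of_mul_right _
  have h4 : p % 4 = 1 := by omega
  have : Fact p.Prime := ⟨hp⟩
  have hnat : ∀ n : ℕ, n ≤ K → IsSquare (n : ZMod p) := by
    intro n
    induction n using Nat.strong_induction_on with
    | _ n ih =>
      intro hn
      rcases Nat.lt_or_ge n 2 with h2 | h2
      · interval_cases n
        · exact ⟨0, by simp⟩
        · exact ⟨1, by simp⟩
      · have hq : n.minFac.Prime := Nat.minFac_prime (by omega)
        have hqd : n.minFac ∣ n := Nat.minFac_dvd n
        have hqn : n.minFac ≤ K := (Nat.minFac_le (by omega)).trans hn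
        have : Fact n.minFac.Prime := ⟨hq⟩
        have hqs : IsSquare ((n.minFac : ℕ) : ZMod p) := by
          by_cases hq2 : n.minFac = 2
          · rw [hq2, Nat.cast_ofNat]
            exact (ZMod.exists_sq_eq_two_iff (by omega)).2 (Or.inl h8)
          · rw [ZMod.exists_sq_eq_prime_iff_of_mod_four_eq_one h4 hq2]
            have h1 : p ≡ 1 [MOD n.minFac] := hmod.of_dvd
              ((hq.dvd_factorial.2 hqn).trans (dvd_mul_left _ _))
            have h2 : ((p : ℕ) : ZMod n.minFac) = ((1 : ℕ) : ZMod n.minFac) :=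
              (ZMod.natCast_eq_natCast_iff _ _ _).2 h1
            rw [h2]
            exact ⟨1, by simp⟩
        have hlt : n / n.minFac < n := Nat.div_lt_self (by omega) hq.one_lt
        have := hqs.mul (ih _ hlt (hlt.le.trans hn))
        rwa [← Nat.cast_mul, Nat.mul_div_cancel' hqd] at this
  refine ⟨p, hp, hN, h4, fun j hj => ?_⟩
  rcases Int.natAbs_eq j with h | h
  · rw [h, Int.cast_natCast]
    exact hnat _ hj
  · rw [h, Int.cast_neg, Int.cast_natCast, neg_eq_neg_one_mul]
    exact ((ZMod.exists_sq_eq_neg_one_iff).2 (by omega)).mul (hnat _ hj)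

theorem sqCount_of_isSquare {F : Type*} [Fintype F] [Field F] (d : ℕ) {a : F} (ha : a ≠ 0)
    (hs : IsSquare a) : sqCount F d a = sqCount F d 1 := by
  obtain ⟨c, rfl⟩ := hs
  have hc : c ≠ 0 := by
    rintro rfl
    simp at ha
  rw [← sqCount_mul_sq d 1 hc, one_mul, sq]

theorem le_norm_sqCount_sub {p : ℕ} [Fact p.Prime] (hp : p % 4 = 1) (d : ℕ) :
    (p : ℝ) ^ (-(((d : ℝ) - 1) / 2)) ≤
      ‖(p * (1 / p : ℂ) ^ d * sqCount (ZMod p) d 0 - p * (1 / p : ℂ) ^ d * sqCount (ZMod p) d 1)‖ := by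
  have hpp : p.Prime := Fact.out
  have hp0 : (0 : ℝ) < p := by exact_mod_cast hpp.pos
  obtain ⟨i, hi⟩ := (ZMod.exists_sq_eq_neg_one_iff (p := p)).2 (by omega)
  have h2 : (2 : ZMod p) ≠ 0 := by
    have : Fact (2 < p) := ⟨by have := hpp.two_le; omega⟩
    have h3 : p ≠ 2 := by omega
    intro h
    have : ((2 : ℕ) : ZMod p) = 0 := by exact_mod_cast h
    rw [ZMod.natCast_eq_zero_iff] at this
    exact h3 ((Nat.prime_dvd_prime_iff_eq hpp Nat.prime_two).1 this)
  have h := sqCount_zero_sub_one (i := i) (by rw [sq, ← hi]) h2 d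
  rw [ZMod.card] at h
  have h' : ‖((sqCount (ZMod p) d 0 : ℂ) - sqCount (ZMod p) d 1)‖ = (p : ℝ) ^ (d / 2) := by
    have h5 : ((sqCount (ZMod p) d 0 : ℂ) - sqCount (ZMod p) d 1) =
      (((sqCount (ZMod p) d 0 : ℤ) - (sqCount (ZMod p) d 1 : ℤ) : ℤ) : ℂ) := by push_cast; rfl
    rw [h5, Complex.norm_intCast]
    exact_mod_cast h
  rw [← mul_sub, norm_mul, h', norm_mul, norm_pow, norm_div, norm_one, Complex.norm_natCast,
    ← Real.rpow_natCast, ← Real.rpow_natCast, one_div, Real.inv_rpow hp0.le,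
    ← Real.rpow_neg hp0.le]
  nth_rewrite 2 [← Real.rpow_one (p : ℝ)]
  rw [← Real.rpow_add hp0, ← Real.rpow_add hp0]
  refine Real.rpow_le_rpow_of_exponent_le (by exact_mod_cast hpp.one_lt.le) ?_
  have h6 : d ≤ 2 * (d / 2) + 1 := by omega
  have h7 : (d : ℝ) ≤ 2 * ((d / 2 : ℕ) : ℝ) + 1 := by exact_mod_cast h6
  linarith

theorem natCast_rpow_zero_exponent {d : ℕ} (hd : 5 ≤ d) :
    ((0 : ℕ) : ℝ) ^ (-((d : ℝ) / 2 - 5 / 4)) = 0 := by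
  have : (5 : ℝ) ≤ d := by exact_mod_cast hd
  rw [Nat.cast_zero, Real.zero_rpow]
  linarith

theorem tendsto_seriesTail_mul_factorial {d : ℕ} (hd : 5 ≤ d) (Q : ℕ) :
    Tendsto (fun M : ℕ => seriesTail d (Q * M.factorial)) atTop (𝓝 0) := by
  have h := tendsto_tsum_of_dominated_convergence (summable_seriesTail_base hd)
    (f := fun (M q : ℕ) => if q ∣ Q * M.factorial then 0 else (q : ℝ) ^ (-((d : ℝ) / 2 - 5 / 4)))
    (g := fun _ => 0) (𝓕 := atTop) (fun q => ?_) (Eventually.of_forall fun M q => ?_)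
  · simpa [seriesTail] using h
  · refine tendsto_const_nhds.congr' ?_
    filter_upwards [eventually_ge_atTop q] with M hM
    rcases Nat.eq_zero_or_pos q with rfl | hq
    · rw [natCast_rpow_zero_exponent hd, ite_self]
    · rw [if_pos ((Nat.dvd_factorial hq hM).mul_left Q)]
  · split_ifs
    · rw [norm_zero]
      positivity
    · rw [Real.norm_of_nonneg (by positivity)]

theorem dvd_ordCompl_mul_pow_iff {p : ℕ} (hp : p.Prime) {q n : ℕ} (hn : n ≠ 0) (hqn : q ∣ n) (k : ℕ) :
    q ∣ ordCompl[p] n * p ^ k ↔ ¬ p ^ (k + 1) ∣ q := by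
  have hq0 : q ≠ 0 := fun h => hn (by rwa [h, zero_dvd_iff] at hqn)
  constructor
  · intro h1 h2
    have h3 := h2.trans h1
    rw [pow_succ', Nat.mul_dvd_mul_iff_right (pow_pos hp.pos k)] at h3
    exact Nat.not_dvd_ordCompl hp hn h3
  · intro h
    have h1 : q.factorization p ≤ k := by
      by_contra hlt
      exact h ((pow_dvd_pow p (by omega)).trans (Nat.ordProj_dvd q p))
    rw [← Nat.ordProj_mul_ordCompl_eq_self q p, mul_comm]
    exact mul_dvd_mul (Nat.ordCompl_dvd_ordCompl_of_dvd hqn p) (pow_dvd_pow p h1)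

theorem tendsto_seriesTail_ordCompl {d : ℕ} (hd : 5 ≤ d) {p : ℕ} (hp : p.Prime) (k : ℕ) :
    Tendsto (fun M : ℕ => seriesTail d (ordCompl[p] M.factorial * p ^ k)) atTop
      (𝓝 (((p : ℝ) ^ (k + 1)) ^ (-((d : ℝ) / 2 - 5 / 4)) *
        ∑' q : ℕ, (q : ℝ) ^ (-((d : ℝ) / 2 - 5 / 4)))) := by
  have hP : 0 < p ^ (k + 1) := pow_pos hp.pos _
  have hlim : ∑' q : ℕ, (if p ^ (k + 1) ∣ q then (q : ℝ) ^ (-((d : ℝ) / 2 - 5 / 4)) else 0) =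
      ((p : ℝ) ^ (k + 1)) ^ (-((d : ℝ) / 2 - 5 / 4)) *
        ∑' q : ℕ, (q : ℝ) ^ (-((d : ℝ) / 2 - 5 / 4)) := by
    rw [← (mul_right_injective₀ hP.ne').tsum_eq, ← tsum_mul_left]
    · refine tsum_congr fun q => ?_
      rw [if_pos (dvd_mul_right _ _), Nat.cast_mul, Real.mul_rpow (by positivity) (by positivity)]
      push_cast
      rfl
    · intro q hq
      have : p ^ (k + 1) ∣ q := by
        by_contra hn
        exact hq (if_neg hn)
      obtain ⟨m, rfl⟩ := this
      exact ⟨m, rfl⟩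
  rw [← hlim]
  refine tendsto_tsum_of_dominated_convergence (summable_seriesTail_base hd)
    (fun q => ?_) (Eventually.of_forall fun M q => ?_)
  · refine tendsto_const_nhds.congr' ?_
    filter_upwards [eventually_ge_atTop q] with M hM
    rcases Nat.eq_zero_or_pos q with rfl | hq
    · rw [natCast_rpow_zero_exponent hd, ite_self, ite_self]
    · have := dvd_ordCompl_mul_pow_iff hp (Nat.factorial_ne_zero M) (Nat.dvd_factorial hq hM) k
      by_cases h : p ^ (k + 1) ∣ q
      · rw [if_pos h, if_neg (by rw [this]; exact not_not_intro h)]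
      · rw [if_neg h, if_pos (this.2 h)]
  · split_ifs
    · rw [norm_zero]
      positivity
    · rw [Real.norm_of_nonneg (by positivity)]

theorem exists_coprime_seriesTail_le {d : ℕ} (hd : 5 ≤ d) {p D : ℕ} (hp : p.Prime) (hD : D.Coprime p) :
    ∃ Q : ℕ, 0 < Q ∧ Q.Coprime p ∧ D ∣ Q ∧
      seriesTail d Q ≤ (p : ℝ) ^ (-((d : ℝ) / 2 - 5 / 4)) *
        (1 + ∑' q : ℕ, (q : ℝ) ^ (-((d : ℝ) / 2 - 5 / 4))) ∧
      seriesTail d (Q * p) ≤ ((p : ℝ) ^ 2) ^ (-((d : ℝ) / 2 - 5 / 4)) *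
        (1 + ∑' q : ℕ, (q : ℝ) ^ (-((d : ℝ) / 2 - 5 / 4))) := by
  have hp0 : (0 : ℝ) < p := by exact_mod_cast hp.pos
  have hD0 : D ≠ 0 := by
    rintro rfl
    rw [Nat.coprime_zero_left] at hD
    exact hp.one_lt.ne' hD
  have h0 := tendsto_seriesTail_ordCompl hd hp 0
  have h1 := tendsto_seriesTail_ordCompl hd hp 1
  have key : ∀ k : ℕ, ((p : ℝ) ^ (k + 1)) ^ (-((d : ℝ) / 2 - 5 / 4)) *
      (∑' q : ℕ, (q : ℝ) ^ (-((d : ℝ) / 2 - 5 / 4))) <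
      ((p : ℝ) ^ (k + 1)) ^ (-((d : ℝ) / 2 - 5 / 4)) *
        (1 + ∑' q : ℕ, (q : ℝ) ^ (-((d : ℝ) / 2 - 5 / 4))) := by
    intro k
    refine mul_lt_mul_of_pos_left (by linarith) (by positivity)
  obtain ⟨M, hM0, hM1, hMD⟩ := ((h0.eventually_lt_const (key 0)).and
    ((h1.eventually_lt_const (key 1)).and (eventually_ge_atTop D))).exists
  refine ⟨ordCompl[p] M.factorial, Nat.ordCompl_pos p (Nat.factorial_ne_zero M),
    (Nat.coprime_ordCompl hp (Nat.factorial_ne_zero M)).symm, ?_, ?_, ?_⟩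
  · have h2 := Nat.dvd_factorial (Nat.pos_of_ne_zero hD0) hMD
    rw [← Nat.ordProj_mul_ordCompl_eq_self M.factorial p] at h2
    exact (hD.pow_right _).dvd_of_dvd_mul_left h2
  · simpa using hM0.le
  · simpa using hM1.le

theorem singSum_sub_eq_range {d : ℕ} (A : Fin d → ℤ) (B Q : ℕ) [NeZero Q] (x T : ℕ) :
    singSum A B Q (x + T) - singSum A B Q x = ∑ j ∈ Finset.range T, singSeries A B Q (x + j) := by
  rw [singSum_sub A B Q (Nat.le_add_right x T), Finset.sum_Ico_eq_sum_range, Nat.add_sub_cancel_left]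

theorem singSum_increment_sub {d : ℕ} (A : Fin d → ℤ) {B Q p x y j₀ T : ℕ} [NeZero Q]
    [Fact p.Prime] [NeZero (Q * p)] (hB : B ∣ Q) (hc : Q.Coprime p) (hxy : (x : ZMod Q) = y)
    (hx : ((x + j₀ : ℕ) : ZMod p) = 0) (hj : j₀ < T) (hT : T < p) (hy : 0 < y) (hyp : y + T ≤ p)
    (hsq : ∀ j : ℤ, j.natAbs ≤ y + T → IsSquare (j : ZMod p)) :
    (singSum A B (Q * p) (x + T) - singSum A B (Q * p) x) -
      (singSum A B (Q * p) (y + T) - singSum A B (Q * p) y) =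
    singSeries A B Q (y + j₀) *
      (p * (1 / p : ℂ) ^ d * sqCount (ZMod p) d 0 - p * (1 / p : ℂ) ^ d * sqCount (ZMod p) d 1) := by
  have hp0 : 0 < p := (Fact.out : p.Prime).pos
  rw [singSum_sub_eq_range, singSum_sub_eq_range, ← Finset.sum_sub_distrib]
  have hone : ∀ j : ℤ, j ≠ 0 → j.natAbs < p → j.natAbs ≤ y + T →
      sqCount (ZMod p) d (j : ZMod p) = sqCount (ZMod p) d 1 := by
    intro j hj0 hjp hjT
    refine sqCount_of_isSquare d (fun h => ?_) (hsq j hjT)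
    rw [ZMod.intCast_zmod_eq_zero_iff_dvd] at h
    have := Nat.le_of_dvd (by omega) (Int.natCast_dvd.1 h)
    omega
  have hterm : ∀ j ∈ Finset.range T,
      singSeries A B (Q * p) (x + j) - singSeries A B (Q * p) (y + j) =
      if j = j₀ then singSeries A B Q (y + j₀) *
      (p * (1 / p : ℂ) ^ d * sqCount (ZMod p) d 0 - p * (1 / p : ℂ) ^ d * sqCount (ZMod p) d 1)
      else 0 := by
    intro j hjT
    rw [Finset.mem_range] at hjT
    rw [singSeries_mul_coprime A hB hc, singSeries_mul_coprime A hB hc,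
      singSeries_congr A B Q (n := x + j) (m := y + j) (by push_cast; rw [hxy]), ← mul_sub]
    have h2 : sqCount (ZMod p) d ((y + j : ℕ) : ZMod p) = sqCount (ZMod p) d 1 := by
      have := hone ((y + j : ℕ) : ℤ) (by omega) (by omega) (by omega)
      rwa [Int.cast_natCast] at this
    have h1 : ((x + j : ℕ) : ZMod p) = (((j : ℤ) - j₀ : ℤ) : ZMod p) := by
      push_cast at hx ⊢
      linear_combination hx
    rw [h2]
    by_cases h : j = j₀
    · subst h
      rw [if_pos rfl, hx]
    · rw [if_neg h, h1, hone _ (by omega) (by omega) (by omega)]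
      ring
  rw [Finset.sum_congr rfl hterm, Finset.sum_ite_eq', if_pos (Finset.mem_range.2 hj)]

theorem exists_modEq_of_isSquare {Q p : ℕ} [NeZero Q] [NeZero p] (hc : Q.Coprime p) (u b : ℕ)
    {j : ℤ} (h : IsSquare (j : ZMod p)) :
    ∃ N : ℕ, b ≤ N ∧ N ≡ u [MOD Q] ∧ ((N ^ 2 : ℕ) : ZMod p) = j := by
  obtain ⟨r, hr⟩ := h
  obtain ⟨k, hk1, hk2⟩ := Nat.chineseRemainder hc u r.val
  have hQp : 0 < Q * p := Nat.mul_pos (Nat.pos_of_ne_zero (NeZero.ne Q))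
    (Nat.pos_of_ne_zero (NeZero.ne p))
  refine ⟨k + Q * p * b, ?_, ?_, ?_⟩
  · have := Nat.le_mul_of_pos_left b hQp
    omega
  · have h1 : Q * p * b ≡ 0 [MOD Q] := by
      rw [mul_assoc]
      exact (Nat.modEq_zero_iff_dvd).2 (dvd_mul_right _ _)
    simpa using hk1.add h1
  · have h2 : ((k : ℕ) : ZMod p) = r := by
      rw [(ZMod.natCast_eq_natCast_iff _ _ _).2 hk2, ZMod.natCast_zmod_val]
    push_cast
    rw [h2, ZMod.natCast_self p, hr]
    ring

theorem exists_forall_le_norm_singSeries {d : ℕ} (hd : 5 ≤ d) (A : Fin d → ℤ) {B : ℕ} (hB : 0 < B)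
    (x : ℕ) {C : ℝ} (hG : ∀ (Q Q' : ℕ) [NeZero Q] [NeZero Q'], B ∣ Q → B ∣ Q' → ∀ n,
      ‖singSeries A B Q n - singSeries A B Q' n‖ ≤ C * (seriesTail d Q + seriesTail d Q')) :
    ∃ c > 0, ∃ j₀ : ℕ, ∀ (Q : ℕ) [NeZero Q], B ∣ Q → C * seriesTail d Q ≤ c →
      c ≤ ‖singSeries A B Q (x + j₀)‖ := by
  have hc : (0 : ℝ) < (1 / √(2 * B)) ^ d := by
    have : (0 : ℝ) < B := by exact_mod_cast hB
    positivity
  have h1 := (tendsto_seriesTail_mul_factorial hd (4 * B)).const_mul C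
  rw [mul_zero] at h1
  obtain ⟨M, hM⟩ := (h1.eventually_lt_const (show (0 : ℝ) < (1 / √(2 * B)) ^ d / 3 by
    positivity)).exists
  have hR : NeZero (4 * B * M.factorial) := ⟨by positivity⟩
  obtain ⟨n, -, hn⟩ := exists_le_norm_singSeries A (Q := 4 * B * M.factorial) hB (dvd_mul_right _ _)
  refine ⟨(1 / √(2 * B)) ^ d / 3, by positivity, n + (4 * B * M.factorial - 1) * x,
    fun Q _ hBQ hQ => ?_⟩
  have h2 : singSeries A B (4 * B * M.factorial) (x + (n + (4 * B * M.factorial - 1) * x)) =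
      singSeries A B (4 * B * M.factorial) n := by
    refine singSeries_congr A B _ ?_
    have h3 : x + (n + (4 * B * M.factorial - 1) * x) = n + 4 * B * M.factorial * x := by
      obtain ⟨t, ht⟩ := Nat.exists_eq_succ_of_ne_zero hR.ne
      rw [ht, Nat.succ_sub_one]
      ring_nf
      rw [Nat.succ_eq_add_one]
      ring
    rw [h3, Nat.cast_add, Nat.cast_mul, ZMod.natCast_self, zero_mul, add_zero]
  have h4 := hG (4 * B * M.factorial) Q (dvd_mul_of_dvd_left (dvd_mul_left _ _) _) hBQ
    (x + (n + (4 * B * M.factorial - 1) * x))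
  rw [← h2] at hn
  have h5 := norm_sub_norm_le (singSeries A B (4 * B * M.factorial)
    (x + (n + (4 * B * M.factorial - 1) * x))) (singSeries A B Q
    (x + (n + (4 * B * M.factorial - 1) * x)))
  linarith

theorem singSum_squares_contradiction {d : ℕ} (hd : 5 ≤ d) (A : Fin d → ℤ) {B : ℕ} (hB : 0 < B)
    (hA : ∃ i, ¬ (B : ℤ) ∣ A i) {b : ℕ} (hb : 0 < b) {C : ℝ} (hC : 0 < C)
    (hF : ∀ (Q : ℕ) [NeZero Q], 4 * B ∣ Q → ∀ m m' : ℕ,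
      ‖singSum A B Q ((b + 4 * m) ^ 2) - singSum A B Q ((b + 4 * m') ^ 2)‖ ≤ C * seriesTail d Q)
    (hG : ∀ (Q Q' : ℕ) [NeZero Q] [NeZero Q'], B ∣ Q → B ∣ Q' → ∀ n,
      ‖singSeries A B Q n - singSeries A B Q' n‖ ≤ C * (seriesTail d Q + seriesTail d Q')) :
    False := by
  obtain ⟨c, hc, j₀, hj₀⟩ := exists_forall_le_norm_singSeries hd A hB (b ^ 2) hG
  obtain ⟨T, hT⟩ : ∃ T, (b + 4 * (j₀ + 1)) ^ 2 = b ^ 2 + T := ⟨8 * b * (j₀ + 1) + 16 * (j₀ + 1) ^ 2, by ring⟩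
  have hjT : j₀ < T := by nlinarith
  set Z : ℝ := 1 + ∑' q : ℕ, (q : ℝ) ^ (-((d : ℝ) / 2 - 5 / 4)) with hZ
  have hZ1 : 1 ≤ Z := by
    have : 0 ≤ ∑' q : ℕ, (q : ℝ) ^ (-((d : ℝ) / 2 - 5 / 4)) := tsum_nonneg fun q => by positivity
    linarith
  have hd5 : (5 : ℝ) ≤ d := by exact_mod_cast hd
  have hlim1 : Tendsto (fun p : ℕ => (p : ℝ) ^ (-((d : ℝ) / 2 - 5 / 4)) * Z * C) atTop (𝓝 0) := by
    have := (((tendsto_rpow_neg_atTop (y := (d : ℝ) / 2 - 5 / 4) (by linarith)).comp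
      tendsto_natCast_atTop_atTop).mul_const Z).mul_const C
    simpa [Function.comp_def] using this
  have hlim2 : Tendsto (fun p : ℕ => (p : ℝ) ^ (-((d : ℝ) / 2 - 2)) * (2 * Z * C)) atTop (𝓝 0) := by
    have := ((tendsto_rpow_neg_atTop (y := (d : ℝ) / 2 - 2) (by linarith)).comp
      tendsto_natCast_atTop_atTop).mul_const (2 * Z * C)
    simpa [Function.comp_def] using this
  obtain ⟨P₀, hP₀⟩ := eventually_atTop.1 ((hlim1.eventually_le_const hc).and
    (hlim2.eventually_lt_const hc))
  obtain ⟨p, hp, hpP, hp4, hsq⟩ := exists_prime_forall_isSquare (b ^ 2 + T) (P₀ + (b ^ 2 + T) + B)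
  have : Fact p.Prime := ⟨hp⟩
  have hp0 : (0 : ℝ) < p := by exact_mod_cast hp.pos
  obtain ⟨hp1, hp2⟩ := hP₀ p (by omega)
  have hcop : (4 * B).Coprime p := by
    refine Nat.Coprime.mul_left ?_ ?_
    · refine (Nat.coprime_primes Nat.prime_two hp).2 (by omega) |>.pow_left 2
    · exact (Nat.coprime_of_lt_prime hB.ne' (by omega) hp).symm
  obtain ⟨Q, hQ, hQp, hDQ, hε, hε2⟩ := exists_coprime_seriesTail_le hd hp hcop
  have : NeZero Q := ⟨hQ.ne'⟩
  have : NeZero (Q * p) := ⟨(Nat.mul_pos hQ hp.pos).ne'⟩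
  have hBQ : B ∣ Q := (dvd_mul_left _ _).trans hDQ
  have h4Q : 4 ∣ Q := (dvd_mul_right _ _).trans hDQ
  have hlow : c ≤ ‖singSeries A B Q (b ^ 2 + j₀)‖ := by
    refine hj₀ Q hBQ (le_trans ?_ hp1)
    rw [mul_comm]
    exact mul_le_mul_of_nonneg_right hε hC.le
  obtain ⟨N, hbN, hNQ, hNp⟩ := exists_modEq_of_isSquare hQp b b (hsq (-(j₀ : ℤ)) (by omega))
  obtain ⟨N', hbN', hNQ', hNp'⟩ := exists_modEq_of_isSquare hQp (b + 4 * (j₀ + 1)) b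
    (hsq ((T : ℤ) - j₀) (by omega))
  have hN4 : N ≡ b [MOD 4] := hNQ.of_dvd h4Q
  have hN4' : N' ≡ b + 4 * (j₀ + 1) [MOD 4] := hNQ'.of_dvd h4Q
  obtain ⟨m, rfl⟩ : ∃ m, N = b + 4 * m := ⟨(N - b) / 4, by
    have : N % 4 = b % 4 := hN4
    omega⟩
  obtain ⟨m', rfl⟩ : ∃ m', N' = b + 4 * m' := ⟨(N' - b) / 4, by
    have : N' % 4 = (b + 4 * (j₀ + 1)) % 4 := hN4'
    omega⟩
  have hcong : (b + 4 * m') ^ 2 ≡ (b + 4 * m) ^ 2 + T [MOD Q * p] := by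
    rw [← Nat.modEq_and_modEq_iff_modEq_mul hQp]
    constructor
    · refine (hNQ'.pow 2).trans ?_
      rw [hT]
      exact ((hNQ.pow 2).symm).add_right T
    · rw [← ZMod.natCast_eq_natCast_iff, hNp', Nat.cast_add, hNp]
      push_cast
      ring
  have hQpB : B ∣ Q * p := hBQ.mul_right p
  have hident := singSum_increment_sub (T := T) A hBQ hQp (x := (b + 4 * m) ^ 2) (y := b ^ 2) (j₀ := j₀)
    ((ZMod.natCast_eq_natCast_iff _ _ _).2 (hNQ.pow 2))
    (by rw [Nat.cast_add, hNp]; push_cast; ring) hjT (by omega) (by positivity) (by omega) hsq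
  rw [← singSum_congr hQpB hA hcong, ← hT] at hident
  have h1 := hF (Q * p) (hDQ.mul_right p) m' m
  have h2 := hF (Q * p) (hDQ.mul_right p) (j₀ + 1) 0
  rw [mul_zero, add_zero] at h2
  have h3 : ‖singSeries A B Q (b ^ 2 + j₀) *
      (p * (1 / p : ℂ) ^ d * sqCount (ZMod p) d 0 - p * (1 / p : ℂ) ^ d * sqCount (ZMod p) d 1)‖ ≤
      C * seriesTail d (Q * p) + C * seriesTail d (Q * p) := by
    rw [← hident]
    exact (norm_sub_le _ _).trans (add_le_add h1 h2)
  rw [norm_mul] at h3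
  have h4 := mul_le_mul hlow (le_norm_sqCount_sub hp4 d) (by positivity) (norm_nonneg _)
  have h5 : c * (p : ℝ) ^ (-(((d : ℝ) - 1) / 2)) ≤
      2 * C * (((p : ℝ) ^ 2) ^ (-((d : ℝ) / 2 - 5 / 4)) * Z) := by
    have := mul_le_mul_of_nonneg_left hε2 hC.le
    linarith
  have h6 : ((p : ℝ) ^ 2) ^ (-((d : ℝ) / 2 - 5 / 4)) =
      (p : ℝ) ^ (-((d : ℝ) / 2 - 2)) * (p : ℝ) ^ (-(((d : ℝ) - 1) / 2)) := by
    rw [← Real.rpow_natCast, ← Real.rpow_mul hp0.le, ← Real.rpow_add hp0]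
    congr 1
    push_cast
    ring
  rw [h6] at h5
  have h7 := mul_lt_mul_of_pos_right hp2 (Real.rpow_pos_of_pos hp0 (-(((d : ℝ) - 1) / 2)))
  linarith

theorem exists_sum_singSeries_sub_bound {d : ℕ} (hd : 5 ≤ d) (A : Fin d → ℤ) (B : ℕ) :
    ∃ C : ℝ, 0 < C ∧ ∀ (Q Q' : ℕ) [NeZero Q] [NeZero Q'], B ∣ Q → B ∣ Q' → ∀ x y : ℕ, x ≤ y →
      ‖∑ n ∈ Finset.Ico x y, (singSeries A B Q n - singSeries A B Q' n)‖ ≤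
        C * (seriesTail d Q + seriesTail d Q') := by
  obtain ⟨C, hC, hbound⟩ := exists_sum_sphereSum_bound hd A B
  have hκ : 0 < sphereConst d := sphereConst_pos (by omega)
  refine ⟨C / sphereConst d, by positivity, ?_⟩
  intro Q Q' _ _ hQ hQ' x y hxy
  suffices h : ‖∑ n ∈ Finset.Ico x y, (sphereConst d : ℂ) *
      (singSeries A B Q n - singSeries A B Q' n)‖ ≤ C * (seriesTail d Q + seriesTail d Q') by
    rw [← Finset.mul_sum, norm_mul, Complex.norm_real, Real.norm_of_nonneg hκ.le] at h
    rw [div_mul_eq_mul_div, le_div_iff₀ hκ, mul_comm _ (sphereConst d)]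
    exact h
  refine le_of_forall_pos_le_add fun ρ hρ => ?_
  obtain ⟨N₁, hN₁⟩ := hbound Q hQ (ρ / 2) (by positivity)
  obtain ⟨N₂, hN₂⟩ := hbound Q' hQ' (ρ / 2) (by positivity)
  have hQQ : 0 < Q * Q' := Nat.mul_pos (Nat.pos_of_ne_zero (NeZero.ne Q))
    (Nat.pos_of_ne_zero (NeZero.ne Q'))
  have hlim : Tendsto (fun t : ℕ => ∑ n ∈ Finset.Ico x y, ((sphereConst d *
      (1 + n * (((Q * Q' * t : ℕ) : ℝ) ^ 2)⁻¹) ^ ((d : ℝ) / 2 - 1) : ℝ) : ℂ) *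
      (singSeries A B Q n - singSeries A B Q' n)) atTop
      (𝓝 (∑ n ∈ Finset.Ico x y, (sphereConst d : ℂ) *
        (singSeries A B Q n - singSeries A B Q' n))) := by
    refine tendsto_finsetSum _ fun n _ => Tendsto.mul_const _ ?_
    have h1 : Tendsto (fun t : ℕ => ((Q * Q' * t : ℕ) : ℝ)) atTop atTop :=
      tendsto_natCast_atTop_atTop.comp (tendsto_id.const_mul_atTop' hQQ)
    have h2 : Tendsto (fun t : ℕ => 1 + (n : ℝ) * (((Q * Q' * t : ℕ) : ℝ) ^ 2)⁻¹) atTop (𝓝 1) := by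
      have := ((tendsto_inv_atTop_zero.comp ((tendsto_pow_atTop two_ne_zero).comp h1)).const_mul
        (n : ℝ)).const_add 1
      simpa [Function.comp_def] using this
    have h3 : Tendsto (fun t : ℕ => sphereConst d *
        (1 + n * (((Q * Q' * t : ℕ) : ℝ) ^ 2)⁻¹) ^ ((d : ℝ) / 2 - 1)) atTop (𝓝 (sphereConst d)) := by
      have := (h2.rpow_const (p := (d : ℝ) / 2 - 1) (Or.inl one_ne_zero)).const_mul (sphereConst d)
      simpa using this
    exact (Complex.continuous_ofReal.tendsto _).comp h3
  refine le_of_tendsto hlim.norm ?_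
  filter_upwards [eventually_ge_atTop (N₁ + N₂ + y + 1)] with t ht
  set N := Q * Q' * t with hN
  have hNt : t ≤ N := Nat.le_mul_of_pos_left t hQQ
  have hNr : (0 : ℝ) < N := by exact_mod_cast (show 0 < N by omega)
  have e1 := hN₁ N (x + N ^ 2) (y + N ^ 2) (by omega) (by omega) (by omega) (by nlinarith)
  have e2 := hN₂ N (x + N ^ 2) (y + N ^ 2) (by omega) (by omega) (by omega) (by nlinarith)
  have e3 : ‖∑ n ∈ Finset.Ico (x + N ^ 2) (y + N ^ 2),
      ((sphereConst d * (n : ℝ) ^ ((d : ℝ) / 2 - 1) : ℝ) : ℂ) *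
        (singSeries A B Q n - singSeries A B Q' n)‖ ≤
      (C * (seriesTail d Q + seriesTail d Q') + ρ) * (N : ℝ) ^ (d - 2) := by
    have := (norm_sub_le _ _).trans (add_le_add e2 e1)
    rw [← Finset.sum_sub_distrib] at this
    refine (le_of_eq ?_).trans (this.trans (le_of_eq ?_))
    · congr 1
      refine Finset.sum_congr rfl fun n _ => ?_
      ring
    · ring
  have e4 : ∑ n ∈ Finset.Ico (x + N ^ 2) (y + N ^ 2),
      ((sphereConst d * (n : ℝ) ^ ((d : ℝ) / 2 - 1) : ℝ) : ℂ) *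
        (singSeries A B Q n - singSeries A B Q' n) =
      (((N : ℝ) ^ (d - 2) : ℝ) : ℂ) * ∑ n ∈ Finset.Ico x y, ((sphereConst d *
      (1 + n * ((N : ℝ) ^ 2)⁻¹) ^ ((d : ℝ) / 2 - 1) : ℝ) : ℂ) *
      (singSeries A B Q n - singSeries A B Q' n) := by
    rw [Finset.mul_sum, ← Finset.sum_Ico_add']
    refine Finset.sum_congr rfl fun n _ => ?_
    rw [singSeries_congr A B Q (n := n + N ^ 2) (m := n) (by
      rw [hN]; push_cast; rw [ZMod.natCast_self Q]; ring),
      singSeries_congr A B Q' (n := n + N ^ 2) (m := n) (by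
      rw [hN]; push_cast; rw [ZMod.natCast_self Q']; ring), ← mul_assoc, ← Complex.ofReal_mul]
    congr 2
    have h5 : ((n + N ^ 2 : ℕ) : ℝ) = (N : ℝ) ^ 2 * (1 + n * ((N : ℝ) ^ 2)⁻¹) := by
      push_cast
      field_simp
      ring
    have h6 : ((N : ℝ) ^ 2) ^ ((d : ℝ) / 2 - 1) = (N : ℝ) ^ (d - 2) := by
      rw [← Real.rpow_natCast, ← Real.rpow_natCast, ← Real.rpow_mul hNr.le]
      congr 1
      rw [Nat.cast_sub (by omega)]
      push_cast
      ring
    rw [h5, Real.mul_rpow (by positivity) (by positivity), h6]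
    ring
  rw [e4, norm_mul, Complex.norm_real, Real.norm_of_nonneg (by positivity), mul_comm] at e3
  exact le_of_mul_le_mul_right e3 (by positivity)

/-- A wave `V(√t)` with amplitude `t ^ σ`. -/
noncomputable def modWave (σ : ℝ) (V : ℝ → ℝ) (t : ℝ) : ℝ := t ^ σ * V (Real.sqrt t)

theorem hasDerivAt_modWave {V V' : ℝ → ℝ} (hV : ∀ r, 0 < r → HasDerivAt V (V' r) r) (σ : ℝ)
    {t : ℝ} (ht : 0 < t) :
    HasDerivAt (modWave σ V) (σ * modWave (σ - 1) V t + 1 / 2 * modWave (σ - 1 / 2) V' t) t := by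
  have h1 := (hV (√t) (Real.sqrt_pos.2 ht)).comp t (Real.hasDerivAt_sqrt ht.ne')
  refine ((Real.hasDerivAt_rpow_const (p := σ) (Or.inl ht.ne')).mul h1).congr_deriv ?_
  have h2 : t ^ (σ - 1 / 2) = t ^ σ / √t := by
    rw [Real.rpow_sub ht, Real.sqrt_eq_rpow]
  rw [modWave, modWave, h2, Function.comp_apply]
  have := Real.sqrt_pos.2 ht
  field_simp

theorem rpow_le_of_mem_Icc {X t e : ℝ} (hX : 1 ≤ X) (h1 : X ≤ t) (h2 : t ≤ 27 * X) :
    t ^ e ≤ 27 ^ |e| * X ^ e := by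
  have hX0 : 0 < X := by linarith
  have hu1 : 1 ≤ t / X := by rwa [le_div_iff₀ hX0, one_mul]
  have hu2 : t / X ≤ 27 := by rwa [div_le_iff₀ hX0]
  have ht : t = t / X * X := by field_simp
  rw [ht, Real.mul_rpow (by positivity) hX0.le]
  refine mul_le_mul_of_nonneg_right ?_ (by positivity)
  exact (Real.rpow_le_rpow_of_exponent_le hu1 (le_abs_self e)).trans
    (Real.rpow_le_rpow (by positivity) hu2 (abs_nonneg e))

theorem abs_modWave_le {V : ℝ → ℝ} {M : ℝ} (hM : ∀ r, 1 ≤ r → |V r| ≤ M) {X t : ℝ} (σ : ℝ)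
    (hX : 1 ≤ X) (h1 : X ≤ t) (h2 : t ≤ 27 * X) :
    |modWave σ V t| ≤ M * 27 ^ |σ| * X ^ σ := by
  have ht : 0 < t := by linarith
  rw [modWave, abs_mul, abs_of_pos (Real.rpow_pos_of_pos ht _)]
  calc t ^ σ * |V √t| ≤ (27 ^ |σ| * X ^ σ) * M :=
        mul_le_mul (rpow_le_of_mem_Icc hX h1 h2) (hM _ (Real.one_le_sqrt.2 (by linarith)))
          (abs_nonneg _) (by positivity)
    _ = _ := by ring

theorem abs_modWave_deriv_le {V V' : ℝ → ℝ} {M : ℝ} (hM : ∀ r, 1 ≤ r → |V r| ≤ M)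
    (hM' : ∀ r, 1 ≤ r → |V' r| ≤ M) {X t : ℝ} (σ : ℝ)
    (hX : 1 ≤ X) (h1 : X ≤ t) (h2 : t ≤ 27 * X) :
    |σ * modWave (σ - 1) V t + 1 / 2 * modWave (σ - 1 / 2) V' t| ≤
      (|σ| * (M * 27 ^ |σ - 1|) + M * 27 ^ |σ - 1 / 2|) * X ^ (σ - 1 / 2) := by
  have hM0 : 0 ≤ M := (abs_nonneg _).trans (hM 1 le_rfl)
  have e1 := abs_modWave_le hM (σ - 1) hX h1 h2
  have e2 := abs_modWave_le hM' (σ - 1 / 2) hX h1 h2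
  have e3 : X ^ (σ - 1) ≤ X ^ (σ - 1 / 2) := Real.rpow_le_rpow_of_exponent_le hX (by linarith)
  have e4 : 0 ≤ X ^ (σ - 1 / 2) := by positivity
  have e5 : |modWave (σ - 1) V t| ≤ M * 27 ^ |σ - 1| * X ^ (σ - 1 / 2) :=
    e1.trans (mul_le_mul_of_nonneg_left e3 (by positivity))
  calc _ ≤ |σ * modWave (σ - 1) V t| + |1 / 2 * modWave (σ - 1 / 2) V' t| := abs_add_le _ _
    _ ≤ |σ| * (M * 27 ^ |σ - 1| * X ^ (σ - 1 / 2)) + M * 27 ^ |σ - 1 / 2| * X ^ (σ - 1 / 2) := by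
      rw [abs_mul, abs_mul, abs_of_pos (by norm_num : (0 : ℝ) < 1 / 2)]
      have := abs_nonneg (modWave (σ - 1 / 2) V' t)
      exact add_le_add (mul_le_mul_of_nonneg_left e5 (abs_nonneg _)) (by linarith)
    _ = _ := by ring

theorem abs_sub_le_of_hasDerivAt {g g' : ℝ → ℝ} {a b C : ℝ} (hab : a ≤ b)
    (hg : ∀ t ∈ Set.Icc a b, HasDerivAt g (g' t) t) (hC : ∀ t ∈ Set.Icc a b, |g' t| ≤ C) :
    |g b - g a| ≤ C * (b - a) := by
  have := (convex_Icc a b).norm_image_sub_le_of_norm_hasDerivWithin_le (f := g) (f' := g')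
    (fun t ht => (hg t ht).hasDerivWithinAt) hC (Set.left_mem_Icc.2 hab) (Set.right_mem_Icc.2 hab)
  rwa [Real.norm_eq_abs, Real.norm_of_nonneg (by linarith)] at this

theorem exists_modWave_bounds {V V' V'' : ℝ → ℝ} (hV : ∀ r, 0 < r → HasDerivAt V (V' r) r)
    (hV' : ∀ r, 0 < r → HasDerivAt V' (V'' r) r) {M : ℝ} (hM : ∀ r, 1 ≤ r → |V r| ≤ M)
    (hM' : ∀ r, 1 ≤ r → |V' r| ≤ M) (hM'' : ∀ r, 1 ≤ r → |V'' r| ≤ M) (σ : ℝ) :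
    ∃ C : ℝ, 0 < C ∧ ∀ X t : ℝ, 1 ≤ X → X ≤ t → t ≤ 25 * X →
      |modWave σ V t| ≤ C * X ^ σ ∧
      |modWave σ V (t + 1) - modWave σ V t| ≤ C * X ^ (σ - 1 / 2) ∧
      |(modWave σ V (t + 2) - modWave σ V (t + 1)) - (modWave σ V (t + 1) - modWave σ V t)| ≤
        C * X ^ (σ - 1) := by
  have hM0 : 0 ≤ M := (abs_nonneg _).trans (hM 1 le_rfl)
  set D : ℝ → ℝ := fun σ => |σ| * (M * 27 ^ |σ - 1|) + M * 27 ^ |σ - 1 / 2| with hD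
  have hD0 : ∀ σ, 0 ≤ D σ := fun σ => by positivity
  set g' : ℝ → ℝ := fun t => σ * modWave (σ - 1) V t + 1 / 2 * modWave (σ - 1 / 2) V' t with hg'
  set g'' : ℝ → ℝ := fun t =>
    σ * ((σ - 1) * modWave (σ - 1 - 1) V t + 1 / 2 * modWave (σ - 1 - 1 / 2) V' t) +
    1 / 2 * ((σ - 1 / 2) * modWave (σ - 1 / 2 - 1) V' t + 1 / 2 * modWave (σ - 1 / 2 - 1 / 2) V'' t)
    with hg''
  have d1 : ∀ t, 0 < t → HasDerivAt (modWave σ V) (g' t) t := fun t ht => hasDerivAt_modWave hV σ ht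
  have d2 : ∀ t, 0 < t → HasDerivAt g' (g'' t) t := fun t ht =>
    ((hasDerivAt_modWave hV (σ - 1) ht).const_mul σ).add
      ((hasDerivAt_modWave hV' (σ - 1 / 2) ht).const_mul (1 / 2))
  have b2 : ∀ X t : ℝ, 1 ≤ X → X ≤ t → t ≤ 27 * X →
      |g'' t| ≤ (|σ| * D (σ - 1) + D (σ - 1 / 2)) * X ^ (σ - 1) := by
    intro X t hX h1 h2
    have e1 := abs_modWave_deriv_le hM hM' (σ - 1) hX h1 h2
    have e2 : |(σ - 1 / 2) * modWave (σ - 1 / 2 - 1) V' t +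
        1 / 2 * modWave (σ - 1 / 2 - 1 / 2) V'' t| ≤ D (σ - 1 / 2) * X ^ (σ - 1 / 2 - 1 / 2) :=
      abs_modWave_deriv_le hM' hM'' (σ - 1 / 2) hX h1 h2
    have e3 : X ^ (σ - 1 - 1 / 2) ≤ X ^ (σ - 1) :=
      Real.rpow_le_rpow_of_exponent_le hX (by linarith)
    rw [show X ^ (σ - 1 / 2 - 1 / 2) = X ^ (σ - 1) by rw [sub_sub]; norm_num] at e2
    have e1' := e1.trans (mul_le_mul_of_nonneg_left e3 (hD0 (σ - 1)))
    calc |g'' t| ≤ _ := abs_add_le _ _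
      _ ≤ |σ| * (D (σ - 1) * X ^ (σ - 1)) + D (σ - 1 / 2) * X ^ (σ - 1) := by
        rw [abs_mul, abs_mul, abs_of_pos (by norm_num : (0 : ℝ) < 1 / 2)]
        refine add_le_add (mul_le_mul_of_nonneg_left e1' (abs_nonneg σ)) ?_
        have : 0 ≤ D (σ - 1 / 2) * X ^ (σ - 1) := mul_nonneg (hD0 _) (by positivity)
        linarith
      _ = _ := by ring
  refine ⟨M * 27 ^ |σ| + D σ + (|σ| * D (σ - 1) + D (σ - 1 / 2)) + 1, ?_, ?_⟩
  · have := hD0 σ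
    have := hD0 (σ - 1)
    have := hD0 (σ - 1 / 2)
    positivity
  intro X t hX h1 h2
  have p1 := hD0 σ
  have p2 := hD0 (σ - 1)
  have p3 := hD0 (σ - 1 / 2)
  have p4 : 0 ≤ M * 27 ^ |σ| := by positivity
  have p5 : 0 ≤ |σ| * D (σ - 1) := by positivity
  refine ⟨?_, ?_, ?_⟩
  · refine (abs_modWave_le hM σ hX h1 (by linarith)).trans ?_
    refine mul_le_mul_of_nonneg_right (by linarith) (by positivity)
  · have := abs_sub_le_of_hasDerivAt (g := modWave σ V) (g' := g') (a := t) (b := t + 1)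
      (C := D σ * X ^ (σ - 1 / 2)) (by linarith)
      (fun s hs => d1 s (by linarith [hs.1]))
      (fun s hs => abs_modWave_deriv_le hM hM' σ hX (by linarith [hs.1]) (by linarith [hs.2]))
    refine this.trans ?_
    rw [add_sub_cancel_left, mul_one]
    refine mul_le_mul_of_nonneg_right (by linarith) (by positivity)
  · have := abs_sub_le_of_hasDerivAt (g := fun s => modWave σ V (s + 1) - modWave σ V s)
      (g' := fun s => g' (s + 1) - g' s) (a := t) (b := t + 1)
      (C := (|σ| * D (σ - 1) + D (σ - 1 / 2)) * X ^ (σ - 1)) (by linarith)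
      (fun s hs => ((d1 (s + 1) (by linarith [hs.1])).comp_add_const s 1).sub
        (d1 s (by linarith [hs.1])))
      (fun s hs => by
        have := abs_sub_le_of_hasDerivAt (g := g') (g' := g'') (a := s) (b := s + 1)
          (C := (|σ| * D (σ - 1) + D (σ - 1 / 2)) * X ^ (σ - 1)) (by linarith)
          (fun r hr => d2 r (by linarith [hr.1, hs.1]))
          (fun r hr => b2 X r hX (by linarith [hr.1, hs.1]) (by linarith [hr.2, hs.2]))
        rwa [add_sub_cancel_left, mul_one] at this)
    simp only [add_assoc, one_add_one_eq_two, add_sub_cancel_left, mul_one] at this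
    refine this.trans (mul_le_mul_of_nonneg_right (by linarith) (by positivity))

theorem sum_Ico_mul_sub (v : ℕ → ℝ) (P : ℕ → ℂ) {a b : ℕ} (hab : a ≤ b) :
    ∑ n ∈ Finset.Ico a b, (v n : ℂ) * (P (n + 1) - P n) =
      v b * P b - v a * P a - ∑ n ∈ Finset.Ico a b, ((v (n + 1) - v n : ℝ) : ℂ) * P (n + 1) := by
  induction b, hab using Nat.le_induction with
  | base => simp
  | succ b hab ih =>
    rw [Finset.sum_Ico_succ_top hab, Finset.sum_Ico_succ_top hab, ih]
    push_cast
    ring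

theorem norm_sum_Ico_mul_le (v : ℕ → ℝ) (E : ℕ → ℂ) {a b : ℕ} (hab : a ≤ b) {D : ℝ}
    (hD : ∀ m, a ≤ m → m ≤ b → ‖∑ n ∈ Finset.Ico a m, E n‖ ≤ D) :
    ‖∑ n ∈ Finset.Ico a b, (v n : ℂ) * E n‖ ≤
      D * (|v b| + ∑ n ∈ Finset.Ico a b, |v (n + 1) - v n|) := by
  have h := sum_Ico_mul_sub v (fun m => ∑ n ∈ Finset.Ico a m, E n) hab
  have h1 : ∑ n ∈ Finset.Ico a b, (v n : ℂ) * E n = ∑ n ∈ Finset.Ico a b, (v n : ℂ) *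
      (∑ n ∈ Finset.Ico a (n + 1), E n - ∑ n ∈ Finset.Ico a n, E n) := by
    refine Finset.sum_congr rfl fun n hn => ?_
    rw [Finset.sum_Ico_succ_top (Finset.mem_Ico.1 hn).1, add_sub_cancel_left]
  rw [h1, h, Finset.Ico_self, Finset.sum_empty, mul_zero, sub_zero, mul_add,
    Finset.mul_sum (s := Finset.Ico a b) (a := D)]
  refine (norm_sub_le _ _).trans (add_le_add ?_ ((norm_sum_le _ _).trans
    (Finset.sum_le_sum fun n hn => ?_)))
  · rw [norm_mul, Complex.norm_real, Real.norm_eq_abs, mul_comm]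
    exact mul_le_mul_of_nonneg_right (hD b hab le_rfl) (abs_nonneg _)
  · rw [norm_mul, Complex.norm_real, Real.norm_eq_abs, mul_comm]
    rw [Finset.mem_Ico] at hn
    exact mul_le_mul_of_nonneg_right (hD (n + 1) (by omega) (by omega)) (abs_nonneg _)

theorem sum_block_le {g : ℕ → ℝ} {N : ℕ} (hN : 1 ≤ N) {c : ℝ}
    (h : ∀ n : ℕ, N ^ 2 ≤ n → n ≤ (N + 4) ^ 2 → g n ≤ c) (hc : 0 ≤ c) :
    ∑ n ∈ Finset.Ico (N ^ 2) ((N + 4) ^ 2), g n ≤ 24 * N * c := by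
  have h1 := Finset.sum_le_card_nsmul (Finset.Ico (N ^ 2) ((N + 4) ^ 2)) g c fun n hn => by
    rw [Finset.mem_Ico] at hn
    exact h n hn.1 hn.2.le
  refine h1.trans ?_
  rw [nsmul_eq_mul, Nat.card_Ico]
  refine mul_le_mul_of_nonneg_right ?_ hc
  have : (N + 4) ^ 2 - N ^ 2 ≤ 24 * N := by
    rw [Nat.sub_le_iff_le_add]
    nlinarith
  exact_mod_cast this

theorem block_cast_bounds {N n : ℕ} (hN : 1 ≤ N) (h1 : N ^ 2 ≤ n) (h2 : n ≤ (N + 4) ^ 2) :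
    (1 : ℝ) ≤ (N : ℝ) ^ 2 ∧ (N : ℝ) ^ 2 ≤ n ∧ (n : ℝ) ≤ 25 * (N : ℝ) ^ 2 := by
  have hNr : (1 : ℝ) ≤ N := by exact_mod_cast hN
  have h1' : (N : ℝ) ^ 2 ≤ n := by exact_mod_cast h1
  have h2' : (n : ℝ) ≤ ((N : ℝ) + 4) ^ 2 := by exact_mod_cast h2
  exact ⟨by nlinarith, h1', by nlinarith⟩

theorem sq_rpow_sub_half {N : ℝ} (hN : 0 < N) (σ : ℝ) :
    (N ^ 2) ^ (σ - 1 / 2) = (N ^ 2) ^ σ / N := by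
  rw [Real.rpow_sub (by positivity), ← Real.sqrt_eq_rpow, Real.sqrt_sq hN.le]

theorem sq_rpow_sub_one {N : ℝ} (hN : 0 < N) (σ : ℝ) :
    (N ^ 2) ^ (σ - 1) = (N ^ 2) ^ σ / N ^ 2 := by
  rw [Real.rpow_sub (by positivity), Real.rpow_one]

theorem norm_sum_block_modWave_le {V : ℝ → ℝ} {σ C : ℝ} (hC : 0 < C)
    (hV : ∀ X t : ℝ, 1 ≤ X → X ≤ t → t ≤ 25 * X → |modWave σ V t| ≤ C * X ^ σ ∧
      |modWave σ V (t + 1) - modWave σ V t| ≤ C * X ^ (σ - 1 / 2))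
    {N e : ℕ} (hN : 1 ≤ N) (he : N ^ 2 ≤ e) (he' : e ≤ (N + 4) ^ 2) {E : ℕ → ℂ} {D : ℝ}
    (hD : ∀ m, N ^ 2 ≤ m → m ≤ (N + 4) ^ 2 → ‖∑ n ∈ Finset.Ico (N ^ 2) m, E n‖ ≤ D) :
    ‖∑ n ∈ Finset.Ico (N ^ 2) e, (modWave σ V n : ℂ) * E n‖ ≤
      25 * C * D * ((N : ℝ) ^ 2) ^ σ := by
  have hNr : (0 : ℝ) < N := by exact_mod_cast hN
  have hD0 : 0 ≤ D := (norm_nonneg _).trans (hD _ he he')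
  refine (norm_sum_Ico_mul_le (fun n : ℕ => modWave σ V n) E he
    fun m h h' => hD m h (h'.trans he')).trans ?_
  have h1 : |modWave σ V e| ≤ C * ((N : ℝ) ^ 2) ^ σ := by
    obtain ⟨a1, a2, a3⟩ := block_cast_bounds hN he he'
    exact (hV _ _ a1 a2 a3).1
  have h2 := sum_block_le (g := fun n : ℕ => |modWave σ V ((n + 1 : ℕ) : ℝ) - modWave σ V n|) hN
    (c := C * ((N : ℝ) ^ 2) ^ (σ - 1 / 2)) (fun n hn1 hn2 => by
      obtain ⟨a1, a2, a3⟩ := block_cast_bounds hN hn1 hn2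
      have := (hV _ _ a1 a2 a3).2
      rwa [Nat.cast_add, Nat.cast_one]) (by positivity)
  have h3 := (Finset.sum_le_sum_of_subset_of_nonneg
    (f := fun n : ℕ => |modWave σ V ((n + 1 : ℕ) : ℝ) - modWave σ V n|)
    (Finset.Ico_subset_Ico_right (a := N ^ 2) he') fun n _ _ => abs_nonneg _).trans h2
  calc _ ≤ D * (C * ((N : ℝ) ^ 2) ^ σ + 24 * N * (C * ((N : ℝ) ^ 2) ^ (σ - 1 / 2))) :=
        mul_le_mul_of_nonneg_left (add_le_add h1 h3) hD0
    _ = _ := by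
      rw [sq_rpow_sub_half hNr]
      field_simp
      ring

theorem norm_sum_block_increment_le {V : ℝ → ℝ} {σ C : ℝ} (hC : 0 < C)
    (hV : ∀ X t : ℝ, 1 ≤ X → X ≤ t → t ≤ 25 * X →
      |modWave σ V (t + 1) - modWave σ V t| ≤ C * X ^ (σ - 1 / 2) ∧
      |(modWave σ V (t + 2) - modWave σ V (t + 1)) - (modWave σ V (t + 1) - modWave σ V t)| ≤
        C * X ^ (σ - 1))
    {N : ℕ} (hN : 1 ≤ N) {P : ℕ → ℂ} {D : ℝ} (hP : ∀ n, ‖P n‖ ≤ D)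
    (hD : ∀ a m, ‖∑ n ∈ Finset.Ico a m, P (n + 1)‖ ≤ D) :
    ‖∑ n ∈ Finset.Ico (N ^ 2) ((N + 4) ^ 2), (modWave σ V n : ℂ) * (P (n + 1) - P n) -
      modWave σ V ((N ^ 2 : ℕ) : ℝ) * (P ((N + 4) ^ 2) - P (N ^ 2))‖ ≤
      D * |modWave σ V (((N + 4) ^ 2 : ℕ) : ℝ) - modWave σ V ((N ^ 2 : ℕ) : ℝ)| +
      25 * C * D * (((N : ℝ) ^ 2) ^ σ / N) := by
  have hNr : (0 : ℝ) < N := by exact_mod_cast hN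
  have hab : N ^ 2 ≤ (N + 4) ^ 2 := Nat.pow_le_pow_left (by omega) 2
  have hD0 : 0 ≤ D := (norm_nonneg _).trans (hP 0)
  have h0 := norm_sum_Ico_mul_le (fun n : ℕ => modWave σ V ((n + 1 : ℕ) : ℝ) - modWave σ V n)
    (fun n => P (n + 1)) hab (fun m _ _ => hD (N ^ 2) m)
  have h1 : |modWave σ V (((N + 4) ^ 2 + 1 : ℕ) : ℝ) - modWave σ V ((N + 4) ^ 2 : ℕ)| ≤
      C * ((N : ℝ) ^ 2) ^ (σ - 1 / 2) := by
    obtain ⟨a1, a2, a3⟩ := block_cast_bounds hN hab le_rfl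
    have := (hV _ _ a1 a2 a3).1
    rwa [Nat.cast_add ((N + 4) ^ 2), Nat.cast_one]
  have h2 := sum_block_le (g := fun n : ℕ =>
      |(modWave σ V ((n + 1 + 1 : ℕ) : ℝ) - modWave σ V ((n + 1 : ℕ) : ℝ)) -
        (modWave σ V ((n + 1 : ℕ) : ℝ) - modWave σ V n)|) hN
    (c := C * ((N : ℝ) ^ 2) ^ (σ - 1)) (fun n hn1 hn2 => by
      obtain ⟨a1, a2, a3⟩ := block_cast_bounds hN hn1 hn2
      have := (hV _ _ a1 a2 a3).2
      rwa [add_assoc n 1 1, Nat.cast_add n 1, Nat.cast_add n (1 + 1), Nat.cast_one, one_add_one_eq_two,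
        Nat.cast_two]) (by positivity)
  have h3 : ‖∑ n ∈ Finset.Ico (N ^ 2) ((N + 4) ^ 2),
      ((modWave σ V ((n + 1 : ℕ) : ℝ) - modWave σ V n : ℝ) : ℂ) * P (n + 1)‖ ≤
      25 * C * D * (((N : ℝ) ^ 2) ^ σ / N) := by
    refine h0.trans ?_
    calc _ ≤ D * (C * ((N : ℝ) ^ 2) ^ (σ - 1 / 2) + 24 * N * (C * ((N : ℝ) ^ 2) ^ (σ - 1))) :=
          mul_le_mul_of_nonneg_left (add_le_add h1 h2) hD0
      _ = _ := by
        rw [sq_rpow_sub_half hNr, sq_rpow_sub_one hNr]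
        field_simp
        ring
  rw [sum_Ico_mul_sub (fun n : ℕ => modWave σ V n) P hab]
  have e : ∀ w1 w0 p1 p0 S : ℂ, w1 * p1 - w0 * p0 - S - w0 * (p1 - p0) = p1 * (w1 - w0) - S := by
    intros; ring
  rw [e]
  refine (norm_sub_le _ _).trans (add_le_add ?_ h3)
  rw [norm_mul, ← Complex.ofReal_sub, Complex.norm_real, Real.norm_eq_abs]
  exact mul_le_mul_of_nonneg_right (hP _) (abs_nonneg _)

theorem exists_bound_sum_of_periodic {Q : ℕ} (hQ : 0 < Q) {f : ℕ → ℂ} (hf : Function.Periodic f Q)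
    (h0 : ∑ n ∈ Finset.range Q, f n = 0) :
    ∃ D : ℝ, ∀ a m, ‖∑ n ∈ Finset.Ico a m, f n‖ ≤ D := by
  have hper : Function.Periodic (fun m => ∑ n ∈ Finset.range m, f n) Q := by
    intro m
    show ∑ n ∈ Finset.range (m + Q), f n = ∑ n ∈ Finset.range m, f n
    rw [add_comm m Q, Finset.sum_range_add, h0, zero_add]
    refine Finset.sum_congr rfl fun n _ => ?_
    rw [add_comm, hf]
  have hb : ∃ K : ℝ, ∀ m, ‖∑ n ∈ Finset.range m, f n‖ ≤ K := by
    refine ⟨∑ j ∈ Finset.range Q, ‖∑ n ∈ Finset.range j, f n‖, fun m => ?_⟩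
    have : ∑ n ∈ Finset.range (m % Q), f n = ∑ n ∈ Finset.range m, f n := hper.map_mod_nat m
    rw [← this]
    exact Finset.single_le_sum (f := fun j => ‖∑ n ∈ Finset.range j, f n‖)
      (fun j _ => norm_nonneg _) (Finset.mem_range.2 (Nat.mod_lt m hQ))
  obtain ⟨K, hK⟩ := hb
  have hK0 : 0 ≤ K := (norm_nonneg _).trans (hK 0)
  refine ⟨K + K, fun a m => ?_⟩
  rcases le_total a m with h | h
  · rw [Finset.sum_Ico_eq_sub _ h]
    exact (norm_sub_le _ _).trans (add_le_add (hK m) (hK a))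
  · rw [Finset.Ico_eq_empty_of_le h, Finset.sum_empty, norm_zero]
    linarith

theorem exists_mean_zero_primitive {d : ℕ} (A : Fin d → ℤ) {B Q : ℕ} [NeZero Q] (hB : B ∣ Q)
    (hA : ∃ i, ¬ (B : ℤ) ∣ A i) :
    ∃ P : ℕ → ℂ, ∃ D : ℝ, (∀ n, P (n + 1) - P n = singSeries A B Q n) ∧
      (∀ m n, P m - P n = singSum A B Q m - singSum A B Q n) ∧ (∀ n, ‖P n‖ ≤ D) ∧
      ∀ a m, ‖∑ n ∈ Finset.Ico a m, P (n + 1)‖ ≤ D := by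
  have hQ : 0 < Q := Nat.pos_of_ne_zero (NeZero.ne Q)
  have hQc : (Q : ℂ) ≠ 0 := by exact_mod_cast hQ.ne'
  set μ : ℂ := (∑ n ∈ Finset.range Q, singSum A B Q n) / Q with hμ
  have hper : Function.Periodic (singSum A B Q) Q := singSum_add_period hB hA
  obtain ⟨D, hD⟩ := exists_bound_sum_of_periodic hQ (f := fun n => singSum A B Q n - μ)
    (fun n => by simp only [hper n]) (by
      rw [Finset.sum_sub_distrib, Finset.sum_const, Finset.card_range, nsmul_eq_mul, hμ,
        mul_div_cancel₀ _ hQc, sub_self])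
  refine ⟨fun n => singSum A B Q n - μ, D, fun n => ?_, fun m n => ?_, fun n => ?_, fun a m => ?_⟩
  · rw [sub_sub_sub_cancel_right, singSum, singSum, Finset.sum_range_succ, add_sub_cancel_left]
  · rw [sub_sub_sub_cancel_right]
  · simpa using hD n (n + 1)
  · have := hD (a + 1) (m + 1)
    rwa [← Finset.sum_Ico_add' (fun n => singSum A B Q n - μ)] at this

theorem modWave_natCast_sq (σ : ℝ) (V : ℝ → ℝ) (N : ℕ) :
    modWave σ V ((N ^ 2 : ℕ) : ℝ) = ((N : ℝ) ^ 2) ^ σ * V N := by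
  rw [modWave, Nat.cast_pow, Real.sqrt_sq (Nat.cast_nonneg N)]

theorem modWave_mul_rpow (σ τ : ℝ) (V : ℝ → ℝ) {t : ℝ} (ht : 0 < t) :
    modWave σ V t * t ^ τ = modWave (σ + τ) V t := by
  rw [modWave, modWave, Real.rpow_add ht]
  ring

theorem exists_block_approx {d : ℕ} (hd : 5 ≤ d) (A : Fin d → ℤ) (B : ℕ) :
    ∃ C : ℝ, 0 < C ∧ ∀ (Q : ℕ) [NeZero Q], B ∣ Q → ∀ ρ : ℝ, 0 < ρ → ∃ N₀ : ℕ, ∀ N e : ℕ,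
      N₀ ≤ N → N ^ 2 ≤ e → e ≤ (N + 4) ^ 2 →
      ‖∑ n ∈ Finset.Ico (N ^ 2) e,
          (modWave (-((d : ℝ) + 1) / 4) (ballWave (((d : ℝ) - 1) / 2)) n : ℂ) *
            sphereSum (fun i => (A i : ℝ) / B) n -
        sphereConst d * ∑ n ∈ Finset.Ico (N ^ 2) e,
          (modWave (((d : ℝ) - 5) / 4) (ballWave (((d : ℝ) - 1) / 2)) n : ℂ) * singSeries A B Q n‖ ≤
        (C * seriesTail d Q + ρ) * ((N : ℝ) ^ 2) ^ (((d : ℝ) - 5) / 4) := by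
  have hdr : (5 : ℝ) ≤ d := by exact_mod_cast hd
  set ν : ℝ := ((d : ℝ) - 1) / 2 with hν
  have hν1 : 1 ≤ ν := by rw [hν]; linarith
  set σ : ℝ := -((d : ℝ) + 1) / 4 with hσ
  obtain ⟨⟨M, hM, hMb⟩, -, -⟩ := exists_ballWave_bounds hν1
  obtain ⟨K, hK, hKb⟩ := exists_modWave_bounds (fun r hr => hasDerivAt_ballWave hν1 hr)
    (fun r hr => hasDerivAt_ballWaveDeriv hν1 hr) (fun r hr => (hMb r hr).1)
    (fun r hr => (hMb r hr).2.1) (fun r hr => (hMb r hr).2.2) σ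
  obtain ⟨C, hC, hbound⟩ := exists_sum_sphereSum_bound hd A B
  refine ⟨25 * K * C, by positivity, ?_⟩
  intro Q _ hQ ρ hρ
  obtain ⟨N₀, hN₀⟩ := hbound Q hQ (ρ / (25 * K)) (by positivity)
  refine ⟨max N₀ 1, fun N e hN he he' => ?_⟩
  have hN1 : 1 ≤ N := (le_max_right _ _).trans hN
  have hNr : (0 : ℝ) < N := by exact_mod_cast hN1
  have h := norm_sum_block_modWave_le hK (fun X t h1 h2 h3 => ⟨(hKb X t h1 h2 h3).1,
    (hKb X t h1 h2 h3).2.1⟩) hN1 he he'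
    (fun m hm hm' => hN₀ N (N ^ 2) m ((le_max_left _ _).trans hN) le_rfl hm hm')
  have e1 : ∀ n ∈ Finset.Ico (N ^ 2) e, (modWave σ (ballWave ν) n : ℂ) *
      (sphereSum (fun i => (A i : ℝ) / B) n -
        ((sphereConst d * (n : ℝ) ^ ((d : ℝ) / 2 - 1) : ℝ) : ℂ) * singSeries A B Q n) =
      (modWave σ (ballWave ν) n : ℂ) * sphereSum (fun i => (A i : ℝ) / B) n -
        sphereConst d * ((modWave (((d : ℝ) - 5) / 4) (ballWave ν) n : ℂ) *
          singSeries A B Q n) := by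
    intro n hn
    have hn0 : (0 : ℝ) < n := by
      have : 0 < n := lt_of_lt_of_le (by positivity) (Finset.mem_Ico.1 hn).1
      exact_mod_cast this
    have e2 : ((d : ℝ) - 5) / 4 = σ + ((d : ℝ) / 2 - 1) := by rw [hσ]; ring
    rw [e2, ← modWave_mul_rpow _ _ _ hn0]
    push_cast
    ring
  rw [Finset.sum_congr rfl e1, Finset.sum_sub_distrib, ← Finset.mul_sum] at h
  refine h.trans (le_of_eq ?_)
  have e3 : (N : ℝ) ^ (d - 2) = ((N : ℝ) ^ 2) ^ ((d : ℝ) / 2 - 1) := by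
    rw [← Real.rpow_natCast, ← Real.rpow_natCast (N : ℝ) 2, ← Real.rpow_mul hNr.le,
      Nat.cast_sub (by omega)]
    congr 1
    push_cast
    ring
  have e4 : ((N : ℝ) ^ 2) ^ (((d : ℝ) - 5) / 4) =
      ((N : ℝ) ^ 2) ^ ((d : ℝ) / 2 - 1) * ((N : ℝ) ^ 2) ^ σ := by
    rw [← Real.rpow_add (by positivity)]
    congr 1
    rw [hσ]
    ring
  rw [e3, e4]
  field_simp

theorem tendsto_shift_rpow_ratio (b : ℕ) (τ : ℝ) :
    Tendsto (fun j : ℕ => (((b + 4 * j + 4 : ℕ) : ℝ) ^ 2) ^ τ / (((b + 4 * j : ℕ) : ℝ) ^ 2) ^ τ)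
      atTop (𝓝 1) := by
  have hN : Tendsto (fun j : ℕ => ((b + 4 * j : ℕ) : ℝ)) atTop atTop :=
    tendsto_natCast_atTop_atTop.comp (tendsto_atTop_mono (fun j => by simp only [id]; omega) tendsto_id)
  have h1 : Tendsto (fun j : ℕ => 1 + 4 / ((b + 4 * j : ℕ) : ℝ)) atTop (𝓝 (1 + 0)) :=
    (hN.const_div_atTop 4).const_add 1
  rw [add_zero] at h1
  have h2 := (h1.pow 2).rpow_const (p := τ) (Or.inl (by norm_num))
  rw [one_pow, Real.one_rpow] at h2
  refine h2.congr' ?_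
  filter_upwards [hN.eventually_gt_atTop 0] with j hj
  rw [← Real.div_rpow (by positivity) (by positivity), ← div_pow, Nat.cast_add _ 4, add_div,
    div_self hj.ne', Nat.cast_ofNat]

theorem exists_singSum_square_step_bound {d : ℕ} (hd : 5 ≤ d) (A : Fin d → ℤ) {B : ℕ}
    (hA : ∃ i, ¬ (B : ℤ) ∣ A i) {b : ℕ} {l : ℝ} (hl : l ≠ 0)
    (hU : Tendsto (fun m : ℕ => ballWave (((d : ℝ) - 1) / 2) ((b + 4 * m : ℕ) : ℝ)) atTop (𝓝 l))
    (hX : Tendsto (fun N : ℕ => ∑ n ∈ Finset.Ico (N ^ 2) ((N + 4) ^ 2),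
      (modWave (-((d : ℝ) + 1) / 4) (ballWave (((d : ℝ) - 1) / 2)) n : ℂ) *
        sphereSum (fun i => (A i : ℝ) / B) n) atTop (𝓝 0)) :
    ∃ C : ℝ, 0 < C ∧ ∀ (Q : ℕ) [NeZero Q], B ∣ Q → ∀ m : ℕ,
      ‖singSum A B Q ((b + 4 * m + 4) ^ 2) - singSum A B Q ((b + 4 * m) ^ 2)‖ ≤
        C * seriesTail d Q := by
  have hdr : (5 : ℝ) ≤ d := by exact_mod_cast hd
  obtain ⟨C, hC, hbound⟩ := exists_block_approx hd A B
  set ν : ℝ := ((d : ℝ) - 1) / 2 with hν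
  have hν1 : 1 ≤ ν := by rw [hν]; linarith
  set τ : ℝ := ((d : ℝ) - 5) / 4 with hτ
  have hτ0 : 0 ≤ τ := by rw [hτ]; linarith
  set X : ℕ → ℂ := fun N => ∑ n ∈ Finset.Ico (N ^ 2) ((N + 4) ^ 2),
      (modWave (-((d : ℝ) + 1) / 4) (ballWave ν) n : ℂ) *
        sphereSum (fun i => (A i : ℝ) / B) n with hXdef
  obtain ⟨⟨M, hM, hMb⟩, -, -⟩ := exists_ballWave_bounds hν1
  obtain ⟨K, hK, hKb⟩ := exists_modWave_bounds (fun r hr => hasDerivAt_ballWave hν1 hr)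
    (fun r hr => hasDerivAt_ballWaveDeriv hν1 hr) (fun r hr => (hMb r hr).1)
    (fun r hr => (hMb r hr).2.1) (fun r hr => (hMb r hr).2.2) τ
  have hκ : 0 < sphereConst d := sphereConst_pos (by omega)
  set κ := sphereConst d with hκdef
  have hl' : 0 < |l| := abs_pos.2 hl
  refine ⟨C / (κ * |l|), by positivity, ?_⟩
  intro Q _ hQ m
  set ΔF := singSum A B Q ((b + 4 * m + 4) ^ 2) - singSum A B Q ((b + 4 * m) ^ 2) with hΔF
  suffices h : κ * |l| * ‖ΔF‖ ≤ C * seriesTail d Q by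
    rw [div_mul_eq_mul_div, le_div_iff₀ (by positivity)]
    linarith
  refine le_of_forall_pos_le_add fun ρ hρ => ?_
  obtain ⟨N₀, hN₀⟩ := hbound Q hQ ρ hρ
  obtain ⟨P, D, hP1, hP2, hP3, hP4⟩ := exists_mean_zero_primitive A hQ hA
  set N : ℕ → ℕ := fun j => b + 4 * j with hNdef
  have hNtop : Tendsto N atTop atTop := tendsto_atTop_mono (fun j => by simp only [hNdef, id]; omega) tendsto_id
  have hNtop' : Tendsto (fun j => (N j : ℝ)) atTop atTop := tendsto_natCast_atTop_atTop.comp hNtop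
  set R : ℕ → ℝ := fun j => (((N j + 4 : ℕ) : ℝ) ^ 2) ^ τ / ((N j : ℝ) ^ 2) ^ τ with hR
  have hRlim : Tendsto R atTop (𝓝 1) := tendsto_shift_rpow_ratio b τ
  have hU4 : Tendsto (fun j => ballWave ν ((N j + 4 : ℕ) : ℝ)) atTop (𝓝 l) := by
    have := hU.comp (tendsto_add_atTop_nat 1)
    refine this.congr fun j => ?_
    simp only [Function.comp, hNdef, mul_add, mul_one, add_assoc]
  set rhs : ℕ → ℝ := fun j => ‖X (N j)‖ + (C * seriesTail d Q + ρ) +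
    κ * (D * |R j * ballWave ν ((N j + 4 : ℕ) : ℝ) - ballWave ν (N j)| + 25 * K * D / N j) with hrhs
  have hrlim : Tendsto rhs atTop (𝓝 (C * seriesTail d Q + ρ)) := by
    have t1 : Tendsto (fun j => ‖X (N j)‖) atTop (𝓝 0) := by
      simpa using (hX.comp hNtop).norm
    have t2 : Tendsto (fun j => |R j * ballWave ν ((N j + 4 : ℕ) : ℝ) - ballWave ν (N j)|)
        atTop (𝓝 0) := by
      have := ((hRlim.mul hU4).sub hU).abs
      rwa [one_mul, sub_self, abs_zero] at this
    have t3 : Tendsto (fun j => 25 * K * D / (N j : ℝ)) atTop (𝓝 0) := hNtop'.const_div_atTop _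
    have := (t1.add_const (C * seriesTail d Q + ρ)).add (((t2.const_mul D).add t3).const_mul κ)
    rwa [mul_zero, zero_add, add_zero, mul_zero, add_zero] at this
  have key : ∀ j, N₀ ≤ N j → 1 ≤ N j → κ * |ballWave ν (N j)| *
      ‖singSum A B Q ((N j + 4) ^ 2) - singSum A B Q ((N j) ^ 2)‖ ≤ rhs j := by
    intro j hj hj1
    have hNr : (1 : ℝ) ≤ N j := by exact_mod_cast hj1
    have h1 := hN₀ (N j) ((N j + 4) ^ 2) hj (Nat.pow_le_pow_left (by omega) 2) le_rfl
    have h2 := norm_sum_block_increment_le hK (fun X t h1 h2 h3 => (hKb X t h1 h2 h3).2) hj1 hP3 hP4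
    set T : ℝ := ((N j : ℝ) ^ 2) ^ τ with hT
    have hT1 : 1 ≤ T := Real.one_le_rpow (by nlinarith) hτ0
    rw [hP2, modWave_natCast_sq, modWave_natCast_sq, Finset.sum_congr rfl fun n _ => by rw [hP1 n]] at h2
    set Y := ∑ n ∈ Finset.Ico (N j ^ 2) ((N j + 4) ^ 2),
      (modWave τ (ballWave ν) n : ℂ) * singSeries A B Q n with hY
    have hR' : (((N j + 4 : ℕ) : ℝ) ^ 2) ^ τ = T * R j := by
      rw [hR]; simp only; rw [mul_div_cancel₀ _ (by positivity)]
    rw [hR', mul_assoc T, ← mul_sub T, abs_mul, abs_of_pos (by positivity : (0 : ℝ) < T)] at h2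
    set Δ := singSum A B Q ((N j + 4) ^ 2) - singSum A B Q ((N j) ^ 2) with hΔ
    have h3 : T * (κ * |ballWave ν (N j)| * ‖Δ‖) =
        ‖(κ : ℂ) * (((T * ballWave ν (N j) : ℝ) : ℂ) * Δ)‖ := by
      rw [norm_mul, norm_mul, Complex.norm_real, Complex.norm_real, Real.norm_eq_abs,
        Real.norm_eq_abs, abs_mul, abs_of_pos hκ, abs_of_pos (by positivity : (0 : ℝ) < T)]
      ring
    have h4 : (κ : ℂ) * (((T * ballWave ν (N j) : ℝ) : ℂ) * Δ) =
        X (N j) - (X (N j) - κ * Y) - κ * (Y - ((T * ballWave ν (N j) : ℝ) : ℂ) * Δ) := by ring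
    have h5 : T * (κ * |ballWave ν (N j)| * ‖Δ‖) ≤ ‖X (N j)‖ + (C * seriesTail d Q + ρ) * T +
        κ * (D * (T * |R j * ballWave ν ((N j + 4 : ℕ) : ℝ) - ballWave ν (N j)|) +
          25 * K * D * (T / N j)) := by
      rw [h3, h4]
      refine (norm_sub_le _ _).trans (add_le_add ((norm_sub_le _ _).trans (add_le_add le_rfl h1)) ?_)
      rw [norm_mul, Complex.norm_real, Real.norm_of_nonneg hκ.le]
      exact mul_le_mul_of_nonneg_left h2 hκ.le
    have h6 : ‖X (N j)‖ ≤ T * ‖X (N j)‖ := le_mul_of_one_le_left (norm_nonneg _) hT1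
    have h7 : T * (κ * |ballWave ν (N j)| * ‖Δ‖) ≤ T * rhs j := by
      refine (h5.trans (add_le_add (add_le_add h6 le_rfl) le_rfl)).trans (le_of_eq ?_)
      simp only [hrhs]
      ring
    exact le_of_mul_le_mul_left h7 (by positivity)
  have hsub : Tendsto (fun k : ℕ => m + Q * k) atTop atTop :=
    tendsto_atTop_mono (fun k => by
      have := Nat.le_mul_of_pos_left k (Nat.pos_of_ne_zero (NeZero.ne Q))
      simp only [id]; omega) tendsto_id
  have hlim1 := ((hU.abs.const_mul κ).mul_const ‖ΔF‖).comp hsub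
  refine le_of_tendsto_of_tendsto hlim1 (hrlim.comp hsub) ?_
  filter_upwards [hsub.eventually (hNtop.eventually_ge_atTop N₀),
    hsub.eventually (hNtop.eventually_ge_atTop 1)] with k hk hk1
  have h := key _ hk hk1
  have hmod : N (m + Q * k) ≡ b + 4 * m [MOD Q] := by
    have : N (m + Q * k) = b + 4 * m + Q * (4 * k) := by simp only [hNdef]; ring
    rw [this]
    simp [Nat.ModEq]
  rw [singSum_congr hQ hA ((hmod.add_right 4).pow 2), singSum_congr hQ hA (hmod.pow 2)] at h
  exact h

theorem false_of_tendsto_block {d : ℕ} (hd : 5 ≤ d) (A : Fin d → ℤ) {B : ℕ} (hB : 0 < B)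
    (hA : ∃ i, ¬ (B : ℤ) ∣ A i)
    (hX : Tendsto (fun N : ℕ => ∑ n ∈ Finset.Ico (N ^ 2) ((N + 4) ^ 2),
      (modWave (-((d : ℝ) + 1) / 4) (ballWave (((d : ℝ) - 1) / 2)) n : ℂ) *
        sphereSum (fun i => (A i : ℝ) / B) n) atTop (𝓝 0)) : False := by
  have hdr : (5 : ℝ) ≤ d := by exact_mod_cast hd
  obtain ⟨-, ⟨b, hb, l, hl, hU⟩, -⟩ :=
    exists_ballWave_bounds (ν := ((d : ℝ) - 1) / 2) (by linarith)
  obtain ⟨C, hC, hstep⟩ := exists_singSum_square_step_bound hd A hA hl hU hX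
  obtain ⟨C₁, hC₁, hsub⟩ := exists_sum_singSeries_sub_bound hd A B
  refine singSum_squares_contradiction hd A hB hA hb hC₁ (fun Q _ hQ m m' => ?_)
    (fun Q Q' _ _ hQ hQ' n => ?_)
  · have hBQ : B ∣ Q := (Dvd.intro_left 4 rfl).trans hQ
    have hcompare : ∀ Q' [NeZero Q'], B ∣ Q' → ∀ m k : ℕ,
        ‖(singSum A B Q ((b + 4 * (m + k)) ^ 2) - singSum A B Q ((b + 4 * m) ^ 2)) -
          (singSum A B Q' ((b + 4 * (m + k)) ^ 2) - singSum A B Q' ((b + 4 * m) ^ 2))‖ ≤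
          C₁ * (seriesTail d Q + seriesTail d Q') := by
      intro Q' _ hQ' m k
      have hle : (b + 4 * m) ^ 2 ≤ (b + 4 * (m + k)) ^ 2 := Nat.pow_le_pow_left (by omega) 2
      rw [singSum_sub A B Q hle, singSum_sub A B Q' hle, ← Finset.sum_sub_distrib]
      exact hsub Q Q' hBQ hQ' _ _ hle
    have hchain : ∀ Q' [NeZero Q'], B ∣ Q' → ∀ m k : ℕ,
        ‖singSum A B Q' ((b + 4 * (m + k)) ^ 2) - singSum A B Q' ((b + 4 * m) ^ 2)‖ ≤
          k * (C * seriesTail d Q') := by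
      intro Q' _ hQ' m k
      induction k with
      | zero => simp
      | succ k ih =>
        have h := hstep Q' hQ' (m + k)
        have e : b + 4 * (m + (k + 1)) = b + 4 * (m + k) + 4 := by ring
        rw [e, ← sub_add_sub_cancel _ (singSum A B Q' ((b + 4 * (m + k)) ^ 2))]
        refine (norm_add_le _ _).trans ((add_le_add h ih).trans (le_of_eq ?_))
        push_cast
        ring
    have hmain : ∀ m k : ℕ, ‖singSum A B Q ((b + 4 * (m + k)) ^ 2) -
        singSum A B Q ((b + 4 * m) ^ 2)‖ ≤ C₁ * seriesTail d Q := by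
      intro m k
      have ht := tendsto_seriesTail_mul_factorial hd Q
      have hlim := ((ht.const_add (seriesTail d Q)).const_mul C₁).add
        ((ht.const_mul C).const_mul (k : ℝ))
      simp only [add_zero, mul_zero] at hlim
      refine ge_of_tendsto' hlim fun M => ?_
      have : NeZero (Q * M.factorial) := ⟨mul_ne_zero (NeZero.ne Q) M.factorial_ne_zero⟩
      have hQ' : B ∣ Q * M.factorial := hBQ.mul_right _
      have h1 := hcompare (Q * M.factorial) hQ' m k
      have h2 := hchain (Q * M.factorial) hQ' m k
      have h3 := norm_add_le _ _ |>.trans (add_le_add h1 h2)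
      rwa [sub_add_cancel] at h3
    rcases le_total m m' with h | h
    · obtain ⟨k, rfl⟩ := Nat.exists_eq_add_of_le h
      rw [norm_sub_rev]
      exact hmain m k
    · obtain ⟨k, rfl⟩ := Nat.exists_eq_add_of_le h
      exact hmain m' k
  · have := hsub Q Q' hQ hQ' n (n + 1) (Nat.le_succ n)
    rwa [Nat.Ico_succ_singleton, Finset.sum_singleton] at this

theorem modWave_ballWaveDeriv₂ (τ ν : ℝ) {t : ℝ} (ht : 0 < t) :
    modWave τ (ballWaveDeriv₂ ν) t =
      -(Real.pi / 2) ^ 2 * modWave τ (ballWave ν) t + ν * (ν + 1) * modWave (τ - 1) (ballWave ν) t := by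
  rw [modWave, modWave, modWave, ballWaveDeriv₂, Real.sq_sqrt ht.le, Real.rpow_sub ht, Real.rpow_one]
  ring

theorem exists_modWave_primitive_bound {ν : ℝ} (hν : 1 ≤ ν) (τ : ℝ) :
    ∃ K : ℝ, 0 < K ∧ ∀ X s : ℝ, 1 ≤ X → X ≤ s → s ≤ 25 * X →
      |modWave (τ + 1 / 2) (ballWaveDeriv ν) (s + 1) - modWave (τ + 1 / 2) (ballWaveDeriv ν) s +
        Real.pi ^ 2 / 8 * modWave τ (ballWave ν) s| ≤ K * X ^ (τ - 1 / 2) := by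
  obtain ⟨⟨M, hM, hMb⟩, -, -⟩ := exists_ballWave_bounds hν
  have hM0 := fun r hr => (hMb r hr).1
  have hM1 := fun r hr => (hMb r hr).2.1
  set D : ℝ := |τ| * (M * 27 ^ |τ - 1|) + M * 27 ^ |τ - 1 / 2| with hD
  have hD0 : 0 ≤ D := by positivity
  set c : ℝ := ν * (ν + 1) with hc
  set K : ℝ := |τ + 1 / 2| * (M * 27 ^ |τ - 1 / 2|) + |c / 2| * (M * 27 ^ |τ - 1|) +
    Real.pi ^ 2 / 8 * D with hK
  refine ⟨K + 1, by positivity, fun X s hX hs hs' => ?_⟩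
  have hX0 : 0 < X := by linarith
  have hp : 0 ≤ X ^ (τ - 1 / 2) := by positivity
  set W := modWave τ (ballWave ν) s with hW
  have hderiv : ∀ t ∈ Set.Icc s (s + 1), HasDerivAt
      (fun t => modWave (τ + 1 / 2) (ballWaveDeriv ν) t + Real.pi ^ 2 / 8 * W * t)
      ((τ + 1 / 2) * modWave (τ - 1 / 2) (ballWaveDeriv ν) t +
        c / 2 * modWave (τ - 1) (ballWave ν) t -
        Real.pi ^ 2 / 8 * (modWave τ (ballWave ν) t - W)) t := by
    intro t ht
    have ht0 : 0 < t := by linarith [ht.1]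
    have h1 := hasDerivAt_modWave (fun r hr => hasDerivAt_ballWaveDeriv hν hr) (τ + 1 / 2) ht0
    rw [add_sub_cancel_right, show τ + 1 / 2 - 1 = τ - 1 / 2 by ring,
      modWave_ballWaveDeriv₂ τ ν ht0] at h1
    refine (h1.add ((hasDerivAt_id t).const_mul (Real.pi ^ 2 / 8 * W))).congr_deriv ?_
    ring
  have hbound : ∀ t ∈ Set.Icc s (s + 1),
      |(τ + 1 / 2) * modWave (τ - 1 / 2) (ballWaveDeriv ν) t +
        c / 2 * modWave (τ - 1) (ballWave ν) t -
        Real.pi ^ 2 / 8 * (modWave τ (ballWave ν) t - W)| ≤ K * X ^ (τ - 1 / 2) := by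
    intro t ht
    have a1 := abs_modWave_le hM1 (τ - 1 / 2) hX (hs.trans ht.1) (by linarith [ht.2])
    have a2 := abs_modWave_le hM0 (τ - 1) hX (hs.trans ht.1) (by linarith [ht.2])
    have a3 : X ^ (τ - 1) ≤ X ^ (τ - 1 / 2) := Real.rpow_le_rpow_of_exponent_le hX (by linarith)
    have a4 := a2.trans (mul_le_mul_of_nonneg_left a3 (by positivity))
    have a5 : |modWave τ (ballWave ν) t - W| ≤ D * X ^ (τ - 1 / 2) := by
      have := abs_sub_le_of_hasDerivAt ht.1
        (fun u hu => hasDerivAt_modWave (fun r hr => hasDerivAt_ballWave hν hr) τ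
          (by linarith [hu.1] : 0 < u))
        (fun u hu => abs_modWave_deriv_le hM0 hM1 τ hX (hs.trans hu.1) (by linarith [hu.2, ht.2]))
      refine this.trans (mul_le_of_le_one_right (by positivity) (by linarith [ht.2]))
    refine (abs_sub _ _).trans ?_
    refine (add_le_add (abs_add_le _ _) le_rfl).trans ?_
    rw [abs_mul, abs_mul, abs_mul, abs_of_pos (by positivity : (0 : ℝ) < Real.pi ^ 2 / 8)]
    calc _ ≤ |τ + 1 / 2| * (M * 27 ^ |τ - 1 / 2| * X ^ (τ - 1 / 2)) +
          |c / 2| * (M * 27 ^ |τ - 1| * X ^ (τ - 1 / 2)) +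
          Real.pi ^ 2 / 8 * (D * X ^ (τ - 1 / 2)) := by gcongr
      _ = _ := by rw [hK]; ring
  have h := abs_sub_le_of_hasDerivAt (by linarith : s ≤ s + 1) hderiv hbound
  rw [add_sub_cancel_left, mul_one] at h
  have e : ∀ a b c : ℝ, a - b + c = a + c * (s + 1) - (b + c * s) := by intros; ring
  rw [e]
  exact h.trans (mul_le_mul_of_nonneg_right (by linarith) hp)

theorem exists_sum_block_primitive_bound {ν : ℝ} (hν : 1 ≤ ν) (τ : ℝ) :
    ∃ K : ℝ, 0 < K ∧ ∀ N e : ℕ, 1 ≤ N → N ^ 2 ≤ e → e ≤ (N + 4) ^ 2 →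
      |modWave (τ + 1 / 2) (ballWaveDeriv ν) e -
        modWave (τ + 1 / 2) (ballWaveDeriv ν) ((N ^ 2 : ℕ) : ℝ) +
        Real.pi ^ 2 / 8 * ∑ n ∈ Finset.Ico (N ^ 2) e, modWave τ (ballWave ν) n| ≤
        K * ((N : ℝ) ^ 2) ^ τ := by
  obtain ⟨K, hK, hb⟩ := exists_modWave_primitive_bound hν τ
  refine ⟨24 * K, by positivity, fun N e hN he he' => ?_⟩
  have hNr : (0 : ℝ) < N := by exact_mod_cast hN
  set H : ℕ → ℝ := fun n => modWave (τ + 1 / 2) (ballWaveDeriv ν) n with hH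
  have h1 : modWave (τ + 1 / 2) (ballWaveDeriv ν) e -
      modWave (τ + 1 / 2) (ballWaveDeriv ν) ((N ^ 2 : ℕ) : ℝ) =
      ∑ n ∈ Finset.Ico (N ^ 2) e, (H (n + 1) - H n) := (Finset.sum_Ico_sub H he).symm
  rw [h1, Finset.mul_sum, ← Finset.sum_add_distrib]
  refine (Finset.abs_sum_le_sum_abs _ _).trans ?_
  refine (Finset.sum_le_sum_of_subset_of_nonneg (Finset.Ico_subset_Ico_right he')
    fun n _ _ => abs_nonneg _).trans ?_
  refine (sum_block_le hN (c := K * ((N : ℝ) ^ 2) ^ (τ - 1 / 2)) (fun n h h' => ?_)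
    (by positivity)).trans (le_of_eq ?_)
  · obtain ⟨a1, a2, a3⟩ := block_cast_bounds hN h h'
    have := hb _ _ a1 a2 a3
    simp only [hH, Nat.cast_add, Nat.cast_one]
    exact this
  · rw [sq_rpow_sub_half hNr]
    field_simp

theorem singSeries_zero_one_one {d : ℕ} (n : ℕ) : singSeries (fun _ : Fin d => 0) 1 1 n = 1 := by
  simp [singSeries, gaussProd, quadGauss]

theorem not_tendsto_block_origin {d : ℕ} (hd : 5 ≤ d)
    (hX : Tendsto (fun N : ℕ => ∑ n ∈ Finset.Ico (N ^ 2) ((N + 2) ^ 2),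
      (modWave (-((d : ℝ) + 1) / 4) (ballWave (((d : ℝ) - 1) / 2)) n : ℂ) *
        sphereSum (fun _ : Fin d => 0) n) atTop (𝓝 0)) : False := by
  have hdr : (5 : ℝ) ≤ d := by exact_mod_cast hd
  obtain ⟨C, hC, hbound⟩ := exists_block_approx hd (fun _ => 0) 1
  obtain ⟨N₀, hN₀⟩ := hbound 1 dvd_rfl 1 one_pos
  simp only [Int.cast_zero, zero_div, singSeries_zero_one_one, mul_one] at hN₀
  set ν : ℝ := ((d : ℝ) - 1) / 2 with hν
  have hν1 : 1 ≤ ν := by rw [hν]; linarith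
  set τ : ℝ := ((d : ℝ) - 5) / 4 with hτ
  have hτ0 : 0 ≤ τ := by rw [hτ]; linarith
  obtain ⟨K, hK, hKb⟩ := exists_sum_block_primitive_bound hν1 τ
  obtain ⟨-, -, b, hb, l, hl, hl1, hl2⟩ := exists_ballWave_bounds hν1
  set κ := sphereConst d with hκdef
  have hκ : 0 < κ := sphereConst_pos (by omega)
  set X : ℕ → ℂ := fun N => ∑ n ∈ Finset.Ico (N ^ 2) ((N + 2) ^ 2),
      (modWave (-((d : ℝ) + 1) / 4) (ballWave ν) n : ℂ) * sphereSum (fun _ : Fin d => 0) n with hXdef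
  set L : ℝ := C * seriesTail d 1 + 1 with hL
  set N : ℕ → ℕ := fun j => b + 4 * j with hNdef
  have hNtop : Tendsto N atTop atTop :=
    tendsto_atTop_mono (fun j => by simp only [hNdef, id]; omega) tendsto_id
  have hNtop' : Tendsto (fun j => (N j : ℝ)) atTop atTop := tendsto_natCast_atTop_atTop.comp hNtop
  set R : ℕ → ℝ := fun j => ((1 + 2 / (N j : ℝ)) ^ 2) ^ (τ + 1 / 2) with hR
  have hRlim : Tendsto R atTop (𝓝 1) := by
    have h1 : Tendsto (fun j : ℕ => 1 + 2 / (N j : ℝ)) atTop (𝓝 (1 + 0)) :=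
      (hNtop'.const_div_atTop 2).const_add 1
    rw [add_zero] at h1
    have h2 := (h1.pow 2).rpow_const (p := τ + 1 / 2) (Or.inl (by norm_num))
    rwa [one_pow, Real.one_rpow] at h2
  have hlhs : Tendsto (fun j => |R j * ballWaveDeriv ν ((N j + 2 : ℕ) : ℝ) - ballWaveDeriv ν (N j)|)
      atTop (𝓝 |1 * -l - l|) := ((hRlim.mul hl2).sub hl1).abs
  have hrhs : Tendsto (fun j => (K + Real.pi ^ 2 / 8 * ((‖X (N j)‖ + L) / κ)) / (N j : ℝ)) atTop
      (𝓝 0) := by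
    have h1 : Tendsto (fun j => K + Real.pi ^ 2 / 8 * ((‖X (N j)‖ + L) / κ)) atTop
        (𝓝 (K + Real.pi ^ 2 / 8 * ((‖(0 : ℂ)‖ + L) / κ))) :=
      (((((hX.comp hNtop).norm.add_const L).div_const κ).const_mul _).const_add K)
    exact h1.div_atTop hNtop'
  have hle : |1 * -l - l| ≤ 0 := by
    refine le_of_tendsto_of_tendsto hlhs hrhs ?_
    filter_upwards [hNtop.eventually_ge_atTop N₀, hNtop.eventually_ge_atTop 1] with j hj hj1
    have hNr : (1 : ℝ) ≤ N j := by exact_mod_cast hj1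
    have hNr0 : (0 : ℝ) < N j := by linarith
    have q1 : N j ^ 2 ≤ (N j + 2) ^ 2 := Nat.pow_le_pow_left (by omega) 2
    have q2 : (N j + 2) ^ 2 ≤ (N j + 4) ^ 2 := Nat.pow_le_pow_left (by omega) 2
    have h1 := hN₀ (N j) _ hj q1 q2
    have h2 := hKb (N j) _ hj1 q1 q2
    set T : ℝ := ((N j : ℝ) ^ 2) ^ τ with hT
    have hT1 : 1 ≤ T := Real.one_le_rpow (by nlinarith) hτ0
    have hT0 : 0 < T := by linarith
    have hTN : ((N j : ℝ) ^ 2) ^ (τ + 1 / 2) = T * N j := by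
      rw [Real.rpow_add (by positivity), ← Real.sqrt_eq_rpow, Real.sqrt_sq hNr0.le]
    have hTR : (((N j + 2 : ℕ) : ℝ) ^ 2) ^ (τ + 1 / 2) = T * N j * R j := by
      rw [← hTN, hR]
      simp only
      rw [← Real.mul_rpow (by positivity) (by positivity), ← mul_pow]
      congr 2
      push_cast
      field_simp
    rw [modWave_natCast_sq, modWave_natCast_sq, hTN, hTR] at h2
    set Y : ℝ := ∑ n ∈ Finset.Ico (N j ^ 2) ((N j + 2) ^ 2), modWave τ (ballWave ν) n with hY
    have h3 : κ * |Y| ≤ (‖X (N j)‖ + L) * T := by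
      have e : (κ : ℂ) * (Y : ℂ) = X (N j) - (X (N j) - κ * ∑ n ∈ Finset.Ico (N j ^ 2) ((N j + 2) ^ 2),
          (modWave τ (ballWave ν) n : ℂ)) := by
        rw [hY]; push_cast; ring
      have e2 : κ * |Y| = ‖(κ : ℂ) * (Y : ℂ)‖ := by
        rw [norm_mul, Complex.norm_real, Complex.norm_real, Real.norm_eq_abs, Real.norm_eq_abs,
          abs_of_pos hκ]
      rw [e2, e, add_mul]
      exact (norm_sub_le _ _).trans (add_le_add (le_mul_of_one_le_right (norm_nonneg _) hT1) h1)
    have h4 : |Y| ≤ (‖X (N j)‖ + L) / κ * T := by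
      rw [div_mul_eq_mul_div, le_div_iff₀ hκ]
      linarith
    have h5 : |T * N j * R j * ballWaveDeriv ν ((N j + 2 : ℕ) : ℝ) - T * N j * ballWaveDeriv ν (N j)| ≤
        K * T + Real.pi ^ 2 / 8 * ((‖X (N j)‖ + L) / κ * T) := by
      have e : ∀ a b : ℝ, a = a + b - b := by intros; ring
      rw [e (_ - _) (Real.pi ^ 2 / 8 * Y)]
      refine (abs_sub _ _).trans (add_le_add h2 ?_)
      rw [abs_mul, abs_of_pos (by positivity : (0 : ℝ) < Real.pi ^ 2 / 8)]
      exact mul_le_mul_of_nonneg_left h4 (by positivity)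
    have e : T * N j * R j * ballWaveDeriv ν ((N j + 2 : ℕ) : ℝ) - T * N j * ballWaveDeriv ν (N j) =
      T * N j * (R j * ballWaveDeriv ν ((N j + 2 : ℕ) : ℝ) - ballWaveDeriv ν (N j)) := by ring
    rw [e, abs_mul, abs_of_pos (by positivity : 0 < T * N j)] at h5
    rw [le_div_iff₀ hNr0]
    refine le_of_mul_le_mul_left ?_ hT0
    linarith
  have : 0 < |1 * -l - l| := abs_pos.2 (by intro h; apply hl; linarith)
  linarith

theorem finite_sum_sq_lt (d : ℕ) (M : ℤ) : {k : Fin d → ℤ | ∑ i, k i ^ 2 < M}.Finite := by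
  refine (Set.Finite.pi' (t := fun _ : Fin d => Set.Icc (-M) M) fun _ => Set.finite_Icc _ _).subset
    fun k hk i => ?_
  have h1 : k i ^ 2 ≤ ∑ i, k i ^ 2 :=
    Finset.single_le_sum (f := fun i => k i ^ 2) (fun i _ => sq_nonneg _) (Finset.mem_univ i)
  have h2 : k i ^ 2 < M := h1.trans_lt hk
  constructor <;> nlinarith [sq_nonneg (k i - 1), sq_nonneg (k i + 1)]

theorem summable_ite_sum_sq {d : ℕ} (e : (Fin d → ℤ) → ℂ) (p : ℤ → Prop) [DecidablePred p] (M : ℤ)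
    (hp : ∀ z, p z → z < M) : Summable fun k : Fin d → ℤ => if p (∑ i, k i ^ 2) then e k else 0 := by
  refine summable_of_hasFiniteSupport ((finite_sum_sq_lt d M).subset fun k hk => ?_)
  by_contra h
  refine hk (if_neg fun h' => h (hp _ h'))

theorem tsum_ite_sum_sq_lt {d : ℕ} (e : (Fin d → ℤ) → ℂ) (M : ℕ) :
    ∑' k : Fin d → ℤ, (if ∑ i, k i ^ 2 < (M : ℤ) then e k else 0) =
      ∑ n ∈ Finset.range M, ∑' k : Fin d → ℤ, if ∑ i, k i ^ 2 = (n : ℤ) then e k else 0 := by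
  induction M with
  | zero =>
    have : ∀ k : Fin d → ℤ, ¬ ∑ i, k i ^ 2 < ((0 : ℕ) : ℤ) := fun k => by
      rw [Nat.cast_zero, not_lt]
      exact Finset.sum_nonneg fun i _ => sq_nonneg _
    simp only [this, if_false, tsum_zero, Finset.range_zero, Finset.sum_empty]
  | succ M ih =>
    rw [Finset.sum_range_succ, ← ih, ← Summable.tsum_add]
    · refine tsum_congr fun k => ?_
      have hiff : ∑ i, k i ^ 2 < ((M + 1 : ℕ) : ℤ) ↔ ∑ i, k i ^ 2 ≤ (M : ℤ) := by
        rw [Nat.cast_add, Nat.cast_one, Int.lt_add_one_iff]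
      simp only [hiff]
      rcases lt_trichotomy (∑ i, k i ^ 2) (M : ℤ) with h | h | h
      · rw [if_pos h, if_neg h.ne, if_pos h.le, add_zero]
      · rw [if_neg h.not_lt, if_pos h, if_pos h.le, zero_add]
      · rw [if_neg h.not_gt, if_neg h.ne', if_neg h.not_ge, add_zero]
    · exact summable_ite_sum_sq e (fun z => z < M) M fun z hz => hz
    · exact summable_ite_sum_sq e (fun z => z = M) (M + 1) fun z hz => by omega

theorem sqrt_sum_sq_lt_iff {d : ℕ} (k : Fin d → ℤ) (N : ℕ) :
    Real.sqrt (∑ i, ((k i : ℝ)) ^ 2) < (N : ℝ) ↔ ∑ i, k i ^ 2 < ((N ^ 2 : ℕ) : ℤ) := by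
  rw [← Real.sqrt_sq (Nat.cast_nonneg N),
    Real.sqrt_lt_sqrt_iff (Finset.sum_nonneg fun i _ => sq_nonneg _)]
  exact_mod_cast Iff.rfl

theorem setIntegral_box_ball_indicator {d : ℕ} {f : EuclideanSpace ℝ (Fin d) → ℝ}
    (hf : ∀ x, f x = if ‖x‖ ≤ 1 / 2 then 1 else 0) (g : EuclideanSpace ℝ (Fin d) → ℂ) :
    ∫ y in {y : EuclideanSpace ℝ (Fin d) | ∀ i, y i ∈ Set.Ico (-1 : ℝ) 1}, (f y : ℂ) * g y =
      ∫ y in Metric.closedBall (0 : EuclideanSpace ℝ (Fin d)) (1 / 2), g y := by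
  have h1 : (fun y => (f y : ℂ) * g y) =
      (Metric.closedBall (0 : EuclideanSpace ℝ (Fin d)) (1 / 2)).indicator g := by
    funext y
    rw [hf]
    by_cases h : ‖y‖ ≤ 1 / 2
    · rw [if_pos h, Set.indicator_of_mem (mem_closedBall_zero_iff.2 h), ofReal_one, one_mul]
    · rw [if_neg h, Set.indicator_of_notMem (fun h' => h (mem_closedBall_zero_iff.1 h')),
        ofReal_zero, zero_mul]
  rw [h1, setIntegral_indicator Metric.isClosed_closedBall.measurableSet]
  congr 2
  refine Set.inter_eq_right.2 fun y hy i => ?_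
  have h2 : |y i| ≤ 1 / 2 := (PiLp.norm_apply_le y i).trans (mem_closedBall_zero_iff.1 hy)
  rw [abs_le] at h2
  constructor <;> linarith

theorem exists_partial_sum_sub {d : ℕ} (hd : 5 ≤ d) {f : EuclideanSpace ℝ (Fin d) → ℝ}
    (hf : ∀ x, f x = if ‖x‖ ≤ 1 / 2 then 1 else 0) {c : (Fin d → ℤ) → ℂ}
    (hc : ∀ k : Fin d → ℤ, c k = (2 : ℂ) ^ (-(d : ℤ)) *
      ∫ y in {y : EuclideanSpace ℝ (Fin d) | ∀ i, y i ∈ Set.Ico (-1 : ℝ) 1},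
        (f y : ℂ) * cexp (-(I * (Real.pi : ℂ) * ∑ i, (k i : ℂ) * (y i : ℂ))))
    {S : ℕ → EuclideanSpace ℝ (Fin d) → ℂ}
    (hS : ∀ (N : ℕ) (x : EuclideanSpace ℝ (Fin d)), S N x =
      ∑' k : Fin d → ℤ,
        if Real.sqrt (∑ i, ((k i : ℝ)) ^ 2) < (N : ℝ) then
          c k * cexp (I * (Real.pi : ℂ) * ∑ i, (k i : ℂ) * (x i : ℂ))
        else 0) :
    ∃ a : ℂ, a ≠ 0 ∧ ∀ (x : EuclideanSpace ℝ (Fin d)) (ξ : Fin d → ℝ), (∀ i, x i = 2 * ξ i) →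
      ∀ N N' : ℕ, 1 ≤ N → N ≤ N' → S N' x - S N x = a * ∑ n ∈ Finset.Ico (N ^ 2) (N' ^ 2),
        (modWave (-((d : ℝ) + 1) / 4) (ballWave (((d : ℝ) - 1) / 2)) n : ℂ) * sphereSum ξ n := by
  obtain ⟨c₁, hc₁, hcoeff⟩ := exists_ball_coeff hd
  refine ⟨(2 : ℂ) ^ (-(d : ℤ)) * c₁, mul_ne_zero (zpow_ne_zero _ two_ne_zero)
    (by exact_mod_cast hc₁), ?_⟩
  intro x ξ hx N N' hN hNN'
  have hS' : ∀ N, S N x = ∑ n ∈ Finset.range (N ^ 2), ∑' k : Fin d → ℤ,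
      if ∑ i, k i ^ 2 = (n : ℤ) then
        c k * cexp (I * (Real.pi : ℂ) * ∑ i, (k i : ℂ) * (x i : ℂ)) else 0 := by
    intro N
    rw [hS, ← tsum_ite_sum_sq_lt]
    simp only [sqrt_sum_sq_lt_iff]
  rw [hS', hS', ← Finset.sum_Ico_eq_sub _ (Nat.pow_le_pow_left hNN' 2), Finset.mul_sum]
  refine Finset.sum_congr rfl fun n hn => ?_
  have hn0 : 0 < n := lt_of_lt_of_le (by positivity) (Finset.mem_Ico.1 hn).1
  rw [sphereSum, ← mul_assoc, ← tsum_mul_left]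
  refine tsum_congr fun k => ?_
  split_ifs with hk
  · have e : cexp (I * (Real.pi : ℂ) * ∑ i, (k i : ℂ) * (x i : ℂ)) = latticePhase ξ k := by
      rw [latticePhase]
      congr 1
      rw [Finset.mul_sum, Finset.mul_sum]
      refine Finset.sum_congr rfl fun i _ => ?_
      rw [hx]
      push_cast
      ring
    rw [e, hc, setIntegral_box_ball_indicator hf, hcoeff k n hn0 hk, modWave]
    push_cast
    ring
  · rw [mul_zero]

theorem exists_common_denominator {d : ℕ} {x : Fin d → ℝ} (hx : ∀ i, ∃ q : ℚ, x i = (q : ℝ)) :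
    ∃ (A : Fin d → ℤ) (B : ℕ), 0 < B ∧ ∀ i, x i = 2 * ((A i : ℝ) / B) := by
  choose q hq using hx
  have hD : 0 < ∏ i, (q i).den := Finset.prod_pos fun i _ => (q i).den_pos
  have hdvd : ∀ i, (q i).den ∣ ∏ i, (q i).den := fun i => Finset.dvd_prod_of_mem _ (Finset.mem_univ i)
  choose m hm using hdvd
  set D := ∏ i, (q i).den with hDdef
  refine ⟨fun i => (q i).num * m i, 2 * D, by positivity, fun i => ?_⟩
  have hd0 : ((q i).den : ℝ) ≠ 0 := by exact_mod_cast (q i).den_ne_zero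
  have hm0 : (m i : ℝ) ≠ 0 := by
    intro h
    have : m i = 0 := by exact_mod_cast h
    rw [hm i, this] at hD
    simp at hD
  have h1 : (D : ℝ) = (q i).den * m i := by exact_mod_cast hm i
  rw [hq, Rat.cast_def]
  push_cast
  rw [h1]
  field_simp

theorem eq_zero_of_dvd {A : ℤ} {B : ℕ} (hB : 0 < B) {x : ℝ} (hx : x ∈ Set.Ico (-1 : ℝ) 1)
    (h : x = 2 * ((A : ℝ) / B)) (hdvd : (B : ℤ) ∣ A) : A = 0 := by
  obtain ⟨t, rfl⟩ := hdvd
  have hBr : (B : ℝ) ≠ 0 := by exact_mod_cast hB.ne'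
  have h1 : x = 2 * (t : ℝ) := by
    rw [h]
    push_cast
    field_simp
  have h2 : (-1 : ℝ) ≤ 2 * (t : ℝ) := h1 ▸ hx.1
  have h3 : 2 * (t : ℝ) < 1 := h1 ▸ hx.2
  have h4 : (-1 : ℤ) ≤ 2 * t := by exact_mod_cast h2
  have h5 : 2 * t < 1 := by exact_mod_cast h3
  have : t = 0 := by omega
  rw [this, mul_zero]

theorem tendsto_sub_shift {s : ℕ → ℂ} {z L : ℂ} (h : Tendsto (fun N => s N - z) atTop (𝓝 L))
    (j : ℕ) : Tendsto (fun N => s (N + j) - s N) atTop (𝓝 0) := by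
  have := (h.comp (tendsto_add_atTop_nat j)).sub h
  rw [sub_self] at this
  refine this.congr fun N => ?_
  simp only [Function.comp_apply, sub_sub_sub_cancel_right]

end KuratsuboDivergence

open MeasureTheory
open scoped Classical

/-- Kuratsubo's third phenomenon: for `d ≥ 5`, the spherical partial sums `S_N` of the
multiple Fourier series of the (2-periodized) indicator `f°` of the ball of radius `1/2`
satisfy: `S_N(x) - f°(x)` diverges as `N → ∞` at every rational point `x ∈ [-1,1)^d`. -/
theorem fourier_spherical_partial_sum_diverges (d : ℕ) (hd : 5 ≤ d)
    (f : EuclideanSpace ℝ (Fin d) → ℝ)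
    (hf : ∀ x, f x = if ‖x‖ ≤ 1 / 2 then 1 else 0)
    (c : (Fin d → ℤ) → ℂ)
    (hc : ∀ k : Fin d → ℤ, c k = (2 : ℂ) ^ (-(d : ℤ)) *
      ∫ y in {y : EuclideanSpace ℝ (Fin d) | ∀ i, y i ∈ Set.Ico (-1 : ℝ) 1},
        (f y : ℂ) * Complex.exp (-(Complex.I * (Real.pi : ℂ) * ∑ i, (k i : ℂ) * (y i : ℂ))))
    (S : ℕ → EuclideanSpace ℝ (Fin d) → ℂ)
    (hS : ∀ (N : ℕ) (x : EuclideanSpace ℝ (Fin d)), S N x =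
      ∑' k : Fin d → ℤ,
        if Real.sqrt (∑ i, ((k i : ℝ)) ^ 2) < (N : ℝ) then
          c k * Complex.exp (Complex.I * (Real.pi : ℂ) * ∑ i, (k i : ℂ) * (x i : ℂ))
        else 0) :
    ∀ x : EuclideanSpace ℝ (Fin d), (∀ i, x i ∈ Set.Ico (-1 : ℝ) 1) →
      (∀ i, ∃ q : ℚ, x i = (q : ℝ)) →
      ¬ ∃ L : ℂ, Filter.Tendsto (fun N : ℕ => S N x - (f x : ℂ)) Filter.atTop (nhds L) := by
  intro x hx hxq ⟨L, hL⟩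
  obtain ⟨a, ha, hdiff⟩ := KuratsuboDivergence.exists_partial_sum_sub hd hf hc hS
  obtain ⟨A, B, hB, hxA⟩ := KuratsuboDivergence.exists_common_denominator hxq
  have hblock : ∀ j : ℕ, Filter.Tendsto (fun N : ℕ => ∑ n ∈ Finset.Ico (N ^ 2) ((N + j) ^ 2),
      (KuratsuboDivergence.modWave (-((d : ℝ) + 1) / 4)
        (KuratsuboDivergence.ballWave (((d : ℝ) - 1) / 2)) n : ℂ) *
        KuratsuboDivergence.sphereSum (fun i => (A i : ℝ) / B) n) Filter.atTop (nhds 0) := by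
    intro j
    have h := (KuratsuboDivergence.tendsto_sub_shift hL j).const_mul a⁻¹
    rw [mul_zero] at h
    refine h.congr' ?_
    filter_upwards [Filter.eventually_ge_atTop 1] with N hN
    rw [hdiff x _ hxA N (N + j) hN (Nat.le_add_right N j), inv_mul_cancel_left₀ ha]
  by_cases hA : ∃ i, ¬ (B : ℤ) ∣ A i
  · exact KuratsuboDivergence.false_of_tendsto_block hd A hB hA (hblock 4)
  · push Not at hA
    have h0 : ∀ i, A i = 0 := fun i =>
      KuratsuboDivergence.eq_zero_of_dvd hB (hx i) (hxA i) (hA i)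
    have h := hblock 2
    simp only [h0, Int.cast_zero, zero_div] at h
    exact KuratsuboDivergence.not_tendsto_block_origin hd h
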